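/- arXiv:math/0211419 — 2 statements merged into one kernel-verified Lean document; each statement's English description precedes it below -/
import Mathlib

section
/- The restriction of any universal LD^strong Laver function to the class of measurable cardinals that are not strong still witnesses LD^strong: if ℓ : Ord → V is a universal LD^strong Laver function and ℓ* is its restriction to the non-strong measurable cardinals, then for every strong cardinal κ the function ℓ*↾κ is a LD^strong_κ Laver function. -/
open FirstOrder

universe u

namespace LaverDiamond

/-- The relation symbols of the language of set theory: a single binary relation `mem`. -/
inductive memRel : ℕ → Type
  | mem : memRel 2

/-- The first-order language of set theory. -/
def SetLang : FirstOrder.Language := ⟨fun _ => Empty, memRel⟩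

/-- Any class of ZF-sets is a structure in the language of set theory, with the true
membership relation. -/
instance classStructure (M : Set ZFSet.{u}) : SetLang.Structure M where
  funMap := fun {_} f _ => f.elim
  RelMap := fun {_} r x => match r with
    | .mem => (x 0 : ZFSet) ∈ (x 1 : ZFSet)

/-- A (fully) elementary embedding from the class `M` to the class `N`, both classes of
ZF-sets equipped with the true membership relation.  It is coded by a global function
`j : ZFSet → ZFSet` mapping `M` into `N`, elementary for all first-order formulas
with parameters from `M`. -/
structure ClassEmb (M N : Set ZFSet.{u}) where
  j : ZFSet.{u} → ZFSet.{u}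
  maps : ∀ x, x ∈ M → j x ∈ N
  elem : ∀ {n : ℕ} (φ : SetLang.Formula (Fin n)) (v : Fin n → ZFSet.{u}) (hv : ∀ i, v i ∈ M),
    φ.Realize (fun i => (⟨v i, hv i⟩ : M)) ↔ φ.Realize (fun i => (⟨j (v i), maps _ (hv i)⟩ : N))

/-- The universe of all ZF-sets, as a class. -/
def V : Set ZFSet.{u} := Set.univ

/-- A transitive class of ZF-sets. -/
def TransClass (M : Set ZFSet.{u}) : Prop := ∀ x ∈ M, ∀ y ∈ x, y ∈ M

/-- `j` has critical point `κ`: `κ` is an ordinal, fixed below `κ`, with `j(κ) > κ`. -/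
def CritPt (j : ZFSet.{u} → ZFSet.{u}) (κ : ZFSet.{u}) : Prop :=
  κ.IsOrdinal ∧ κ ∈ j κ ∧ ∀ α : ZFSet, α.IsOrdinal → α ∈ κ → j α = α

/-- `x` is a member of the rank-initial segment `V_θ`. -/
def MemV (θ x : ZFSet.{u}) : Prop := x.rank < θ.rank

/-- `κ` is a cardinal: an ordinal not equinumerous with any smaller ordinal. -/
def IsCard (κ : ZFSet.{u}) : Prop :=
  κ.IsOrdinal ∧ ∀ β ∈ κ, Cardinal.mk β.toSet < Cardinal.mk κ.toSet

/-- `x ∈ H(θ⁺)`, i.e. `x` has hereditary size at most `θ`. -/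
def MemH (θ x : ZFSet.{u}) : Prop :=
  ∃ t : ZFSet, t.IsTransitive ∧ x ∈ t ∧ Cardinal.mk t.toSet ≤ Cardinal.mk θ.toSet

/-- `f` is a set-function with domain `θ` taking values in the class `M`. -/
def IsFuncInto (θ : ZFSet.{u}) (M : Set ZFSet.{u}) (f : ZFSet.{u}) : Prop :=
  (∀ p ∈ f, ∃ a b : ZFSet, a ∈ θ ∧ b ∈ M ∧ p = ZFSet.pair a b) ∧
  ∀ a ∈ θ, ∃! b : ZFSet, ZFSet.pair a b ∈ f

/-- The class `M` is closed under `θ`-sequences: `M^θ ⊆ M`. -/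
def SeqClosed (θ : ZFSet.{u}) (M : Set ZFSet.{u}) : Prop :=
  ∀ f : ZFSet, IsFuncInto θ M f → f ∈ M

/-- The set `M` is closed under `<κ`-sequences: `M^{<κ} ⊆ M`. -/
def SeqClosedLt (κ M : ZFSet.{u}) : Prop :=
  ∀ α : ZFSet, α ∈ κ → ∀ f : ZFSet, IsFuncInto α M.toSet f → f ∈ M

/-- `ℓ` is a partial function from `κ` to `V_κ` (coded as a set of Kuratowski pairs). -/
def IsPFun (κ ℓ : ZFSet.{u}) : Prop :=
  (∀ p ∈ ℓ, ∃ γ A : ZFSet, γ ∈ κ ∧ MemV κ A ∧ p = ZFSet.pair γ A) ∧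
  ∀ γ A B : ZFSet, ZFSet.pair γ A ∈ ℓ → ZFSet.pair γ B ∈ ℓ → A = B

/-- The set `r` is the restriction to `κ` of the class function `ℓ` (defined on the
ordinals below `κ`), coded as a set of Kuratowski pairs. -/
def RestrictEq (ℓ : ZFSet.{u} → ZFSet.{u}) (κ r : ZFSet.{u}) : Prop :=
  ∀ p : ZFSet, p ∈ r ↔ ∃ γ : ZFSet, γ ∈ κ ∧ p = ZFSet.pair γ (ℓ γ)

/-- The set `r` is the restriction to `κ` of the class function `ℓ` restricted further to
the class `D`. -/
def RestrictEqOn (ℓ : ZFSet.{u} → ZFSet.{u}) (D : Set ZFSet.{u}) (κ r : ZFSet.{u}) : Prop :=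
  ∀ p : ZFSet, p ∈ r ↔ ∃ γ : ZFSet, γ ∈ κ ∧ γ ∈ D ∧ p = ZFSet.pair γ (ℓ γ)

/-- The set `r` is the restriction to `δ` of the set partial function `ℓ`. -/
def RestrictSet (ℓ δ r : ZFSet.{u}) : Prop :=
  ∀ p : ZFSet, p ∈ r ↔ p ∈ ℓ ∧ ∃ γ A : ZFSet, γ ∈ δ ∧ p = ZFSet.pair γ A

/-! ### Supercompactness -/

/-- A `θ`-supercompactness embedding with critical point `κ`: an elementary embedding
`j : V → M` with `M` a transitive class closed under `θ`-sequences and `j(κ) > θ`. -/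
structure SCEmb (κ θ : ZFSet.{u}) where
  M : Set ZFSet.{u}
  trans : TransClass M
  e : ClassEmb V M
  crit : CritPt e.j κ
  closed : SeqClosed θ M
  big : θ ∈ e.j κ

/-- `κ` is `θ`-supercompact. -/
def SCAt (κ θ : ZFSet.{u}) : Prop := Nonempty (SCEmb κ θ)

/-- `κ` is supercompact: `θ`-supercompact for every cardinal `θ`. -/
def Supercompact (κ : ZFSet.{u}) : Prop := ∀ θ : ZFSet, IsCard θ → SCAt κ θ

/-- `ℓ` is a Laver function witnessing the Laver diamond `LD^sc_κ`. -/
def LDscFun (κ ℓ : ZFSet.{u}) : Prop :=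
  IsPFun κ ℓ ∧ ∀ θ A : ZFSet, IsCard θ → MemH θ A →
    ∃ E : SCEmb κ θ, ZFSet.pair κ A ∈ E.e.j ℓ

/-- The Laver diamond principle `LD^sc_κ`. -/
def LDsc (κ : ZFSet.{u}) : Prop := ∃ ℓ : ZFSet, LDscFun κ ℓ

/-- A universal `LD^sc` Laver function. -/
def UnivLDsc (ℓ : ZFSet.{u} → ZFSet.{u}) : Prop :=
  ∀ κ : ZFSet, Supercompact κ → ∃ r : ZFSet, RestrictEq ℓ κ r ∧ LDscFun κ r

/-! ### Strongness -/

/-- A `θ`-strongness embedding with critical point `κ`: an elementary `j : V → M` with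
`M` a transitive class and `V_θ ⊆ M`. -/
structure StrEmb (κ θ : ZFSet.{u}) where
  M : Set ZFSet.{u}
  trans : TransClass M
  e : ClassEmb V M
  crit : CritPt e.j κ
  vsub : ∀ x : ZFSet, MemV θ x → x ∈ M

/-- `κ` is `θ`-strong. -/
def StrongAt (κ θ : ZFSet.{u}) : Prop := Nonempty (StrEmb κ θ)

/-- `κ` is a strong cardinal. -/
def Strong (κ : ZFSet.{u}) : Prop := ∀ θ : ZFSet, θ.IsOrdinal → StrongAt κ θ

/-- `ℓ` witnesses the Laver diamond `LD^strong_κ`. -/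
def LDstrongFun (κ ℓ : ZFSet.{u}) : Prop :=
  IsPFun κ ℓ ∧ ∀ θ A : ZFSet, θ.IsOrdinal → MemV θ A →
    ∃ E : StrEmb κ θ, ZFSet.pair κ A ∈ E.e.j ℓ

/-- The Laver diamond principle `LD^strong_κ`. -/
def LDstrong (κ : ZFSet.{u}) : Prop := ∃ ℓ : ZFSet, LDstrongFun κ ℓ

/-- A universal `LD^strong` Laver function. -/
def UnivLDstrong (ℓ : ZFSet.{u} → ZFSet.{u}) : Prop :=
  ∀ κ : ZFSet, Strong κ → ∃ r : ZFSet, RestrictEq ℓ κ r ∧ LDstrongFun κ r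

/-! ### Measurability -/

/-- An embedding witnessing measurability of `κ`: an elementary `j : V → M`
with `M` a transitive class and critical point `κ`. -/
structure MeasEmb (κ : ZFSet.{u}) where
  M : Set ZFSet.{u}
  trans : TransClass M
  e : ClassEmb V M
  crit : CritPt e.j κ

/-- `κ` is a measurable cardinal. -/
def MeasurableCard (κ : ZFSet.{u}) : Prop := Nonempty (MeasEmb κ)

/-- `ℓ` witnesses the Laver diamond `LD^meas_κ`. -/
def LDmeasFun (κ ℓ : ZFSet.{u}) : Prop :=
  IsPFun κ ℓ ∧ ∀ A : ZFSet, MemH κ A → ∃ E : MeasEmb κ, ZFSet.pair κ A ∈ E.e.j ℓ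

/-- The Laver diamond principle `LD^meas_κ`. -/
def LDmeas (κ : ZFSet.{u}) : Prop := ∃ ℓ : ZFSet, LDmeasFun κ ℓ

/-- A universal `LD^meas` Laver function. -/
def UnivLDmeas (ℓ : ZFSet.{u} → ZFSet.{u}) : Prop :=
  ∀ κ : ZFSet, MeasurableCard κ → ∃ r : ZFSet, RestrictEq ℓ κ r ∧ LDmeasFun κ r

/-! ### Weak compactness -/

/-- `κ` is weakly compact: every transitive set `M` of size `κ` with `κ ∈ M` admits an
elementary embedding `j : M → N` into a transitive set `N` with critical point `κ`. -/
def WeaklyCompact (κ : ZFSet.{u}) : Prop :=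
  ∀ M : ZFSet, M.IsTransitive → Cardinal.mk M.toSet = Cardinal.mk κ.toSet → κ ∈ M →
    ∃ N : ZFSet, N.IsTransitive ∧ ∃ e : ClassEmb M.toSet N.toSet, CritPt e.j κ

/-- `ℓ` witnesses the Laver diamond `LD^wc_κ`. -/
def LDwcFun (κ ℓ : ZFSet.{u}) : Prop :=
  IsPFun κ ℓ ∧ ∀ A M : ZFSet, MemH κ A →
    M.IsTransitive → Cardinal.mk M.toSet = Cardinal.mk κ.toSet → κ ∈ M → A ∈ M → ℓ ∈ M →
    ∃ N : ZFSet, N.IsTransitive ∧ ∃ e : ClassEmb M.toSet N.toSet,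
      CritPt e.j κ ∧ ZFSet.pair κ A ∈ e.j ℓ

/-- The Laver diamond principle `LD^wc_κ`. -/
def LDwc (κ : ZFSet.{u}) : Prop := ∃ ℓ : ZFSet, LDwcFun κ ℓ

/-- A universal `LD^wc` Laver function. -/
def UnivLDwc (ℓ : ZFSet.{u} → ZFSet.{u}) : Prop :=
  ∀ κ : ZFSet, WeaklyCompact κ → ∃ r : ZFSet, RestrictEq ℓ κ r ∧ LDwcFun κ r

/-! ### Nice structures and unfoldability -/

/-- `M` is a nice structure for `κ`: a transitive set of size `κ`, closed under
`<κ`-sequences, with `κ ∈ M`. -/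
def Nice (κ M : ZFSet.{u}) : Prop :=
  M.IsTransitive ∧ Cardinal.mk M.toSet = Cardinal.mk κ.toSet ∧ SeqClosedLt κ M ∧ κ ∈ M

/-- `κ` is unfoldable: for every ordinal `θ`, every nice structure admits a
`θ`-unfoldability embedding. -/
def Unfoldable (κ : ZFSet.{u}) : Prop :=
  ∀ θ M : ZFSet, θ.IsOrdinal → Nice κ M →
    ∃ N : ZFSet, N.IsTransitive ∧ ∃ e : ClassEmb M.toSet N.toSet, CritPt e.j κ ∧ θ ∈ e.j κ

/-- `ℓ` witnesses the Laver diamond `LD^unf_κ`. -/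
def LDunfFun (κ ℓ : ZFSet.{u}) : Prop :=
  IsPFun κ ℓ ∧ ∀ θ A M : ZFSet, θ.IsOrdinal → MemH κ A →
    M.IsTransitive → Cardinal.mk M.toSet = Cardinal.mk κ.toSet → SeqClosedLt κ M →
    κ ∈ M → ℓ ∈ M → A ∈ M →
    ∃ N : ZFSet, N.IsTransitive ∧ ∃ e : ClassEmb M.toSet N.toSet,
      CritPt e.j κ ∧ θ ∈ e.j κ ∧ ZFSet.pair κ A ∈ e.j ℓ

/-- The Laver diamond principle `LD^unf_κ`. -/
def LDunf (κ : ZFSet.{u}) : Prop := ∃ ℓ : ZFSet, LDunfFun κ ℓ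

/-- `ℓ` witnesses the Laver diamond `LD^sunf_κ` for strong unfoldability. -/
def LDsunfFun (κ ℓ : ZFSet.{u}) : Prop :=
  IsPFun κ ℓ ∧ ∀ θ A M : ZFSet, IsCard θ → MemH θ A →
    M.IsTransitive → Cardinal.mk M.toSet = Cardinal.mk κ.toSet → SeqClosedLt κ M →
    κ ∈ M → ℓ ∈ M →
    ∃ N : ZFSet, N.IsTransitive ∧ (∀ x : ZFSet, MemV θ x → x ∈ N) ∧
      ∃ e : ClassEmb M.toSet N.toSet, CritPt e.j κ ∧ θ ∈ e.j κ ∧ ZFSet.pair κ A ∈ e.j ℓ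

/-! ### Ramsey cardinals -/

/-- `F` is a weakly amenable `M`-normal measure on `κ`. -/
def MNormalMeasure (κ M F : ZFSet.{u}) : Prop :=
  (∀ X ∈ F, X ⊆ κ ∧ X ∈ M) ∧ κ ∈ F ∧ (∅ : ZFSet) ∉ F ∧
  (∀ X Y : ZFSet, X ∈ F → Y ∈ F → X ∩ Y ∈ F) ∧
  (∀ X Y : ZFSet, X ∈ F → Y ∈ M → X ⊆ Y → Y ⊆ κ → Y ∈ F) ∧
  (∀ X : ZFSet, X ∈ M → X ⊆ κ → (X ∈ F ∨ κ \ X ∈ F)) ∧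
  (∀ ξ ∈ κ, ({ξ} : ZFSet) ∉ F) ∧
  (∀ γ f : ZFSet, γ ∈ κ → f ∈ M → IsFuncInto γ F.toSet f →
    ZFSet.sep (fun ξ => ∀ a X : ZFSet, ZFSet.pair a X ∈ f → ξ ∈ X) κ ∈ F) ∧
  (∀ f : ZFSet, f ∈ M → IsFuncInto κ F.toSet f →
    ZFSet.sep (fun ξ => ∀ a X : ZFSet, ZFSet.pair a X ∈ f → a ∈ ξ → ξ ∈ X) κ ∈ F) ∧
  (∀ D : ZFSet, D ∈ M → MemH κ D → F ∩ D ∈ M)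

/-- `j` is (isomorphic to) the ultrapower map of `M` by the `M`-measure `F` on `κ`, with
transitive (wellfounded) target `N`: `j` is elementary, has critical point `κ`, derives the
measure `F` at `κ`, and every element of `N` has the form `j(f)(κ)` for some function
`f ∈ M` with domain `κ`. -/
def IsUltrapowerMap (κ M F N : ZFSet.{u}) (j : ZFSet.{u} → ZFSet.{u}) : Prop :=
  N.IsTransitive ∧ (∃ e : ClassEmb M.toSet N.toSet, e.j = j) ∧ CritPt j κ ∧
  (∀ X : ZFSet, X ∈ M → X ⊆ κ → (X ∈ F ↔ κ ∈ j X)) ∧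
  (∀ y ∈ N, ∃ f : ZFSet, f ∈ M ∧ (∀ a ∈ κ, ∃! b : ZFSet, ZFSet.pair a b ∈ f) ∧
    ZFSet.pair κ y ∈ j f)

/-- A wellfounded iteration of `⟨M, F⟩` of length `δ`: a commuting system of elementary
embeddings between transitive models, starting at `⟨M, F⟩`, taking ultrapowers by the
image measures at successor steps and direct limits at limit stages. -/
structure Iteration (κ M F δ : ZFSet.{u}) where
  Mod : ZFSet.{u} → ZFSet.{u}
  Meas : ZFSet.{u} → ZFSet.{u}
  cp : ZFSet.{u} → ZFSet.{u}
  emb : ZFSet.{u} → ZFSet.{u} → ZFSet.{u} → ZFSet.{u}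
  mod_zero : Mod ∅ = M
  meas_zero : Meas ∅ = F
  cp_zero : cp ∅ = κ
  trans' : ∀ i : ZFSet, i ∈ δ → (Mod i).IsTransitive
  elem' : ∀ i k : ZFSet, i ∈ δ → k ∈ δ → i ∈ k →
    ∃ e : ClassEmb (Mod i).toSet (Mod k).toSet, e.j = emb i k
  comm : ∀ i k l : ZFSet, i ∈ δ → k ∈ δ → l ∈ δ → i ∈ k → k ∈ l →
    ∀ x ∈ Mod i, emb k l (emb i k x) = emb i l x
  cp_emb : ∀ i : ZFSet, i ∈ δ → i ≠ ∅ → cp i = emb ∅ i κ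
  succ' : ∀ i : ZFSet, i ∈ δ → insert i i ∈ δ →
    IsUltrapowerMap (cp i) (Mod i) (Meas i) (Mod (insert i i)) (emb i (insert i i)) ∧
    (∀ Y : ZFSet, Y ∈ Meas (insert i i) ↔
      ∃ D : ZFSet, D ∈ Mod i ∧ Y ∈ emb i (insert i i) (Meas i ∩ D))
  limit' : ∀ l : ZFSet, l ∈ δ → l ≠ ∅ → (∀ i ∈ l, insert i i ∈ l) →
    (∀ y ∈ Mod l, ∃ i : ZFSet, i ∈ l ∧ ∃ x, x ∈ Mod i ∧ emb i l x = y) ∧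
    (∀ Y : ZFSet, Y ∈ Meas l ↔
      ∃ i : ZFSet, i ∈ l ∧ ∃ D, D ∈ Mod i ∧ Y ∈ emb i l (Meas i ∩ D))

/-- `⟨M, F⟩` is iterable: all its iterations (of any ordinal length) are wellfounded,
i.e. realized by transitive models. -/
def Iterable (κ M F : ZFSet.{u}) : Prop :=
  ∀ δ : ZFSet, δ.IsOrdinal → Nonempty (Iteration κ M F δ)

/-! ### Constructibility -/

/-- `X` is a subset of `M` definable over `⟨M, ∈⟩` with parameters. -/
def DefinableSubset (M X : ZFSet.{u}) : Prop :=
  X ⊆ M ∧ ∃ (n : ℕ) (φ : SetLang.Formula (Fin (n + 1))) (v : Fin n → ZFSet.{u})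
    (hv : ∀ i, v i ∈ M.toSet),
    ∀ a : ZFSet, a ∈ X ↔ ∃ ha : a ∈ M.toSet,
      φ.Realize (Fin.cons (⟨a, ha⟩ : M.toSet) (fun i => (⟨v i, hv i⟩ : M.toSet)))

/-- The set of all subsets of `M` definable over `⟨M, ∈⟩` with parameters. -/
noncomputable def DefSet (M : ZFSet.{u}) : ZFSet.{u} :=
  ZFSet.sep (fun X => DefinableSubset M X) (ZFSet.powerset M)

/-- `h` codes the constructible hierarchy up to `δ`: a function with domain `δ` such that
`h(β) = ⋃_{γ<β} Def(h(γ))` for every `β < δ`. -/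
def IsLHierarchy (δ h : ZFSet.{u}) : Prop :=
  δ.IsOrdinal ∧
  (∀ p ∈ h, ∃ β y : ZFSet, β ∈ δ ∧ p = ZFSet.pair β y) ∧
  (∀ β ∈ δ, ∃! y : ZFSet, ZFSet.pair β y ∈ h) ∧
  ∀ β y : ZFSet, ZFSet.pair β y ∈ h →
    ∀ z : ZFSet, z ∈ y ↔ ∃ γ x : ZFSet, γ ∈ β ∧ ZFSet.pair γ x ∈ h ∧ z ∈ DefSet x

/-- `x` is constructible: it appears at some level of some constructible hierarchy. -/
def Constructible (x : ZFSet.{u}) : Prop :=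
  ∃ δ h β y : ZFSet, IsLHierarchy δ h ∧ ZFSet.pair β y ∈ h ∧ x ∈ y

/-- The axiom of constructibility `V = L`. -/
def VeqL : Prop := ∀ x : ZFSet.{u}, Constructible x

/-! ### Normal measures -/

/-- `U` is a normal measure on `κ`: a `κ`-complete nonprincipal ultrafilter on `κ`
closed under diagonal intersections. -/
def IsNormalMeasure (κ U : ZFSet.{u}) : Prop :=
  (∀ X ∈ U, X ⊆ κ) ∧ κ ∈ U ∧ (∅ : ZFSet) ∉ U ∧
  (∀ X Y : ZFSet, X ∈ U → Y ∈ U → X ∩ Y ∈ U) ∧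
  (∀ X Y : ZFSet, X ∈ U → X ⊆ Y → Y ⊆ κ → Y ∈ U) ∧
  (∀ X : ZFSet, X ⊆ κ → (X ∈ U ∨ κ \ X ∈ U)) ∧
  (∀ ξ ∈ κ, ({ξ} : ZFSet) ∉ U) ∧
  (∀ γ f : ZFSet, γ ∈ κ → IsFuncInto γ U.toSet f →
    ZFSet.sep (fun ξ => ∀ a X : ZFSet, ZFSet.pair a X ∈ f → ξ ∈ X) κ ∈ U) ∧
  (∀ f : ZFSet, IsFuncInto κ U.toSet f →
    ZFSet.sep (fun ξ => ∀ a X : ZFSet, ZFSet.pair a X ∈ f → a ∈ ξ → ξ ∈ X) κ ∈ U)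

end LaverDiamond

open LaverDiamond

namespace LaverDiamond

/-! ### Bounded formulas and their transfer along elementary embeddings -/

/-- Tuples of sets, presented as assignments of finitely many variables. -/
class Ctx (Γ : Type (u + 1)) where
  I : Type
  fin : Finite I
  val : Γ → I → ZFSet.{u}
  map : (ZFSet.{u} → ZFSet.{u}) → Γ → Γ
  val_map : ∀ f γ i, val (map f γ) i = f (val γ i)

instance ctxOne : Ctx.{u} ZFSet.{u} where
  I := Unit
  fin := inferInstance
  val := fun x _ => x
  map := fun f x => f x
  val_map := fun _ _ _ => rfl

instance ctxCons (Γ : Type (u + 1)) [c : Ctx.{u} Γ] : Ctx.{u} (ZFSet.{u} × Γ) where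
  I := Option c.I
  fin := have := c.fin; inferInstance
  val := fun p i => i.elim p.1 (c.val p.2)
  map := fun f p => (f p.1, c.map f p.2)
  val_map := by
    rintro f ⟨x, γ⟩ (_ | i)
    · rfl
    · exact c.val_map f γ i

section Bounded

variable {Γ Γ' : Type (u + 1)} [c : Ctx.{u} Γ] [c' : Ctx.{u} Γ']

/-- `f` selects some of the variables of a tuple. -/
def Proj (f : Γ → Γ') : Prop := ∃ σ : c'.I → c.I, ∀ γ i, c'.val (f γ) i = c.val γ (σ i)

theorem Proj.self : Proj (fun γ : Γ => γ) := ⟨fun i => i, fun _ _ => rfl⟩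

theorem Proj.fst {f : Γ → ZFSet.{u} × Γ'} (hf : Proj f) : Proj (fun γ => (f γ).1) :=
  let ⟨σ, hσ⟩ := hf
  ⟨fun _ => σ none, fun γ _ => hσ γ none⟩

theorem Proj.snd {f : Γ → ZFSet.{u} × Γ'} (hf : Proj f) : Proj (fun γ => (f γ).2) :=
  let ⟨σ, hσ⟩ := hf
  ⟨fun i => σ (some i), fun γ i => hσ γ (some i)⟩

/-- The predicate `Q` on tuples is expressible by a formula which is absolute between
transitive classes. -/
def Del (Q : Γ → Prop) : Prop :=
  ∃ φ : SetLang.Formula c.I, ∀ M : Set ZFSet.{u}, TransClass M → ∀ γ (h : ∀ i, c.val γ i ∈ M),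
    φ.Realize (fun i => (⟨c.val γ i, h i⟩ : M)) ↔ Q γ

/-- The atomic formula `t₁ ∈ t₂`. -/
def memFm {α : Type} {n : ℕ} (t₁ t₂ : SetLang.Term (α ⊕ Fin n)) : SetLang.BoundedFormula α n :=
  FirstOrder.Language.BoundedFormula.rel (memRel.mem : SetLang.Relations 2) ![t₁, t₂]

theorem Del.congr {Q R : Γ → Prop} (hQ : Del Q) (h : ∀ γ, R γ ↔ Q γ) : Del R :=
  let ⟨φ, hφ⟩ := hQ
  ⟨φ, fun M hM γ hγ => (hφ M hM γ hγ).trans (h γ).symm⟩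

theorem Del.mem {s t : Γ → ZFSet.{u}} (hs : Proj s) (ht : Proj t) :
    Del (fun γ => s γ ∈ t γ) := by
  obtain ⟨σ, hσ⟩ := hs
  obtain ⟨τ, hτ⟩ := ht
  refine ⟨memFm (.var (.inl (σ ()))) (.var (.inl (τ ()))), fun M _ γ h => ?_⟩
  have h1 : s γ = c.val γ (σ ()) := hσ γ ()
  have h2 : t γ = c.val γ (τ ()) := hτ γ ()
  beta_reduce
  rw [h1, h2]
  rfl

theorem Del.eq {s t : Γ → ZFSet.{u}} (hs : Proj s) (ht : Proj t) :
    Del (fun γ => s γ = t γ) := by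
  obtain ⟨σ, hσ⟩ := hs
  obtain ⟨τ, hτ⟩ := ht
  refine ⟨.equal (.var (.inl (σ ()))) (.var (.inl (τ ()))), fun M _ γ h => ?_⟩
  have h1 : s γ = c.val γ (σ ()) := hσ γ ()
  have h2 : t γ = c.val γ (τ ()) := hτ γ ()
  beta_reduce
  rw [h1, h2]
  exact Subtype.ext_iff

theorem Del.false : Del (fun _ : Γ => False) :=
  ⟨.falsum, fun _ _ _ _ => Iff.rfl⟩

theorem Del.imp {P Q : Γ → Prop} (hP : Del P) (hQ : Del Q) : Del (fun γ => P γ → Q γ) := by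
  obtain ⟨φ, hφ⟩ := hP
  obtain ⟨ψ, hψ⟩ := hQ
  refine ⟨φ.imp ψ, fun M hM γ h => ?_⟩
  beta_reduce
  rw [← hφ M hM γ h, ← hψ M hM γ h]
  rfl

theorem Del.not {P : Γ → Prop} (hP : Del P) : Del (fun γ => ¬ P γ) := hP.imp .false

theorem Del.and {P Q : Γ → Prop} (hP : Del P) (hQ : Del Q) : Del (fun γ => P γ ∧ Q γ) :=
  (hP.imp hQ.not).not.congr fun γ => by tauto

theorem Del.or {P Q : Γ → Prop} (hP : Del P) (hQ : Del Q) : Del (fun γ => P γ ∨ Q γ) :=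
  (hP.not.imp hQ).congr fun γ => by tauto

theorem Del.iff {P Q : Γ → Prop} (hP : Del P) (hQ : Del Q) : Del (fun γ => P γ ↔ Q γ) :=
  ((hP.imp hQ).and (hQ.imp hP)).congr fun γ => by tauto

/-- Quantification over the first variable. -/
def allFst {I : Type} (φ : SetLang.Formula (Option I)) : SetLang.Formula I :=
  (FirstOrder.Language.BoundedFormula.relabel (n := 1) (k := 0)
    (fun o : Option I => o.elim (Sum.inr 0) Sum.inl) φ).all

theorem realize_allFst {I : Type} (φ : SetLang.Formula (Option I)) {M : Set ZFSet.{u}}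
    (v : I → M) : (allFst φ).Realize v ↔ ∀ x : M, φ.Realize (fun o => o.elim x v) := by
  unfold allFst FirstOrder.Language.Formula.Realize
  rw [FirstOrder.Language.BoundedFormula.realize_all]
  refine forall_congr' fun x => ?_
  rw [FirstOrder.Language.BoundedFormula.realize_relabel]
  refine iff_of_eq ?_
  congr 1
  · funext o
    rcases o with _ | i <;> rfl
  · exact Subsingleton.elim _ _

theorem val_cons_mem {M : Set ZFSet.{u}} {γ : Γ} (h : ∀ i, c.val γ i ∈ M) {x : ZFSet.{u}}
    (hx : x ∈ M) : ∀ i, (ctxCons Γ).val (x, γ) i ∈ M := by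
  rintro (_ | i)
  · exact hx
  · exact h i

theorem realize_allFst_iff {Q : ZFSet.{u} × Γ → Prop} {φ : SetLang.Formula (Option c.I)}
    {M : Set ZFSet.{u}} (hφ : ∀ γ (h : ∀ i, (ctxCons Γ).val γ i ∈ M),
      φ.Realize (fun i : Option c.I => (⟨(ctxCons Γ).val γ i, h i⟩ : M)) ↔ Q γ)
    {γ : Γ} (h : ∀ i, c.val γ i ∈ M) :
    (allFst φ).Realize (fun i => (⟨c.val γ i, h i⟩ : M)) ↔ ∀ x ∈ M, Q (x, γ) := by
  rw [realize_allFst]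
  have key : ∀ x : M, (φ.Realize fun o => o.elim x (fun i => (⟨c.val γ i, h i⟩ : M))) ↔
      Q (x, γ) := by
    intro x
    rw [← hφ _ (val_cons_mem h x.2)]
    refine iff_of_eq (congrArg _ (funext ?_))
    rintro (_ | i) <;> rfl
  exact ⟨fun H x hx => (key ⟨x, hx⟩).1 (H _), fun H x => (key x).2 (H x x.2)⟩

theorem Del.ball {Q : ZFSet.{u} → Γ → Prop} {t : Γ → ZFSet.{u}} (ht : Proj t)
    (hQ : Del (fun p : ZFSet.{u} × Γ => Q p.1 p.2)) : Del (fun γ => ∀ x, x ∈ t γ → Q x γ) := by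
  have ht' : Proj (fun p : ZFSet.{u} × Γ => t p.2) := by
    obtain ⟨σ, hσ⟩ := ht
    exact ⟨fun i => some (σ i), fun p i => hσ p.2 i⟩
  obtain ⟨φ, hφ⟩ := (Del.mem (Proj.fst Proj.self) ht').imp hQ
  refine ⟨allFst φ, fun M hM γ h => ?_⟩
  have htM : t γ ∈ M := by
    obtain ⟨σ, hσ⟩ := ht
    have : t γ = c.val γ (σ ()) := hσ γ ()
    exact this ▸ h _
  rw [realize_allFst_iff (hφ M hM) h]
  exact ⟨fun H x hx => H x (hM _ htM _ hx) hx, fun H x _ hx => H x hx⟩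

theorem Del.bex {Q : ZFSet.{u} → Γ → Prop} {t : Γ → ZFSet.{u}} (ht : Proj t)
    (hQ : Del (fun p : ZFSet.{u} × Γ => Q p.1 p.2)) : Del (fun γ => ∃ x, x ∈ t γ ∧ Q x γ) :=
  (Del.ball (Q := fun x γ => ¬ Q x γ) ht hQ.not).not.congr fun γ => by push Not; rfl

theorem Del.subset {s t : Γ → ZFSet.{u}} (hs : Proj s) (ht : Proj t) :
    Del (fun γ => s γ ⊆ t γ) := by
  have ht' : Proj (fun p : ZFSet.{u} × Γ => t p.2) := by
    obtain ⟨σ, hσ⟩ := ht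
    exact ⟨fun i => some (σ i), fun p i => hσ p.2 i⟩
  exact (Del.ball hs (Del.mem (Proj.fst Proj.self) ht')).congr fun γ => Iff.rfl

theorem Proj.comp_snd {t : Γ → Γ'} (ht : Proj t) : Proj (fun p : ZFSet.{u} × Γ => t p.2) := by
  obtain ⟨σ, hσ⟩ := ht
  exact ⟨fun i => some (σ i), fun p i => hσ p.2 i⟩

theorem Proj.cons {s : Γ → ZFSet.{u}} {t : Γ → Γ'} (hs : Proj s) (ht : Proj t) :
    Proj (fun γ => (s γ, t γ)) := by
  obtain ⟨σ, hσ⟩ := hs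
  obtain ⟨τ, hτ⟩ := ht
  refine ⟨fun i => Option.elim i (σ ()) τ, fun γ i => ?_⟩
  rcases i with _ | i
  · exact hσ γ ()
  · exact hτ γ i

theorem Del.comp {Q : Γ' → Prop} (hQ : Del Q) {f : Γ → Γ'} (hf : Proj f) :
    Del (fun γ => Q (f γ)) := by
  obtain ⟨φ, hφ⟩ := hQ
  obtain ⟨σ, hσ⟩ := hf
  refine ⟨φ.relabel σ, fun M hM γ h => ?_⟩
  beta_reduce
  rw [FirstOrder.Language.Formula.realize_relabel,
    ← hφ M hM (f γ) (fun i => by rw [hσ]; exact h _)]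
  refine iff_of_eq (congrArg _ (funext fun i => Subtype.ext ?_))
  exact (hσ γ i).symm

theorem Del.eq_pair {s a b : Γ → ZFSet.{u}} (hs : Proj s) (ha : Proj a) (hb : Proj b) :
    Del (fun γ => s γ = ZFSet.pair (a γ) (b γ)) := by
  have key : ∀ s a b : ZFSet.{u}, s = ZFSet.pair a b ↔
      (∃ x ∈ s, a ∈ x ∧ ∀ y ∈ x, y = a) ∧ (∃ x ∈ s, a ∈ x ∧ b ∈ x ∧ ∀ y ∈ x, y = a ∨ y = b) ∧
      ∀ x ∈ s, (a ∈ x ∧ ∀ y ∈ x, y = a) ∨ (a ∈ x ∧ b ∈ x ∧ ∀ y ∈ x, y = a ∨ y = b) := by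
    intro s a b
    have e1 : ∀ x : ZFSet.{u}, (a ∈ x ∧ ∀ y ∈ x, y = a) ↔ x = {a} := by
      intro x
      constructor
      · rintro ⟨h1, h2⟩
        ext y
        rw [ZFSet.mem_singleton]
        exact ⟨h2 y, fun h => h ▸ h1⟩
      · rintro rfl
        simp
    have e2 : ∀ x : ZFSet.{u}, (a ∈ x ∧ b ∈ x ∧ ∀ y ∈ x, y = a ∨ y = b) ↔ x = {a, b} := by
      intro x
      constructor
      · rintro ⟨h1, h2, h3⟩
        ext y
        rw [ZFSet.mem_pair]
        exact ⟨h3 y, fun h => h.elim (fun h => h ▸ h1) (fun h => h ▸ h2)⟩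
      · rintro rfl
        simp
    simp only [e1, e2]
    constructor
    · rintro rfl
      simp [ZFSet.pair]
    · rintro ⟨⟨x, hx, rfl⟩, ⟨y, hy, rfl⟩, h⟩
      ext z
      simp only [ZFSet.pair, ZFSet.mem_pair]
      exact ⟨h z, fun h => h.elim (fun h => h ▸ hx) (fun h => h ▸ hy)⟩
  refine Del.congr ?_ (fun γ => key _ _ _)
  have hs' := hs.comp_snd
  have ha' := ha.comp_snd
  have hb' := hb.comp_snd
  have ha'' := ha'.comp_snd
  have hb'' := hb'.comp_snd
  repeat' first
    | assumption | apply Proj.self | apply Proj.fst | apply Proj.snd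
    | apply Del.ball | apply Del.bex | apply Del.and | apply Del.or
    | apply Del.mem | apply Del.eq

theorem Del.pair_mem {a b t : Γ → ZFSet.{u}} (ha : Proj a) (hb : Proj b) (ht : Proj t) :
    Del (fun γ => ZFSet.pair (a γ) (b γ) ∈ t γ) := by
  have : Del (fun γ => ∃ c, c ∈ t γ ∧ c = ZFSet.pair (a γ) (b γ)) :=
    Del.bex ht (Del.eq_pair (Proj.fst Proj.self) ha.comp_snd hb.comp_snd)
  exact this.congr fun γ => by simp

theorem Del.pair_pair_mem {X a b t : Γ → ZFSet.{u}} (hX : Proj X) (ha : Proj a) (hb : Proj b)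
    (ht : Proj t) : Del (fun γ => ZFSet.pair (X γ) (ZFSet.pair (a γ) (b γ)) ∈ t γ) := by
  have : Del (fun γ => ∃ c, c ∈ t γ ∧ ∃ s, s ∈ c ∧ ∃ q, q ∈ s ∧
      q = ZFSet.pair (a γ) (b γ) ∧ c = ZFSet.pair (X γ) q) := by
    refine Del.bex ht (Del.bex (Proj.fst Proj.self) (Del.bex (Proj.fst Proj.self)
      (Del.and (Del.eq_pair (Proj.fst Proj.self) ha.comp_snd.comp_snd.comp_snd
        hb.comp_snd.comp_snd.comp_snd) (Del.eq_pair ?_ hX.comp_snd.comp_snd.comp_snd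
          (Proj.fst Proj.self)))))
    exact Proj.fst (Proj.snd (Proj.snd Proj.self))
  refine this.congr fun γ => ⟨fun h => ⟨_, h, {X γ, ZFSet.pair (a γ) (b γ)}, ?_, _, ?_, rfl, rfl⟩,
    ?_⟩
  · simp [ZFSet.pair]
  · simp
  · rintro ⟨c, hc, _, _, q, _, rfl, rfl⟩
    exact hc

/-- Elementarity for formulas with variables from an arbitrary finite type. -/
theorem ClassEmb.elem_finite {M N : Set ZFSet.{u}} (e : ClassEmb M N) {I : Type} [Finite I]
    (φ : SetLang.Formula I) (v : I → ZFSet.{u}) (hv : ∀ i, v i ∈ M) :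
    φ.Realize (fun i => (⟨v i, hv i⟩ : M)) ↔
      φ.Realize (fun i => (⟨e.j (v i), e.maps _ (hv i)⟩ : N)) := by
  obtain ⟨n, ⟨f⟩⟩ := Finite.exists_equiv_fin I
  have := e.elem (φ.relabel f) (fun i => v (f.symm i)) (fun i => hv _)
  rw [FirstOrder.Language.Formula.realize_relabel, FirstOrder.Language.Formula.realize_relabel]
    at this
  convert this using 2
  · funext i; simp
  · funext i; simp

theorem mem_V (x : ZFSet.{u}) : x ∈ V.{u} := trivial

theorem transClass_V : TransClass V.{u} := fun _ _ _ _ => mem_V _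

/-- Bounded formulas are preserved by elementary embeddings into transitive classes. -/
theorem Del.transfer {Q : Γ → Prop} (hQ : Del Q) {M : Set ZFSet.{u}} (hM : TransClass M)
    (e : ClassEmb V M) (γ : Γ) : Q γ ↔ Q (c.map e.j γ) := by
  obtain ⟨φ, hφ⟩ := hQ
  have := c.fin
  have hm : ∀ i, c.val (c.map e.j γ) i ∈ M := fun i => by
    rw [c.val_map]; exact e.maps _ (mem_V _)
  rw [← hφ V transClass_V γ (fun _ => mem_V _), ← hφ M hM _ hm, e.elem_finite]
  refine iff_of_eq (congrArg _ (funext fun i => Subtype.ext ?_))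
  exact (c.val_map _ _ _).symm

/-- A bounded formula preceded by an unbounded universal quantifier is preserved by elementary
embeddings into transitive classes. -/
theorem Del.transfer_forall {Q : ZFSet.{u} → Γ → Prop}
    (hQ : Del (fun p : ZFSet.{u} × Γ => Q p.1 p.2)) {M : Set ZFSet.{u}} (hM : TransClass M)
    (e : ClassEmb V M) (γ : Γ) (h : ∀ x, Q x γ) : ∀ x ∈ M, Q x (c.map e.j γ) := by
  obtain ⟨φ, hφ⟩ := hQ
  have := c.fin
  have hm : ∀ i, c.val (c.map e.j γ) i ∈ M := fun i => by
    rw [c.val_map]; exact e.maps _ (mem_V _)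
  have h1 : (allFst φ).Realize (fun i => (⟨c.val γ i, mem_V _⟩ : (V : Set ZFSet.{u}))) := by
    rw [realize_allFst_iff (hφ V transClass_V) (fun _ => mem_V _)]
    exact fun x _ => h x
  rw [e.elem_finite _ _ (fun _ => mem_V _)] at h1
  have h2 : (allFst φ).Realize (fun i => (⟨c.val (c.map e.j γ) i, hm i⟩ : M)) := by
    convert h1 using 3
    exact c.val_map _ _ _
  rw [realize_allFst_iff (hφ M hM) hm] at h2
  exact h2

end Bounded

/-! ### Set-sized extenders -/

/-- `e` codes a set-sized extender on `D` with index set `B`, in the sense that `pair X a ∈ e`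
stands for `a ∈ j X`. The sets `PD` and `RR` bound the quantification over subsets of `D`
and over ranking functions of relations on `D`. -/
def SetExt (κ D PD B e RR : ZFSet.{u}) : Prop :=
  (∀ x ∈ D, ∀ y ∈ x, y ∈ D) ∧
  (∀ x ∈ D, ∀ y ∈ D, ∃ z ∈ D, z = ZFSet.pair x y) ∧
  (κ ∈ D) ∧
  (∀ x ∈ B, ∀ y ∈ x, y ∈ B) ∧
  (∀ x ∈ B, ∀ y ∈ B, ∃ z ∈ B, z = ZFSet.pair x y) ∧
  (κ ∈ B) ∧
  (∀ X ∈ PD, ∀ Y ∈ PD, ∀ Z ∈ PD, (∀ x ∈ D, x ∈ X → x ∈ Y → x ∈ Z) →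
    ∀ a ∈ B, ZFSet.pair X a ∈ e → ZFSet.pair Y a ∈ e → ZFSet.pair Z a ∈ e) ∧
  (∀ X ∈ PD, ∀ Y ∈ PD, (∀ x ∈ D, x ∈ X ∨ x ∈ Y) →
    ∀ a ∈ B, ZFSet.pair X a ∈ e ∨ ZFSet.pair Y a ∈ e) ∧
  (∀ X ∈ PD, ∀ Y ∈ PD, (∀ x ∈ D, x ∈ X → x ∉ Y) →
    ∀ a ∈ B, ZFSet.pair X a ∈ e → ZFSet.pair Y a ∉ e) ∧
  (∀ P ∈ PD, (∀ x ∈ D, ZFSet.pair x x ∈ P) →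
    ∀ a ∈ B, ZFSet.pair P (ZFSet.pair a a) ∈ e) ∧
  (∀ P ∈ PD, (∀ z ∈ D, ∀ x ∈ D, ∀ y ∈ D, z = ZFSet.pair x y → ZFSet.pair z x ∈ P) →
    ∀ c ∈ B, ∀ a ∈ B, ∀ b ∈ B, c = ZFSet.pair a b → ZFSet.pair P (ZFSet.pair c a) ∈ e) ∧
  (∀ P ∈ PD, (∀ z ∈ D, ∀ x ∈ D, ∀ y ∈ D, z = ZFSet.pair x y → ZFSet.pair z y ∈ P) →
    ∀ c ∈ B, ∀ a ∈ B, ∀ b ∈ B, c = ZFSet.pair a b → ZFSet.pair P (ZFSet.pair c b) ∈ e) ∧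
  (∀ P ∈ PD, (∀ x ∈ D, ∃ y ∈ D, ZFSet.pair x y ∈ P) →
    ∀ a ∈ B, ∃ b ∈ B, ZFSet.pair P (ZFSet.pair a b) ∈ e) ∧
  (∀ P ∈ PD, ∀ X ∈ PD, ∀ Y ∈ PD,
    (∀ x ∈ D, ∀ y ∈ D, ZFSet.pair x y ∈ P → x ∈ X → y ∈ Y) →
    ∀ a ∈ B, ∀ b ∈ B, ZFSet.pair P (ZFSet.pair a b) ∈ e → ZFSet.pair X a ∈ e →
      ZFSet.pair Y b ∈ e) ∧
  (∀ P ∈ PD, ∀ Q ∈ PD, ∀ R ∈ PD, (∀ x ∈ D, ∀ y ∈ D, ∀ z ∈ D,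
      ZFSet.pair x y ∈ P → ZFSet.pair y z ∈ Q → ZFSet.pair x z ∈ R) →
    ∀ a ∈ B, ∀ b ∈ B, ∀ c ∈ B, ZFSet.pair P (ZFSet.pair a b) ∈ e →
      ZFSet.pair Q (ZFSet.pair b c) ∈ e → ZFSet.pair R (ZFSet.pair a c) ∈ e) ∧
  (∀ P ∈ PD, ∀ Q ∈ PD, ∀ X ∈ PD, (∀ x ∈ D, ∀ y ∈ D,
      ZFSet.pair x y ∈ P → ZFSet.pair x y ∈ Q → x ∈ X) →
    ∀ a ∈ B, ∀ b ∈ B, ZFSet.pair P (ZFSet.pair a b) ∈ e →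
      ZFSet.pair Q (ZFSet.pair a b) ∈ e → ZFSet.pair X a ∈ e) ∧
  (∀ P ∈ PD, ∀ Q ∈ PD, ∀ X ∈ PD, ∀ R ∈ PD, (∀ x ∈ D, ∀ y ∈ D, ∀ z ∈ D,
      ZFSet.pair x y ∈ P → ZFSet.pair x z ∈ Q → x ∈ X → ZFSet.pair y z ∈ R) →
    ∀ a ∈ B, ∀ b ∈ B, ∀ c ∈ B, ZFSet.pair P (ZFSet.pair a b) ∈ e →
      ZFSet.pair Q (ZFSet.pair a c) ∈ e → ZFSet.pair X a ∈ e → ZFSet.pair R (ZFSet.pair b c) ∈ e) ∧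
  (∀ P ∈ PD, (∀ x ∈ D, ∀ y ∈ D, x ∈ y → ZFSet.pair x y ∈ P) →
    ∀ a ∈ B, ∀ b ∈ B, a ∈ b → ZFSet.pair P (ZFSet.pair a b) ∈ e) ∧
  (∀ P ∈ PD, (∀ x ∈ D, ∀ y ∈ D, ZFSet.pair x y ∈ P → x ∈ y) →
    ∀ a ∈ B, ∀ b ∈ B, ZFSet.pair P (ZFSet.pair a b) ∈ e → a ∈ b) ∧
  (∀ R ∈ PD, (∀ X ∈ PD, (∃ x ∈ X, x ∈ D) → ∃ x ∈ X, ∀ y ∈ X, ZFSet.pair y x ∉ R) →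
    ∃ ρ ∈ RR, (∀ a ∈ B, ∀ s ∈ RR, ∀ t ∈ RR, ZFSet.pair a s ∈ ρ → ZFSet.pair a t ∈ ρ → s = t) ∧
      ∀ a ∈ B, ∀ b ∈ B, ZFSet.pair R (ZFSet.pair a b) ∈ e →
        ∃ s ∈ RR, ∃ t ∈ RR, ZFSet.pair a s ∈ ρ ∧ ZFSet.pair b t ∈ ρ ∧ s ∈ t) ∧
  (∀ α ∈ κ, ∀ a ∈ B, ZFSet.pair α a ∈ e ↔ a ∈ α) ∧
  (ZFSet.pair κ κ ∈ e)

theorem del_setExt : Del (fun p : ZFSet.{u} × ZFSet.{u} × ZFSet.{u} × ZFSet.{u} × ZFSet.{u} ×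
    ZFSet.{u} => SetExt p.1 p.2.1 p.2.2.1 p.2.2.2.1 p.2.2.2.2.1 p.2.2.2.2.2) := by
  unfold SetExt
  repeat' with_reducible first
    | apply Proj.self | apply Proj.fst | apply Proj.snd
    | apply Del.ball | apply Del.bex | apply Del.and | apply Del.or | apply Del.iff
    | apply Del.not | apply Del.imp
    | apply Del.pair_pair_mem | apply Del.pair_mem | apply Del.eq_pair
    | apply Del.mem | apply Del.eq

theorem Del.setExt {Γ : Type (u + 1)} [c : Ctx.{u} Γ] {κ D PD B e RR : Γ → ZFSet.{u}}
    (hκ : Proj κ) (hD : Proj D) (hP : Proj PD) (hB : Proj B) (he : Proj e) (hR : Proj RR) :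
    Del (fun γ => SetExt (κ γ) (D γ) (PD γ) (B γ) (e γ) (RR γ)) :=
  del_setExt.comp (hκ.cons (hD.cons (hP.cons (hB.cons (he.cons hR)))))

/-! ### Systems of measures and their ultrapowers -/

/-- A binary relation as a predicate on Kuratowski pairs. -/
def OnPair (R : ZFSet.{u} → ZFSet.{u} → Prop) (z : ZFSet.{u}) : Prop :=
  ∃ x y, z = ZFSet.pair x y ∧ R x y

theorem onPair_pair {R : ZFSet.{u} → ZFSet.{u} → Prop} {x y : ZFSet.{u}} :
    OnPair R (ZFSet.pair x y) ↔ R x y := by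
  constructor
  · rintro ⟨x', y', h, hR⟩
    obtain ⟨rfl, rfl⟩ := ZFSet.pair_inj.1 h
    exact hR
  · exact fun h => ⟨x, y, rfl, h⟩

/-- A coherent system of ultrafilters `mu a` on `D`, indexed by `a ∈ B`, which is wellfounded. -/
structure MeasSys (D B : ZFSet.{u}) (mu : ZFSet.{u} → (ZFSet.{u} → Prop) → Prop) : Prop where
  trans_dom : ∀ {x y}, x ∈ D → y ∈ x → y ∈ D
  pair_dom : ∀ {x y}, x ∈ D → y ∈ D → ZFSet.pair x y ∈ D
  trans_idx : ∀ {x y}, x ∈ B → y ∈ x → y ∈ B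
  pair_idx : ∀ {x y}, x ∈ B → y ∈ B → ZFSet.pair x y ∈ B
  mono₂ : ∀ {a P Q S}, a ∈ B → (∀ x ∈ D, P x → Q x → S x) → mu a P → mu a Q → mu a S
  cover : ∀ {a P Q}, a ∈ B → (∀ x ∈ D, P x ∨ Q x) → mu a P ∨ mu a Q
  disj : ∀ {a P Q}, a ∈ B → (∀ x ∈ D, P x → ¬ Q x) → mu a P → ¬ mu a Q
  diag : ∀ {a R}, a ∈ B → (∀ x ∈ D, R x x) → mu (ZFSet.pair a a) (OnPair R)
  fst : ∀ {a b R}, a ∈ B → b ∈ B → (∀ x ∈ D, ∀ y ∈ D, R (ZFSet.pair x y) x) →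
    mu (ZFSet.pair (ZFSet.pair a b) a) (OnPair R)
  snd : ∀ {a b R}, a ∈ B → b ∈ B → (∀ x ∈ D, ∀ y ∈ D, R (ZFSet.pair x y) y) →
    mu (ZFSet.pair (ZFSet.pair a b) b) (OnPair R)
  total : ∀ {a R}, a ∈ B → (∀ x ∈ D, ∃ y ∈ D, R x y) → ∃ b ∈ B, mu (ZFSet.pair a b) (OnPair R)
  push : ∀ {a b P Q R}, a ∈ B → b ∈ B → (∀ x ∈ D, ∀ y ∈ D, R x y → P x → Q y) →
    mu (ZFSet.pair a b) (OnPair R) → mu a P → mu b Q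
  comp : ∀ {a b c R S T}, a ∈ B → b ∈ B → c ∈ B →
    (∀ x ∈ D, ∀ y ∈ D, ∀ z ∈ D, R x y → S y z → T x z) →
    mu (ZFSet.pair a b) (OnPair R) → mu (ZFSet.pair b c) (OnPair S) →
    mu (ZFSet.pair a c) (OnPair T)
  parallel : ∀ {a b R S P}, a ∈ B → b ∈ B → (∀ x ∈ D, ∀ y ∈ D, R x y → S x y → P x) →
    mu (ZFSet.pair a b) (OnPair R) → mu (ZFSet.pair a b) (OnPair S) → mu a P
  fan : ∀ {a b c R S T P}, a ∈ B → b ∈ B → c ∈ B →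
    (∀ x ∈ D, ∀ y ∈ D, ∀ z ∈ D, R x y → S x z → P x → T y z) →
    mu (ZFSet.pair a b) (OnPair R) → mu (ZFSet.pair a c) (OnPair S) → mu a P →
    mu (ZFSet.pair b c) (OnPair T)
  mem_iff : ∀ {a b}, a ∈ B → b ∈ B → (mu (ZFSet.pair a b) (OnPair (· ∈ ·)) ↔ a ∈ b)
  wf : ∀ {R : ZFSet.{u} → ZFSet.{u} → Prop}, WellFounded R → ∀ f : ℕ → ZFSet.{u},
    (∀ n, f n ∈ B) → ¬ ∀ n, mu (ZFSet.pair (f (n + 1)) (f n)) (OnPair R)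

theorem SetExt.measSys {κ D PD B e RR : ZFSet.{u}} (h : SetExt κ D PD B e RR)
    (hPD : ∀ X ⊆ D, X ∈ PD) :
    MeasSys D B (fun a P => ZFSet.pair (ZFSet.sep P D) a ∈ e) := by
  obtain ⟨trans_dom, pair_dom, mem_dom, trans_idx, pair_idx, mem_idx, mono, compl, disj, diag,
    fst, snd, total, push, comp, parallel, fan, of_mem, to_mem, ranked, crit_lt, crit_self⟩ := h
  have hS : ∀ P, ZFSet.sep P D ∈ PD := fun P => hPD _ fun x hx => (ZFSet.mem_sep.1 hx).1
  have pD : ∀ {x y}, x ∈ D → y ∈ D → ZFSet.pair x y ∈ D := fun {x y} hx hy => by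
    obtain ⟨z, hz, rfl⟩ := pair_dom x hx y hy
    exact hz
  have pB : ∀ {x y}, x ∈ B → y ∈ B → ZFSet.pair x y ∈ B := fun {x y} hx hy => by
    obtain ⟨z, hz, rfl⟩ := pair_idx x hx y hy
    exact hz
  have mS : ∀ {R x y}, x ∈ D → y ∈ D → (ZFSet.pair x y ∈ ZFSet.sep (OnPair R) D ↔ R x y) :=
    fun {R x y} hx hy => by
      rw [ZFSet.mem_sep, onPair_pair]
      exact ⟨fun h => h.2, fun h => ⟨pD hx hy, h⟩⟩
  have mP : ∀ {P : ZFSet.{u} → Prop} {x}, x ∈ D → (x ∈ ZFSet.sep P D ↔ P x) :=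
    fun {P x} hx => by
      rw [ZFSet.mem_sep]
      exact ⟨fun h => h.2, fun h => ⟨hx, h⟩⟩
  constructor
  · exact fun {x y} hx hy => trans_dom x hx y hy
  · exact pD
  · exact fun {x y} hx hy => trans_idx x hx y hy
  · exact pB
  · intro a P Q S ha H
    refine mono _ (hS P) _ (hS Q) _ (hS S) (fun x hx => ?_) a ha
    rw [mP hx, mP hx, mP hx]
    exact H x hx
  · intro a P Q ha H
    refine compl _ (hS P) _ (hS Q) (fun x hx => ?_) a ha
    rw [mP hx, mP hx]
    exact H x hx
  · intro a P Q ha H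
    refine disj _ (hS P) _ (hS Q) (fun x hx => ?_) a ha
    rw [mP hx, mP hx]
    exact H x hx
  · intro a R ha H
    refine diag _ (hS _) (fun x hx => ?_) a ha
    rw [mS hx hx]
    exact H x hx
  · intro a b R ha hb H
    refine fst _ (hS _) (fun z hz x hx y hy hzz => ?_) _ (pB ha hb) a ha b hb rfl
    rw [mS hz hx, hzz]
    exact H x hx y hy
  · intro a b R ha hb H
    refine snd _ (hS _) (fun z hz x hx y hy hzz => ?_) _ (pB ha hb) a ha b hb rfl
    rw [mS hz hy, hzz]
    exact H x hx y hy
  · intro a R ha H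
    refine total _ (hS _) (fun x hx => ?_) a ha
    obtain ⟨y, hy, hR⟩ := H x hx
    exact ⟨y, hy, (mS hx hy).2 hR⟩
  · intro a b P Q R ha hb H
    refine push _ (hS _) _ (hS _) _ (hS _) (fun x hx y hy => ?_) a ha b hb
    rw [mS hx hy, mP hx, mP hy]
    exact H x hx y hy
  · intro a b c R S T ha hb hc H
    refine comp _ (hS _) _ (hS _) _ (hS _) (fun x hx y hy z hz => ?_) a ha b hb c hc
    rw [mS hx hy, mS hy hz, mS hx hz]
    exact H x hx y hy z hz
  · intro a b R S P ha hb H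
    refine parallel _ (hS _) _ (hS _) _ (hS _) (fun x hx y hy => ?_) a ha b hb
    rw [mS hx hy, mS hx hy, mP hx]
    exact H x hx y hy
  · intro a b c R S T P ha hb hc H
    refine fan _ (hS _) _ (hS _) _ (hS P) _ (hS _) (fun x hx y hy z hz => ?_) a ha b hb c hc
    rw [mS hx hy, mS hx hz, mS hy hz, mP hx]
    exact H x hx y hy z hz
  · intro a b ha hb
    refine ⟨to_mem _ (hS _) (fun x hx y hy => ?_) a ha b hb,
      of_mem _ (hS _) (fun x hx y hy => ?_) a ha b hb⟩
    · exact (mS (R := (· ∈ ·)) hx hy).1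
    · exact (mS (R := (· ∈ ·)) hx hy).2
  · intro R hR f hf H
    obtain ⟨ρ, -, hρ1, hρ2⟩ := ranked _ (hS (OnPair R)) (by
      rintro X - ⟨x, hx, -⟩
      obtain ⟨m, hm, hmin⟩ := hR.has_min {y | y ∈ X} ⟨x, hx⟩
      refine ⟨m, hm, fun y hy hym => ?_⟩
      rw [ZFSet.mem_sep, onPair_pair] at hym
      exact hmin y hy hym.2)
    have key : ∀ n, ∃ s ∈ RR, ZFSet.pair (f n) s ∈ ρ := fun n => by
      obtain ⟨s, hs, t, ht, h1, h2, h3⟩ := hρ2 _ (hf (n + 1)) _ (hf n) (H n)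
      exact ⟨t, ht, h2⟩
    choose s hs hsρ using key
    obtain ⟨n, hn⟩ : ∃ n, s (n + 1) ∉ s n := by
      by_contra! hcon
      obtain ⟨_, ⟨n, rfl⟩, hmin⟩ := ZFSet.mem_wf.has_min (Set.range s) ⟨_, 0, rfl⟩
      exact hmin _ ⟨n + 1, rfl⟩ (hcon n)
    obtain ⟨s', hs', t', ht', h1, h2, h3⟩ := hρ2 _ (hf (n + 1)) _ (hf n) (H n)
    rw [hρ1 _ (hf _) _ hs' _ (hs _) h1 (hsρ _), hρ1 _ (hf _) _ ht' _ (hs _) h2 (hsρ _)] at h3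
    exact hn h3

/-- The first component of a Kuratowski pair; a set which is not a pair is returned unchanged. -/
noncomputable def fstOr (z : ZFSet.{u}) : ZFSet.{u} :=
  open Classical in if h : ∃ x y, z = ZFSet.pair x y then h.choose else z

/-- The second component of a Kuratowski pair; a set which is not a pair is returned unchanged. -/
noncomputable def sndOr (z : ZFSet.{u}) : ZFSet.{u} :=
  open Classical in if h : ∃ x y, z = ZFSet.pair x y then h.choose_spec.choose else z

theorem pair_fstOr_sndOr (x y : ZFSet.{u}) :
    fstOr (ZFSet.pair x y) = x ∧ sndOr (ZFSet.pair x y) = y := by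
  have h : ∃ x' y', ZFSet.pair x y = ZFSet.pair x' y' := ⟨x, y, rfl⟩
  rw [fstOr, sndOr, dif_pos h, dif_pos h]
  obtain ⟨h1, h2⟩ := ZFSet.pair_inj.1 h.choose_spec.choose_spec
  exact ⟨h1.symm, h2.symm⟩

@[simp] theorem fstOr_pair (x y : ZFSet.{u}) : fstOr (ZFSet.pair x y) = x :=
  (pair_fstOr_sndOr x y).1

@[simp] theorem sndOr_pair (x y : ZFSet.{u}) : sndOr (ZFSet.pair x y) = y :=
  (pair_fstOr_sndOr x y).2

theorem mem_of_pair_mem {D : ZFSet.{u}} (hD : ∀ {x y}, x ∈ D → y ∈ x → y ∈ D) {x y : ZFSet.{u}}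
    (h : ZFSet.pair x y ∈ D) : x ∈ D ∧ y ∈ D := by
  have h1 : ({x, y} : ZFSet.{u}) ∈ D := hD h (by simp [ZFSet.pair])
  exact ⟨hD h1 (by simp), hD h1 (by simp)⟩

theorem fstOr_mem {D : ZFSet.{u}} (hD : ∀ {x y}, x ∈ D → y ∈ x → y ∈ D) {z : ZFSet.{u}}
    (hz : z ∈ D) : fstOr z ∈ D := by
  by_cases h : ∃ x y, z = ZFSet.pair x y
  · obtain ⟨x, y, rfl⟩ := h
    simpa using (mem_of_pair_mem hD hz).1
  · rwa [fstOr, dif_neg h]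

theorem sndOr_mem {D : ZFSet.{u}} (hD : ∀ {x y}, x ∈ D → y ∈ x → y ∈ D) {z : ZFSet.{u}}
    (hz : z ∈ D) : sndOr z ∈ D := by
  by_cases h : ∃ x y, z = ZFSet.pair x y
  · obtain ⟨x, y, rfl⟩ := h
    simpa using (mem_of_pair_mem hD hz).2
  · rwa [sndOr, dif_neg h]

/-- `p : D → D` represents an arrow from the index `a` to the index `b`. -/
structure Arr (D B : ZFSet.{u}) (mu : ZFSet.{u} → (ZFSet.{u} → Prop) → Prop)
    (p : ZFSet.{u} → ZFSet.{u}) (a b : ZFSet.{u}) : Prop where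
  maps : ∀ x ∈ D, p x ∈ D
  src : a ∈ B
  tgt : b ∈ B
  graph : mu (ZFSet.pair a b) (OnPair fun x y => y = p x)

/-- Functions on `D` at an index, the preliminary elements of the ultrapower. -/
abbrev Elt (B : ZFSet.{u}) : Type (u + 1) := {a : ZFSet.{u} // a ∈ B} × (ZFSet.{u} → ZFSet.{u})

/-- The relation induced by `R` on preliminary elements of the ultrapower. -/
def UpRel (D B : ZFSet.{u}) (mu : ZFSet.{u} → (ZFSet.{u} → Prop) → Prop)
    (R : ZFSet.{u} → ZFSet.{u} → Prop) (u v : Elt B) : Prop :=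
  ∃ d r s, Arr D B mu r d u.1 ∧ Arr D B mu s d v.1 ∧ mu d (fun z => R (u.2 (r z)) (v.2 (s z)))

namespace MeasSys

variable {D B : ZFSet.{u}} {mu : ZFSet.{u} → (ZFSet.{u} → Prop) → Prop} (S : MeasSys D B mu)
include S

theorem mono {a : ZFSet.{u}} {P Q : ZFSet.{u} → Prop} (ha : a ∈ B) (hP : mu a P)
    (h : ∀ x ∈ D, P x → Q x) : mu a Q :=
  S.mono₂ ha (fun x hx h1 _ => h x hx h1) hP hP

theorem inter {a : ZFSet.{u}} {P Q : ZFSet.{u} → Prop} (ha : a ∈ B) (hP : mu a P)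
    (hQ : mu a Q) : mu a (fun x => P x ∧ Q x) :=
  S.mono₂ ha (fun _ _ h1 h2 => ⟨h1, h2⟩) hP hQ

theorem of_forall {a : ZFSet.{u}} {P : ZFSet.{u} → Prop} (ha : a ∈ B)
    (h : ∀ x ∈ D, P x) : mu a P :=
  (S.cover (P := P) (Q := P) ha fun x hx => Or.inl (h x hx)).elim id id

theorem not_iff {a : ZFSet.{u}} {P : ZFSet.{u} → Prop} (ha : a ∈ B) :
    mu a (fun x => ¬ P x) ↔ ¬ mu a P :=
  ⟨fun h => S.disj ha (fun _ _ h => h) h,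
    (S.cover ha fun x _ => em (P x)).resolve_left⟩

theorem arr_id {a : ZFSet.{u}} (ha : a ∈ B) : Arr D B mu (fun x => x) a a :=
  ⟨fun _ h => h, ha, ha, S.diag ha fun _ _ => rfl⟩

theorem exists_arr {a : ZFSet.{u}} (ha : a ∈ B) {p : ZFSet.{u} → ZFSet.{u}}
    (hp : ∀ x ∈ D, p x ∈ D) : ∃ b, Arr D B mu p a b := by
  obtain ⟨b, hb, h⟩ := S.total (R := fun x y => y = p x) ha fun x hx => ⟨p x, hp x hx, rfl⟩
  exact ⟨b, hp, ha, hb, h⟩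

theorem arr_comp {a b c : ZFSet.{u}} {p q : ZFSet.{u} → ZFSet.{u}} (hp : Arr D B mu p a b)
    (hq : Arr D B mu q b c) : Arr D B mu (fun x => q (p x)) a c :=
  ⟨fun x hx => hq.maps _ (hp.maps x hx), hp.src, hq.tgt,
    S.comp hp.src hp.tgt hq.tgt (fun _ _ _ _ _ _ h1 h2 => by rw [h2, h1]) hp.graph hq.graph⟩

theorem arr_push {a b : ZFSet.{u}} {p : ZFSet.{u} → ZFSet.{u}} (hp : Arr D B mu p a b)
    {P : ZFSet.{u} → Prop} : mu b P ↔ mu a (fun x => P (p x)) := by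
  have key : ∀ {P : ZFSet.{u} → Prop}, mu a (fun x => P (p x)) → mu b P := fun {P} h =>
    S.push hp.src hp.tgt (fun x _ y _ h1 h2 => by rw [h1]; exact h2) hp.graph h
  refine ⟨fun h => ?_, key⟩
  by_contra hn
  rw [← S.not_iff hp.src] at hn
  exact (S.not_iff hp.tgt).1 (key (P := fun x => ¬ P x) hn) h

theorem arr_parallel {a b : ZFSet.{u}} {p q : ZFSet.{u} → ZFSet.{u}} (hp : Arr D B mu p a b)
    (hq : Arr D B mu q a b) : mu a (fun x => p x = q x) :=
  S.parallel hp.src hp.tgt (fun _ _ _ _ h1 h2 => h1.symm.trans h2) hp.graph hq.graph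

theorem arr_fan {a b c : ZFSet.{u}} {p q : ZFSet.{u} → ZFSet.{u}} (hp : Arr D B mu p a b)
    (hq : Arr D B mu q a c) {R : ZFSet.{u} → ZFSet.{u} → Prop}
    (h : mu a (fun x => R (p x) (q x))) : mu (ZFSet.pair b c) (OnPair R) :=
  S.fan hp.src hp.tgt hq.tgt (fun _ _ _ _ _ _ h1 h2 h3 => by rw [h1, h2]; exact h3)
    hp.graph hq.graph h

theorem arr_fst {a b : ZFSet.{u}} (ha : a ∈ B) (hb : b ∈ B) :
    Arr D B mu fstOr (ZFSet.pair a b) a :=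
  ⟨fun _ h => fstOr_mem S.trans_dom h, S.pair_idx ha hb, ha,
    S.fst ha hb fun _ _ _ _ => by simp⟩

theorem arr_snd {a b : ZFSet.{u}} (ha : a ∈ B) (hb : b ∈ B) :
    Arr D B mu sndOr (ZFSet.pair a b) b :=
  ⟨fun _ h => sndOr_mem S.trans_dom h, S.pair_idx ha hb, hb,
    S.snd ha hb fun _ _ _ _ => by simp⟩

theorem exists_common {a b : ZFSet.{u}} (ha : a ∈ B) (hb : b ∈ B) :
    ∃ d r s, Arr D B mu r d a ∧ Arr D B mu s d b :=
  ⟨_, _, _, S.arr_fst ha hb, S.arr_snd ha hb⟩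

theorem upRel_iff {R : ZFSet.{u} → ZFSet.{u} → Prop} {u v : Elt B} {d : ZFSet.{u}}
    {r s : ZFSet.{u} → ZFSet.{u}} (hr : Arr D B mu r d u.1) (hs : Arr D B mu s d v.1) :
    UpRel D B mu R u v ↔ mu d (fun z => R (u.2 (r z)) (v.2 (s z))) := by
  refine ⟨?_, fun h => ⟨d, r, s, hr, hs, h⟩⟩
  rintro ⟨d', r', s', hr', hs', h⟩
  obtain ⟨c, p, q, hp, hq⟩ := S.exists_common hr.src hr'.src
  rw [S.arr_push hp]
  rw [S.arr_push hq] at h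
  have h1 := S.arr_parallel (S.arr_comp hp hr) (S.arr_comp hq hr')
  have h2 := S.arr_parallel (S.arr_comp hp hs) (S.arr_comp hq hs')
  refine S.mono hp.src (S.inter hp.src h (S.inter hp.src h1 h2)) ?_
  rintro x - ⟨h, h1, h2⟩
  rw [h1, h2]
  exact h

/-- Transitivity-like laws for three preliminary elements. -/
theorem upRel_trans {R T Q : ZFSet.{u} → ZFSet.{u} → Prop} (h : ∀ x y z, R x y → T y z → Q x z)
    {u v w : Elt B} (huv : UpRel D B mu R u v) (hvw : UpRel D B mu T v w) :
    UpRel D B mu Q u w := by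
  obtain ⟨d, r, s, hr, hs, h1⟩ := huv
  obtain ⟨d', r', s', hr', hs', h2⟩ := hvw
  obtain ⟨c, p, q, hp, hq⟩ := S.exists_common hr.src hr'.src
  have e := S.arr_parallel (S.arr_comp hp hs) (S.arr_comp hq hr')
  refine ⟨c, _, _, S.arr_comp hp hr, S.arr_comp hq hs', ?_⟩
  rw [S.arr_push hp] at h1
  rw [S.arr_push hq] at h2
  refine S.mono hp.src (S.inter hp.src e (S.inter hp.src h1 h2)) ?_
  rintro x - ⟨e, h1, h2⟩
  rw [e] at h1
  exact h _ _ _ h1 h2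

theorem upRel_symm {R T : ZFSet.{u} → ZFSet.{u} → Prop} (h : ∀ x y, R x y → T y x)
    {u v : Elt B} (huv : UpRel D B mu R u v) : UpRel D B mu T v u := by
  obtain ⟨d, r, s, hr, hs, h1⟩ := huv
  exact ⟨d, s, r, hs, hr, S.mono hr.src h1 fun x _ hx => h _ _ hx⟩

theorem upRel_wf (hne : ∃ x, x ∈ D) : WellFounded (UpRel D B mu (· ∈ ·)) := by
  rw [wellFounded_iff_isEmpty_descending_chain]
  refine ⟨fun ⟨v, hv⟩ => ?_⟩
  obtain ⟨x₀, hx₀⟩ := hne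
  let c : ℕ → ZFSet.{u} := fun n => Nat.rec x₀ (fun _ x => ZFSet.pair x x) n
  have hc : ∀ n, c n ∈ D := fun n => by
    induction n with
    | zero => exact hx₀
    | succ n ih => exact S.pair_dom ih ih
  have hmono : StrictMono fun n => (c n).rank := by
    refine strictMono_nat_of_lt_succ fun n => ?_
    have h1 : c n ∈ ({c n} : ZFSet.{u}) := by simp
    have h2 : ({c n} : ZFSet.{u}) ∈ c (n + 1) := by
      change _ ∈ ZFSet.pair (c n) (c n)
      simp [ZFSet.pair]
    exact (ZFSet.rank_lt_of_mem h1).trans (ZFSet.rank_lt_of_mem h2)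
  have hinj : ∀ {m n}, c m = c n → m = n := fun h => hmono.injective (congrArg ZFSet.rank h)
  let G : ZFSet.{u} → ZFSet.{u} := fun y => open Classical in
    if h : ∃ n x, y = ZFSet.pair (c n) x then (v h.choose).2 h.choose_spec.choose else ∅
  have hG : ∀ n x, G (ZFSet.pair (c n) x) = (v n).2 x := fun n x => by
    have h : ∃ m y, ZFSet.pair (c n) x = ZFSet.pair (c m) y := ⟨n, x, rfl⟩
    simp only [G, dif_pos h]
    obtain ⟨h1, h2⟩ := ZFSet.pair_inj.1 h.choose_spec.choose_spec
    rw [← h2, ← hinj h1]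
  choose b hb using fun n => S.exists_arr (v n).1.2
    (p := fun x => ZFSet.pair (c n) x) fun x hx => S.pair_dom (hc n) hx
  refine S.wf (InvImage.wf G ZFSet.mem_wf) b (fun n => (hb n).tgt) fun n => ?_
  obtain ⟨d, r, s, hr, hs, h⟩ := hv n
  refine S.arr_fan (S.arr_comp hr (hb (n + 1))) (S.arr_comp hs (hb n)) (S.mono hr.src h ?_)
  intro x _ hx
  exact (congrArg₂ (· ∈ ·) (hG (n + 1) (r x)) (hG n (s x))).mpr hx

end MeasSys

/-- The set with the same elements as a small class of sets. -/
noncomputable def ofClass (s : Set ZFSet.{u}) : ZFSet.{u} :=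
  open Classical in if _h : Small.{u} s then ZFSet.range (Subtype.val : s → ZFSet.{u}) else ∅

theorem mem_ofClass {s : Set ZFSet.{u}} (h : Small.{u} s) {x : ZFSet.{u}} :
    x ∈ ofClass s ↔ x ∈ s := by
  rw [ofClass, dif_pos h, ZFSet.mem_range]
  simp

/-- A set of Kuratowski pairs as a function, with value `∅` outside of its domain. -/
noncomputable def applyFun (G x : ZFSet.{u}) : ZFSet.{u} :=
  open Classical in if h : ∃ y, ZFSet.pair x y ∈ G then h.choose else ∅

namespace MeasSys

variable {D B : ZFSet.{u}} {mu : ZFSet.{u} → (ZFSet.{u} → Prop) → Prop} (S : MeasSys D B mu)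
  (hne : ∃ x, x ∈ D)

/-- The transitive collapse of the ultrapower. -/
noncomputable def collapse : Elt B → ZFSet.{u} :=
  (S.upRel_wf hne).fix fun u ih =>
    ofClass (Set.range fun v : {v // UpRel D B mu (· ∈ ·) v u} => ih v.1 v.2)

theorem collapse_eq (u : Elt B) : S.collapse hne u =
    ofClass {y | ∃ v, UpRel D B mu (· ∈ ·) v u ∧ S.collapse hne v = y} := by
  rw [collapse, WellFounded.fix_eq]
  congr 1
  ext y
  simp

theorem collapse_congr {u v : Elt B} (h : UpRel D B mu (· = ·) u v) :
    S.collapse hne u = S.collapse hne v := by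
  rw [collapse_eq, collapse_eq]
  congr 1
  ext y
  refine exists_congr fun w => and_congr_left fun _ => ⟨fun hw => ?_, fun hw => ?_⟩
  · exact S.upRel_trans (T := (· = ·)) (fun x y z h1 h2 => h2 ▸ h1) hw h
  · exact S.upRel_trans (T := (· = ·)) (fun x y z h1 h2 => h2 ▸ h1) hw
      (S.upRel_symm (fun _ _ h => h.symm) h)

include S in
theorem exists_bounded_rep {u v : Elt B} (h : UpRel D B mu (· ∈ ·) v u) :
    ∃ G ∈ (ZFSet.prod D (ZFSet.sUnion (ZFSet.range fun x : D => u.2 x))).powerset,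
      UpRel D B mu (· = ·) v (v.1, applyFun G) := by
  set W := ZFSet.sUnion (ZFSet.range fun x : D => u.2 x)
  refine ⟨ZFSet.sep (fun z => ∃ x, z = ZFSet.pair x (v.2 x)) (ZFSet.prod D W), ?_, ?_⟩
  · rw [ZFSet.mem_powerset]
    exact fun z hz => (ZFSet.mem_sep.1 hz).1
  · obtain ⟨d, r, s, hr, hs, h⟩ := h
    refine ⟨d, r, r, hr, hr, S.mono hr.src h fun z hz hzm => ?_⟩
    have hW : v.2 (r z) ∈ W :=
      ZFSet.mem_sUnion.2 ⟨_, ZFSet.mem_range.2 ⟨⟨s z, hs.maps z hz⟩, rfl⟩, hzm⟩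
    have hex : ∃ y, ZFSet.pair (r z) y ∈
        ZFSet.sep (fun z => ∃ x, z = ZFSet.pair x (v.2 x)) (ZFSet.prod D W) :=
      ⟨v.2 (r z), ZFSet.mem_sep.2 ⟨ZFSet.pair_mem_prod.2 ⟨hr.maps z hz, hW⟩, _, rfl⟩⟩
    simp only [applyFun, dif_pos hex]
    obtain ⟨x, hx⟩ := (ZFSet.mem_sep.1 hex.choose_spec).2
    obtain ⟨h1, h2⟩ := ZFSet.pair_inj.1 hx
    rw [h2, ← h1]

theorem mem_collapse {u : Elt B} {y : ZFSet.{u}} : y ∈ S.collapse hne u ↔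
    ∃ v, UpRel D B mu (· ∈ ·) v u ∧ S.collapse hne v = y := by
  rw [collapse_eq, mem_ofClass]
  · rfl
  set P := (ZFSet.prod D (ZFSet.sUnion (ZFSet.range fun x : D => u.2 x))).powerset
  have hsmall : Small.{u} (Set.range fun p : {x // x ∈ B} × {x // x ∈ P} =>
    S.collapse hne (p.1, applyFun p.2.1)) := inferInstance
  refine small_subset (s := Set.range fun p : {x // x ∈ B} × {x // x ∈ P} =>
    S.collapse hne (p.1, applyFun p.2.1)) ?_
  rintro y ⟨v, hv, rfl⟩
  obtain ⟨G, hG, hvG⟩ := S.exists_bounded_rep hv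
  exact ⟨⟨v.1, ⟨G, hG⟩⟩, (S.collapse_congr hne hvG).symm⟩

theorem collapse_eq_iff {u v : Elt B} :
    S.collapse hne u = S.collapse hne v ↔ UpRel D B mu (· = ·) u v := by
  refine ⟨fun h => ?_, S.collapse_congr hne⟩
  induction u using (S.upRel_wf hne).induction generalizing v with
  | _ u ih =>
  by_contra hn
  obtain ⟨d, r, s, hr, hs⟩ := S.exists_common u.1.2 v.1.2
  rw [S.upRel_iff hr hs, ← S.not_iff hr.src] at hn
  have hor : mu d (fun z => ∃ w, w ∈ u.2 (r z) ∧ w ∉ v.2 (s z)) ∨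
      mu d (fun z => ∃ w, w ∈ v.2 (s z) ∧ w ∉ u.2 (r z)) := by
    by_contra hcon
    rw [not_or, ← S.not_iff hr.src, ← S.not_iff hr.src] at hcon
    have := S.inter hr.src hn (S.inter hr.src hcon.1 hcon.2)
    refine (S.not_iff (P := fun _ => True) hr.src).1 (S.mono hr.src this ?_)
      (S.of_forall hr.src fun _ _ => trivial)
    rintro x - ⟨h1, h2, h3⟩ -
    push Not at h2 h3
    exact h1 (ZFSet.ext fun w => ⟨h2 w, h3 w⟩)
  have hskolem : ∀ {p q : ZFSet.{u} → ZFSet.{u}}, mu d (fun z => ∃ w, w ∈ p z ∧ w ∉ q z) →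
      ∃ f : ZFSet.{u} → ZFSet.{u}, mu d (fun z => f z ∈ p z ∧ f z ∉ q z) := by
    intro p q h
    classical
    refine ⟨fun z => if h : ∃ w, w ∈ p z ∧ w ∉ q z then h.choose else ∅,
      S.mono hr.src h fun z _ hz => ?_⟩
    simp only [dif_pos hz]
    exact hz.choose_spec
  rcases hor with hor | hor
  · obtain ⟨f, hf⟩ := hskolem hor
    have hu : UpRel D B mu (· ∈ ·) (⟨d, hr.src⟩, f) u :=
      (S.upRel_iff (S.arr_id hr.src) hr).2 (S.mono hr.src hf fun _ _ h => h.1)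
    have hv : ¬ UpRel D B mu (· ∈ ·) (⟨d, hr.src⟩, f) v := by
      rw [S.upRel_iff (S.arr_id hr.src) hs, ← S.not_iff hr.src]
      exact S.mono hr.src hf fun _ _ h => h.2
    have : S.collapse hne (⟨d, hr.src⟩, f) ∈ S.collapse hne v :=
      h ▸ (S.mem_collapse hne).2 ⟨_, hu, rfl⟩
    obtain ⟨w, hwv, hw⟩ := (S.mem_collapse hne).1 this
    exact hv (S.upRel_trans (fun x y z (h1 : x = y) h2 => h1 ▸ h2) (ih _ hu hw.symm) hwv)
  · obtain ⟨f, hf⟩ := hskolem hor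
    have hv : UpRel D B mu (· ∈ ·) (⟨d, hr.src⟩, f) v :=
      (S.upRel_iff (S.arr_id hr.src) hs).2 (S.mono hr.src hf fun _ _ h => h.1)
    have hu : ¬ UpRel D B mu (· ∈ ·) (⟨d, hr.src⟩, f) u := by
      rw [S.upRel_iff (S.arr_id hr.src) hr, ← S.not_iff hr.src]
      exact S.mono hr.src hf fun _ _ h => h.2
    have : S.collapse hne (⟨d, hr.src⟩, f) ∈ S.collapse hne u :=
      h ▸ (S.mem_collapse hne).2 ⟨_, hv, rfl⟩
    obtain ⟨w, hwu, hw⟩ := (S.mem_collapse hne).1 this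
    exact hu (S.upRel_trans (fun x y z (h1 : x = y) h2 => h1 ▸ h2)
      (S.upRel_symm (fun _ _ h => h.symm) (ih _ hwu hw)) hwu)

theorem collapse_mem_iff {u v : Elt B} :
    S.collapse hne u ∈ S.collapse hne v ↔ UpRel D B mu (· ∈ ·) u v := by
  refine ⟨fun h => ?_, fun h => (S.mem_collapse hne).2 ⟨_, h, rfl⟩⟩
  obtain ⟨w, hw, h⟩ := (S.mem_collapse hne).1 h
  rw [collapse_eq_iff] at h
  exact S.upRel_trans (fun x y z (h1 : x = y) h2 => h1 ▸ h2)
    (S.upRel_symm (fun _ _ h => h.symm) h) hw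

/-- The ultrapower, as a transitive class. -/
noncomputable def ultrapower : Set ZFSet.{u} := Set.range (S.collapse hne)

theorem ultrapower_trans : TransClass (S.ultrapower hne) := by
  rintro _ ⟨u, rfl⟩ y hy
  obtain ⟨v, -, rfl⟩ := (S.mem_collapse hne).1 hy
  exact ⟨v, rfl⟩

/-- The element of the ultrapower given by a preliminary element. -/
noncomputable def pt (u : Elt B) : S.ultrapower hne := ⟨S.collapse hne u, u, rfl⟩

theorem exists_var_eq {α : Type} (t : SetLang.Term α) : ∃ i, t = .var i := by
  cases t with
  | var i => exact ⟨i, rfl⟩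
  | func f _ => exact f.elim

/-- Łoś's theorem, at a common index `d`. -/
theorem realize_iff {α : Type} {n : ℕ} (φ : SetLang.BoundedFormula α n) (v : α → Elt B)
    (xs : Fin n → Elt B) {d : ZFSet.{u}} (hd : d ∈ B) (r : α → ZFSet.{u} → ZFSet.{u})
    (s : Fin n → ZFSet.{u} → ZFSet.{u}) (hr : ∀ i, Arr D B mu (r i) d (v i).1)
    (hs : ∀ i, Arr D B mu (s i) d (xs i).1) :
    φ.Realize (fun i => S.pt hne (v i)) (fun i => S.pt hne (xs i)) ↔
      mu d (fun z => φ.Realize (fun i => (⟨(v i).2 (r i z), mem_V _⟩ : V.{u}))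
        (fun i => (⟨(xs i).2 (s i z), mem_V _⟩ : V.{u}))) := by
  induction φ generalizing d r with
  | falsum =>
    refine ⟨False.elim, fun h => ?_⟩
    exact (S.not_iff hd).1 (S.of_forall hd fun _ _ => id) h
  | @equal n t₁ t₂ =>
    obtain ⟨i, rfl⟩ := exists_var_eq t₁
    obtain ⟨j, rfl⟩ := exists_var_eq t₂
    have key : ∀ i : α ⊕ Fin n, ∃ u p, Arr D B mu p d u.1 ∧
        (Sum.elim (fun i => S.pt hne (v i)) (fun i => S.pt hne (xs i)) i) = S.pt hne u ∧
        ∀ z, (Sum.elim (fun i => (⟨(v i).2 (r i z), mem_V _⟩ : V.{u}))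
          (fun i => (⟨(xs i).2 (s i z), mem_V _⟩ : V.{u})) i : V.{u}).1 = u.2 (p z) := by
      rintro (i | i)
      · exact ⟨v i, r i, hr i, rfl, fun _ => rfl⟩
      · exact ⟨xs i, s i, hs i, rfl, fun _ => rfl⟩
    obtain ⟨u, p, hp, e1, e2⟩ := key i
    obtain ⟨w, q, hq, e3, e4⟩ := key j
    change _ = _ ↔ mu d (fun z => _ = _)
    simp only [FirstOrder.Language.Term.realize_var, e1, e3, Subtype.ext_iff, e2, e4]
    rw [← S.upRel_iff (R := (· = ·)) hp hq]
    exact S.collapse_eq_iff hne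
  | @rel n l R ts =>
    obtain ⟨⟩ := R
    have key : ∀ i : α ⊕ Fin n, ∃ u p, Arr D B mu p d u.1 ∧
        (Sum.elim (fun i => S.pt hne (v i)) (fun i => S.pt hne (xs i)) i) = S.pt hne u ∧
        ∀ z, (Sum.elim (fun i => (⟨(v i).2 (r i z), mem_V _⟩ : V.{u}))
          (fun i => (⟨(xs i).2 (s i z), mem_V _⟩ : V.{u})) i : V.{u}).1 = u.2 (p z) := by
      rintro (i | i)
      · exact ⟨v i, r i, hr i, rfl, fun _ => rfl⟩
      · exact ⟨xs i, s i, hs i, rfl, fun _ => rfl⟩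
    obtain ⟨i, hi⟩ := exists_var_eq (ts 0)
    obtain ⟨j, hj⟩ := exists_var_eq (ts 1)
    obtain ⟨u, p, hp, e1, e2⟩ := key i
    obtain ⟨w, q, hq, e3, e4⟩ := key j
    change ((ts 0).realize _ : ↥(S.ultrapower hne)).1 ∈
      ((ts 1).realize _ : ↥(S.ultrapower hne)).1 ↔
      mu d (fun z => ((ts 0).realize _ : V.{u}).1 ∈ ((ts 1).realize _ : V.{u}).1)
    simp only [hi, hj, FirstOrder.Language.Term.realize_var, e1, e3, e2, e4]
    rw [← S.upRel_iff (R := (· ∈ ·)) hp hq]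
    exact S.collapse_mem_iff hne
  | imp φ ψ ihφ ihψ =>
    simp only [FirstOrder.Language.BoundedFormula.realize_imp]
    rw [ihφ xs hd r s hr hs, ihψ xs hd r s hr hs]
    constructor
    · intro h
      by_contra hn
      rw [← S.not_iff hd] at hn
      have h1 := h (S.mono hd hn fun z _ hz => (Classical.not_imp.1 hz).1)
      have h2 := S.inter hd hn h1
      exact (S.not_iff (P := fun _ => True) hd).1
        (S.mono hd h2 fun z _ hz _ => hz.1 fun _ => hz.2) (S.of_forall hd fun _ _ => trivial)
    · intro h1 h2
      exact S.mono hd (S.inter hd h1 h2) fun z _ hz => hz.1 hz.2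
  | @all n φ ih =>
    simp only [FirstOrder.Language.BoundedFormula.realize_all]
    have snoc1 : ∀ u : Elt B, (Fin.snoc (fun i => S.pt hne (xs i)) (S.pt hne u) :
        Fin (n + 1) → S.ultrapower hne) = fun i => S.pt hne
          ((Fin.snoc xs u : Fin (n + 1) → Elt B) i) := by
      intro u
      funext i
      refine Fin.lastCases ?_ (fun i => ?_) i <;> simp
    have snoc2 : ∀ (z : ZFSet.{u}) (u : Elt B) (s : Fin n → ZFSet.{u} → ZFSet.{u})
        (p : ZFSet.{u} → ZFSet.{u}),
        (fun i => (⟨((Fin.snoc xs u : Fin (n + 1) → Elt B) i).2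
          ((Fin.snoc s p : Fin (n + 1) → ZFSet.{u} → ZFSet.{u}) i z), mem_V _⟩ : V.{u})) =
        (Fin.snoc (fun i => (⟨(xs i).2 (s i z), mem_V _⟩ : V.{u})) ⟨u.2 (p z), mem_V _⟩ :
          Fin (n + 1) → V.{u}) := by
      intro z u s p
      funext i
      refine Fin.lastCases ?_ (fun i => ?_) i <;> simp
    have snoc3 : ∀ {d : ZFSet.{u}} {u : Elt B} {s : Fin n → ZFSet.{u} → ZFSet.{u}}
        {p : ZFSet.{u} → ZFSet.{u}}, (∀ i, Arr D B mu (s i) d (xs i).1) → Arr D B mu p d u.1 →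
        ∀ i, Arr D B mu ((Fin.snoc s p : Fin (n + 1) → ZFSet.{u} → ZFSet.{u}) i) d
          ((Fin.snoc xs u : Fin (n + 1) → Elt B) i).1 := by
      intro d u s p h1 h2 i
      refine Fin.lastCases ?_ (fun i => ?_) i
      · simpa using h2
      · simpa using h1 i
    constructor
    · intro h
      by_contra hn
      rw [← S.not_iff hd] at hn
      classical
      let g : ZFSet.{u} → ZFSet.{u} := fun z =>
        if hz : ∃ x : V.{u}, ¬ φ.Realize (fun i => (⟨(v i).2 (r i z), mem_V _⟩ : V.{u}))
          (Fin.snoc (fun i => (⟨(xs i).2 (s i z), mem_V _⟩ : V.{u})) x) then hz.choose else ∅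
      have h1 := h (S.pt hne (⟨d, hd⟩, g))
      rw [snoc1, ih _ hd r _ hr (snoc3 hs (S.arr_id hd))] at h1
      have h2 := S.inter hd hn h1
      refine (S.not_iff (P := fun _ => True) hd).1 (S.mono hd h2 ?_)
        (S.of_forall hd fun _ _ => trivial)
      rintro z - ⟨hz1, hz2⟩ -
      rw [snoc2] at hz2
      have hz : ∃ x : V.{u}, ¬ φ.Realize (fun i => (⟨(v i).2 (r i z), mem_V _⟩ : V.{u}))
          (Fin.snoc (fun i => (⟨(xs i).2 (s i z), mem_V _⟩ : V.{u})) x) := not_forall.1 hz1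
      apply hz.choose_spec
      convert hz2 using 2
      refine Subtype.ext ?_
      change _ = g z
      simp only [g, dif_pos hz]
    · rintro h ⟨_, u, rfl⟩
      obtain ⟨c, p, q, hp, hq⟩ := S.exists_common hd u.1.2
      have := (ih (Fin.snoc xs u) hp.src (fun i z => r i (p z)) _
        (fun i => S.arr_comp hp (hr i)) (snoc3 (fun i => S.arr_comp hp (hs i)) hq)).2
      rw [← snoc1] at this
      refine this ?_
      rw [S.arr_push hp] at h
      refine S.mono hp.src h fun z _ hz => ?_
      rw [snoc2]
      exact hz _

/-- The ultrapower embedding. -/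
noncomputable def emb {a : ZFSet.{u}} (ha : a ∈ B) : ClassEmb V.{u} (S.ultrapower hne) where
  j := fun x => S.collapse hne (⟨a, ha⟩, fun _ => x)
  maps := fun x _ => ⟨_, rfl⟩
  elem := by
    intro n φ v hv
    have h := S.realize_iff hne φ (fun i => (⟨a, ha⟩, fun _ => v i)) default ha
      (fun _ x => x) default (fun _ => S.arr_id ha) (fun i => i.elim0)
    unfold FirstOrder.Language.Formula.Realize
    rw [show (default : Fin 0 → S.ultrapower hne) =
      fun i => S.pt hne ((default : Fin 0 → Elt B) i) from Subsingleton.elim _ _]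
    refine Iff.trans ?_ h.symm
    rw [show (default : Fin 0 → V.{u}) = fun i => i.elim0 from Subsingleton.elim _ _]
    constructor
    · intro hφ
      refine S.of_forall ha fun z _ => ?_
      convert hφ
    · intro hφ
      by_contra hn
      refine (S.not_iff ha).1 (S.of_forall ha fun z _ => ?_) hφ
      convert hn

end MeasSys

namespace MeasSys

variable {D B : ZFSet.{u}} {mu : ZFSet.{u} → (ZFSet.{u} → Prop) → Prop} (S : MeasSys D B mu)
  (hne : ∃ x, x ∈ D)

include S in
theorem upRel_id_iff {a c : ZFSet.{u}} (ha : a ∈ B) (hc : c ∈ B) :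
    UpRel D B mu (· ∈ ·) (⟨c, hc⟩, fun x => x) (⟨a, ha⟩, fun x => x) ↔ c ∈ a := by
  have h1 := S.arr_fst hc ha
  have h2 := S.arr_snd hc ha
  rw [S.upRel_iff (u := (⟨c, hc⟩, fun x => x)) (v := (⟨a, ha⟩, fun x => x)) h1 h2,
    ← S.mem_iff hc ha]
  refine ⟨fun h => S.arr_fan h1 h2 h, fun h => S.mono h1.src h ?_⟩
  rintro _ - ⟨x, y, rfl, h⟩
  simpa using h

include S in
theorem exists_id_rep {v : Elt B} {d : ZFSet.{u}} {r : ZFSet.{u} → ZFSet.{u}}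
    (hr : Arr D B mu r d v.1) (h : mu d (fun z => v.2 (r z) ∈ D)) :
    ∃ c, ∃ hc : c ∈ B, UpRel D B mu (· = ·) v (⟨c, hc⟩, fun x => x) := by
  classical
  obtain ⟨c, hc⟩ := S.exists_arr hr.src
    (p := fun z => if v.2 (r z) ∈ D then v.2 (r z) else z) fun x hx => by
      split_ifs with h
      exacts [h, hx]
  refine ⟨c, hc.tgt, d, r, _, hr, hc, S.mono hr.src h fun z _ hz => ?_⟩
  simp only [if_pos hz]

theorem collapse_id {a : ZFSet.{u}} (ha : a ∈ B) :
    S.collapse hne (⟨a, ha⟩, fun x => x) = a := by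
  induction a using ZFSet.inductionOn with
  | _ a ih =>
  ext y
  rw [S.mem_collapse]
  constructor
  · rintro ⟨v, hv, rfl⟩
    obtain ⟨d, r, s, hr, hs, h⟩ := id hv
    obtain ⟨c, hc, hvc⟩ := S.exists_id_rep hr
      (S.mono hr.src h fun z hz hzm => S.trans_dom (hs.maps z hz) hzm)
    have hca : c ∈ a := by
      rw [← S.upRel_id_iff ha hc, ← S.collapse_mem_iff hne, ← S.collapse_congr hne hvc,
        S.collapse_mem_iff hne]
      exact hv
    rw [S.collapse_congr hne hvc, ih c hca]
    exact hca
  · intro hy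
    have hyB := S.trans_idx ha hy
    exact ⟨_, (S.upRel_id_iff ha hyB).2 hy, ih y hy hyB⟩

theorem mem_emb_iff {a₀ a X : ZFSet.{u}} (ha₀ : a₀ ∈ B) (ha : a ∈ B) :
    a ∈ (S.emb hne ha₀).j X ↔ mu a (· ∈ X) := by
  obtain ⟨d, r, s, hr, hs⟩ := S.exists_common ha ha₀
  conv_lhs => rw [← S.collapse_id hne ha]
  refine (S.collapse_mem_iff hne).trans ?_
  rw [S.upRel_iff (u := (⟨a, ha⟩, fun x => x)) (v := (⟨a₀, ha₀⟩, fun _ => X)) hr hs, S.arr_push hr]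

theorem mem_idx_of_mem_emb {a₀ a X : ZFSet.{u}} (ha₀ : a₀ ∈ B) (hX : X ⊆ D)
    (h : a ∈ (S.emb hne ha₀).j X) : a ∈ B := by
  obtain ⟨v, ⟨d, r, s, hr, hs, hm⟩, rfl⟩ := (S.mem_collapse hne).1 h
  obtain ⟨c, hc, hvc⟩ := S.exists_id_rep hr (S.mono hr.src hm fun z _ hz => hX hz)
  rw [S.collapse_congr hne hvc, S.collapse_id]
  exact hc

end MeasSys

/-- An extender induces an embedding. -/
theorem SetExt.exists_emb {κ D PD B e RR : ZFSet.{u}} (h : SetExt κ D PD B e RR)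
    (hPD : ∀ X ⊆ D, X ∈ PD) (hκ : κ.IsOrdinal) :
    ∃ E : MeasEmb κ, (∀ a ∈ B, a ∈ E.M) ∧
      ∀ X ⊆ D, ∀ a, a ∈ E.e.j X ↔ a ∈ B ∧ ZFSet.pair X a ∈ e := by
  have S := h.measSys hPD
  obtain ⟨trans_dom, pair_dom, mem_dom, trans_idx, pair_idx, mem_idx, mono, compl, disj, diag,
    fst, snd, total, push, comp, parallel, fan, of_mem, to_mem, ranked, crit_lt, crit_self⟩ := h
  have hne : ∃ x, x ∈ D := ⟨κ, mem_dom⟩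
  have hsep : ∀ X ⊆ D, ZFSet.sep (· ∈ X) D = X := fun X hX => by
    ext z
    rw [ZFSet.mem_sep]
    exact ⟨And.right, fun h => ⟨hX h, h⟩⟩
  have key : ∀ X ⊆ D, ∀ a, a ∈ (S.emb hne mem_idx).j X ↔ a ∈ B ∧ ZFSet.pair X a ∈ e := by
    intro X hX a
    constructor
    · intro h
      have ha := S.mem_idx_of_mem_emb hne mem_idx hX h
      rw [S.mem_emb_iff hne mem_idx ha, hsep X hX] at h
      exact ⟨ha, h⟩
    · rintro ⟨ha, h⟩
      rw [S.mem_emb_iff hne mem_idx ha, hsep X hX]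
      exact h
  have hsub : ∀ {x}, x ∈ D → x ⊆ D := fun hx y hy => S.trans_dom hx hy
  refine ⟨⟨S.ultrapower hne, S.ultrapower_trans hne, S.emb hne mem_idx, hκ, ?_, ?_⟩, ?_, key⟩
  · exact (key κ (hsub mem_dom) κ).2 ⟨mem_idx, crit_self⟩
  · intro α _ hα
    ext a
    rw [key α (hsub (S.trans_dom mem_dom hα))]
    constructor
    · rintro ⟨ha, h⟩
      exact (crit_lt α hα a ha).1 h
    · intro h
      have ha := S.trans_idx (S.trans_idx mem_idx hα) h
      exact ⟨ha, (crit_lt α hα a ha).2 h⟩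
  · intro a ha
    exact ⟨_, S.collapse_id hne ha⟩

/-- A ranking function with values in the ordinals, for a relation on a set. -/
theorem exists_ranking {D R : ZFSet.{u}}
    (h : ∀ X ∈ D.powerset, (∃ x ∈ X, x ∈ D) → ∃ x ∈ X, ∀ y ∈ X, ZFSet.pair y x ∉ R) :
    ∃ ρ T : ZFSet.{u}, (∀ p ∈ ρ, ∃ a ∈ D, ∃ s ∈ T, p = ZFSet.pair a s) ∧
      (∀ a ∈ D, ∀ s ∈ T, ∀ t ∈ T, ZFSet.pair a s ∈ ρ → ZFSet.pair a t ∈ ρ → s = t) ∧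
      ∀ a ∈ D, ∀ b ∈ D, ZFSet.pair a b ∈ R →
        ∃ s ∈ T, ∃ t ∈ T, ZFSet.pair a s ∈ ρ ∧ ZFSet.pair b t ∈ ρ ∧ s ∈ t := by
  let val : Shrink.{u} {x // x ∈ D} → ZFSet.{u} := fun x => ((equivShrink _).symm x).1
  have hval : ∀ x, val x ∈ D := fun x => ((equivShrink _).symm x).2
  have hsurj : ∀ a ∈ D, ∃ x, val x = a := fun a ha => ⟨equivShrink _ ⟨a, ha⟩, by simp [val]⟩
  have hinj : ∀ {x y}, val x = val y → x = y := fun h =>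
    (equivShrink _).symm.injective (Subtype.ext h)
  let r : Shrink.{u} {x // x ∈ D} → Shrink.{u} {x // x ∈ D} → Prop := fun x y =>
    ZFSet.pair (val x) (val y) ∈ R
  have wf : IsWellFounded _ r := by
    constructor
    rw [WellFounded.wellFounded_iff_has_min]
    rintro s ⟨x₀, hx₀⟩
    obtain ⟨_, hxs, hmin⟩ := h (ZFSet.sep (fun a => ∃ x ∈ s, val x = a) D)
      (ZFSet.mem_powerset.2 fun x hx => (ZFSet.mem_sep.1 hx).1)
      ⟨val x₀, ZFSet.mem_sep.2 ⟨hval _, x₀, hx₀, rfl⟩, hval _⟩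
    obtain ⟨-, x, hx, rfl⟩ := ZFSet.mem_sep.1 hxs
    exact ⟨x, hx, fun y hy => hmin _ (ZFSet.mem_sep.2 ⟨hval _, y, hy, rfl⟩)⟩
  let π : Shrink.{u} {x // x ∈ D} → ZFSet.{u} := fun x => (IsWellFounded.rank r x).toZFSet
  refine ⟨ZFSet.range fun x => ZFSet.pair (val x) (π x), ZFSet.range π, ?_, ?_, ?_⟩
  · intro p hp
    obtain ⟨x, rfl⟩ := ZFSet.mem_range.1 hp
    exact ⟨_, hval x, _, ZFSet.mem_range.2 ⟨x, rfl⟩, rfl⟩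
  · intro a _ s _ t _ hs ht
    obtain ⟨x, hx⟩ := ZFSet.mem_range.1 hs
    obtain ⟨y, hy⟩ := ZFSet.mem_range.1 ht
    obtain ⟨rfl, rfl⟩ := ZFSet.pair_inj.1 hx
    obtain ⟨hxy, rfl⟩ := ZFSet.pair_inj.1 hy
    rw [hinj hxy]
  · intro a ha b hb hab
    obtain ⟨x, rfl⟩ := hsurj a ha
    obtain ⟨y, rfl⟩ := hsurj b hb
    exact ⟨_, ZFSet.mem_range.2 ⟨x, rfl⟩, _, ZFSet.mem_range.2 ⟨y, rfl⟩,
      ZFSet.mem_range.2 ⟨x, rfl⟩, ZFSet.mem_range.2 ⟨y, rfl⟩,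
      Ordinal.toZFSet_mem_toZFSet_iff.2 (IsWellFounded.rank_lt_of_rel hab)⟩

/-- The extender derived from an embedding. -/
theorem MeasEmb.exists_setExt {κ : ZFSet.{u}} (E : MeasEmb κ) {D : ZFSet.{u}}
    (trans_dom : ∀ x ∈ D, ∀ y ∈ x, y ∈ D) (pair_dom : ∀ x ∈ D, ∀ y ∈ D, ZFSet.pair x y ∈ D)
    (hκ : κ ∈ D) : ∃ e RR, SetExt κ D D.powerset (E.e.j D) e RR ∧
      ∀ X ⊆ D, ∀ a ∈ E.e.j X, ZFSet.pair X a ∈ e := by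
  set j := E.e.j
  have dels :
      Del (fun p : ZFSet.{u} × ZFSet.{u} => ∀ x ∈ p.1, x ∈ p.2) ∧
      Del (fun D : ZFSet.{u} => ∀ x ∈ D, ∀ y ∈ x, y ∈ D) ∧
      Del (fun D : ZFSet.{u} => ∀ x ∈ D, ∀ y ∈ D, ∃ z ∈ D, z = ZFSet.pair x y) ∧
      Del (fun p : ZFSet.{u} × ZFSet.{u} × ZFSet.{u} × ZFSet.{u} =>
        ∀ x ∈ p.2.2.2, x ∈ p.1 → x ∈ p.2.1 → x ∈ p.2.2.1) ∧
      Del (fun p : ZFSet.{u} × ZFSet.{u} × ZFSet.{u} => ∀ x ∈ p.2.2, x ∈ p.1 ∨ x ∈ p.2.1) ∧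
      Del (fun p : ZFSet.{u} × ZFSet.{u} × ZFSet.{u} => ∀ x ∈ p.2.2, x ∈ p.1 → x ∉ p.2.1) ∧
      Del (fun p : ZFSet.{u} × ZFSet.{u} => ∀ x ∈ p.2, ZFSet.pair x x ∈ p.1) ∧
      Del (fun p : ZFSet.{u} × ZFSet.{u} => ∀ z ∈ p.2, ∀ x ∈ p.2, ∀ y ∈ p.2,
        z = ZFSet.pair x y → ZFSet.pair z x ∈ p.1) ∧
      Del (fun p : ZFSet.{u} × ZFSet.{u} => ∀ z ∈ p.2, ∀ x ∈ p.2, ∀ y ∈ p.2,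
        z = ZFSet.pair x y → ZFSet.pair z y ∈ p.1) ∧
      Del (fun p : ZFSet.{u} × ZFSet.{u} => ∀ x ∈ p.2, ∃ y ∈ p.2, ZFSet.pair x y ∈ p.1) ∧
      Del (fun p : ZFSet.{u} × ZFSet.{u} × ZFSet.{u} × ZFSet.{u} => ∀ x ∈ p.2.2.2, ∀ y ∈ p.2.2.2,
        ZFSet.pair x y ∈ p.1 → x ∈ p.2.1 → y ∈ p.2.2.1) ∧
      Del (fun p : ZFSet.{u} × ZFSet.{u} × ZFSet.{u} × ZFSet.{u} => ∀ x ∈ p.2.2.2, ∀ y ∈ p.2.2.2,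
        ∀ z ∈ p.2.2.2, ZFSet.pair x y ∈ p.1 → ZFSet.pair y z ∈ p.2.1 →
          ZFSet.pair x z ∈ p.2.2.1) ∧
      Del (fun p : ZFSet.{u} × ZFSet.{u} × ZFSet.{u} × ZFSet.{u} => ∀ x ∈ p.2.2.2, ∀ y ∈ p.2.2.2,
        ZFSet.pair x y ∈ p.1 → ZFSet.pair x y ∈ p.2.1 → x ∈ p.2.2.1) ∧
      Del (fun p : ZFSet.{u} × ZFSet.{u} × ZFSet.{u} × ZFSet.{u} × ZFSet.{u} =>
        ∀ x ∈ p.2.2.2.2, ∀ y ∈ p.2.2.2.2, ∀ z ∈ p.2.2.2.2, ZFSet.pair x y ∈ p.1 →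
          ZFSet.pair x z ∈ p.2.1 → x ∈ p.2.2.1 → ZFSet.pair y z ∈ p.2.2.2.1) ∧
      Del (fun p : ZFSet.{u} × ZFSet.{u} => ∀ x ∈ p.2, ∀ y ∈ p.2, x ∈ y → ZFSet.pair x y ∈ p.1) ∧
      Del (fun p : ZFSet.{u} × ZFSet.{u} => ∀ x ∈ p.2, ∀ y ∈ p.2, ZFSet.pair x y ∈ p.1 → x ∈ y) ∧
      Del (fun p : ZFSet.{u} × ZFSet.{u} × ZFSet.{u} × ZFSet.{u} =>
        (∀ q ∈ p.1, ∃ a ∈ p.2.2.2, ∃ s ∈ p.2.1, q = ZFSet.pair a s) ∧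
        (∀ a ∈ p.2.2.2, ∀ s ∈ p.2.1, ∀ t ∈ p.2.1, ZFSet.pair a s ∈ p.1 →
          ZFSet.pair a t ∈ p.1 → s = t) ∧
        ∀ a ∈ p.2.2.2, ∀ b ∈ p.2.2.2, ZFSet.pair a b ∈ p.2.2.1 →
          ∃ s ∈ p.2.1, ∃ t ∈ p.2.1, ZFSet.pair a s ∈ p.1 ∧ ZFSet.pair b t ∈ p.1 ∧ s ∈ t) := by
    refine ⟨?_, ?_, ?_, ?_, ?_, ?_, ?_, ?_, ?_, ?_, ?_, ?_, ?_, ?_, ?_, ?_, ?_⟩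
    all_goals
      repeat' with_reducible first
        | apply Proj.self | apply Proj.fst | apply Proj.snd
        | apply Del.ball | apply Del.bex | apply Del.and | apply Del.or
        | apply Del.not | apply Del.imp
        | apply Del.pair_mem | apply Del.eq_pair
        | apply Del.mem | apply Del.eq
  obtain ⟨d_sub, d_trans, d_pair, d_mono, d_compl, d_disj, d_diag, d_fst, d_snd, d_total, d_push,
    d_comp, d_parallel, d_fan, d_of_mem, d_to_mem, d_ranked⟩ := dels
  have trans_idx := (d_trans.transfer E.trans E.e D).1 trans_dom
  have pair_idx' := (d_pair.transfer E.trans E.e D).1 fun x hx y hy => ⟨_, pair_dom x hx y hy, rfl⟩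
  have pair_idx : ∀ x ∈ j D, ∀ y ∈ j D, ZFSet.pair x y ∈ j D := fun x hx y hy => by
    obtain ⟨z, hz, rfl⟩ := pair_idx' x hx y hy
    exact hz
  have hsub : ∀ X ⊆ D, ∀ a ∈ j X, a ∈ j D := fun X hX =>
    (d_sub.transfer E.trans E.e (X, D)).1 hX
  have hκD : κ ⊆ D := fun x hx => trans_dom κ hκ x hx
  set e := ZFSet.sep (fun z => ∃ X a, z = ZFSet.pair X a ∧ a ∈ j X) (ZFSet.prod D.powerset (j D))
  have he : ∀ {X a}, X ∈ D.powerset → a ∈ j D → (ZFSet.pair X a ∈ e ↔ a ∈ j X) := by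
    intro X a hX ha
    rw [ZFSet.mem_sep]
    constructor
    · rintro ⟨-, X', a', h, h'⟩
      obtain ⟨rfl, rfl⟩ := ZFSet.pair_inj.1 h
      exact h'
    · exact fun h => ⟨ZFSet.pair_mem_prod.2 ⟨hX, ha⟩, _, _, rfl, h⟩
  have hrank : ∀ R : D.powerset, ∃ ρ T : ZFSet.{u},
      (∀ X ∈ D.powerset, (∃ x ∈ X, x ∈ D) → ∃ x ∈ X, ∀ y ∈ X, ZFSet.pair y x ∉ R.1) →
      (∀ p ∈ ρ, ∃ a ∈ D, ∃ s ∈ T, p = ZFSet.pair a s) ∧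
      (∀ a ∈ D, ∀ s ∈ T, ∀ t ∈ T, ZFSet.pair a s ∈ ρ → ZFSet.pair a t ∈ ρ → s = t) ∧
      ∀ a ∈ D, ∀ b ∈ D, ZFSet.pair a b ∈ R.1 →
        ∃ s ∈ T, ∃ t ∈ T, ZFSet.pair a s ∈ ρ ∧ ZFSet.pair b t ∈ ρ ∧ s ∈ t := by
    intro R
    by_cases h : ∀ X ∈ D.powerset, (∃ x ∈ X, x ∈ D) → ∃ x ∈ X, ∀ y ∈ X, ZFSet.pair y x ∉ R.1
    · obtain ⟨ρ, T, hρ⟩ := exists_ranking h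
      exact ⟨ρ, T, fun _ => hρ⟩
    · exact ⟨∅, ∅, fun h' => absurd h' h⟩
  choose ρ T hρ using hrank
  set RR := ZFSet.sUnion (ZFSet.range fun R : D.powerset => insert (j (ρ R)) (j (T R)))
  have hRR : ∀ R : D.powerset, ∀ x ∈ (insert (j (ρ R)) (j (T R)) : ZFSet.{u}), x ∈ RR :=
    fun R x hx => ZFSet.mem_sUnion.2 ⟨_, ZFSet.mem_range.2 ⟨R, rfl⟩, hx⟩
  refine ⟨e, RR, ⟨trans_dom, fun x hx y hy => ⟨_, pair_dom x hx y hy, rfl⟩, hκ, trans_idx,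
    pair_idx', hsub κ hκD κ E.crit.2.1, ?_, ?_, ?_, ?_, ?_, ?_, ?_, ?_, ?_, ?_, ?_, ?_, ?_, ?_,
    ?_, ?_⟩, ?_⟩
  · intro X hX Y hY Z hZ h a ha h1 h2
    rw [he hX ha] at h1
    rw [he hY ha] at h2
    rw [he hZ ha]
    exact (d_mono.transfer E.trans E.e (X, Y, Z, D)).1 h a ha h1 h2
  · intro X hX Y hY h a ha
    rw [he hX ha, he hY ha]
    exact (d_compl.transfer E.trans E.e (X, Y, D)).1 h a ha
  · intro X hX Y hY h a ha
    rw [he hX ha, he hY ha]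
    exact (d_disj.transfer E.trans E.e (X, Y, D)).1 h a ha
  · intro P hP h a ha
    rw [he hP (pair_idx a ha a ha)]
    exact (d_diag.transfer E.trans E.e (P, D)).1 h a ha
  · intro P hP h c hc a ha b hb hcab
    rw [he hP (pair_idx c hc a ha)]
    exact (d_fst.transfer E.trans E.e (P, D)).1 h c hc a ha b hb hcab
  · intro P hP h c hc a ha b hb hcab
    rw [he hP (pair_idx c hc b hb)]
    exact (d_snd.transfer E.trans E.e (P, D)).1 h c hc a ha b hb hcab
  · intro P hP h a ha
    obtain ⟨b, hb, hab⟩ := (d_total.transfer E.trans E.e (P, D)).1 h a ha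
    exact ⟨b, hb, (he hP (pair_idx a ha b hb)).2 hab⟩
  · intro P hP X hX Y hY h a ha b hb h1 h2
    rw [he hP (pair_idx a ha b hb)] at h1
    rw [he hX ha] at h2
    rw [he hY hb]
    exact (d_push.transfer E.trans E.e (P, X, Y, D)).1 h a ha b hb h1 h2
  · intro P hP Q hQ R hR h a ha b hb c hc h1 h2
    rw [he hP (pair_idx a ha b hb)] at h1
    rw [he hQ (pair_idx b hb c hc)] at h2
    rw [he hR (pair_idx a ha c hc)]
    exact (d_comp.transfer E.trans E.e (P, Q, R, D)).1 h a ha b hb c hc h1 h2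
  · intro P hP Q hQ X hX h a ha b hb h1 h2
    rw [he hP (pair_idx a ha b hb)] at h1
    rw [he hQ (pair_idx a ha b hb)] at h2
    rw [he hX ha]
    exact (d_parallel.transfer E.trans E.e (P, Q, X, D)).1 h a ha b hb h1 h2
  · intro P hP Q hQ X hX R hR h a ha b hb c hc h1 h2 h3
    rw [he hP (pair_idx a ha b hb)] at h1
    rw [he hQ (pair_idx a ha c hc)] at h2
    rw [he hX ha] at h3
    rw [he hR (pair_idx b hb c hc)]
    exact (d_fan.transfer E.trans E.e (P, Q, X, R, D)).1 h a ha b hb c hc h1 h2 h3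
  · intro P hP h a ha b hb hab
    rw [he hP (pair_idx a ha b hb)]
    exact (d_of_mem.transfer E.trans E.e (P, D)).1 h a ha b hb hab
  · intro P hP h a ha b hb hab
    rw [he hP (pair_idx a ha b hb)] at hab
    exact (d_to_mem.transfer E.trans E.e (P, D)).1 h a ha b hb hab
  · intro R hR h
    obtain ⟨h1, h2, h3⟩ :=
      (d_ranked.transfer E.trans E.e (ρ ⟨R, hR⟩, T ⟨R, hR⟩, R, D)).1 (hρ ⟨R, hR⟩ h)
    have hval : ∀ {a s}, ZFSet.pair a s ∈ j (ρ ⟨R, hR⟩) → s ∈ j (T ⟨R, hR⟩) := by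
      intro a s has
      obtain ⟨a', -, s', hs', heq⟩ := h1 _ has
      rw [(ZFSet.pair_inj.1 heq).2]
      exact hs'
    refine ⟨j (ρ ⟨R, hR⟩), hRR ⟨R, hR⟩ _ (ZFSet.mem_insert _ _), ?_, ?_⟩
    · intro a ha s _ t _ hs ht
      exact h2 a ha s (hval hs) t (hval ht) hs ht
    · intro a ha b hb hab
      rw [he hR (pair_idx a ha b hb)] at hab
      obtain ⟨s, hs, t, ht, hst⟩ := h3 a ha b hb hab
      exact ⟨s, hRR ⟨R, hR⟩ _ (ZFSet.mem_insert_of_mem _ hs), t,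
        hRR ⟨R, hR⟩ _ (ZFSet.mem_insert_of_mem _ ht), hst⟩
  · intro α hα a ha
    rw [he (ZFSet.mem_powerset.2 fun x hx => trans_dom α (hκD hα) x hx) ha]
    change a ∈ E.e.j α ↔ _
    rw [E.crit.2.2 α (E.crit.1.mem hα) hα]
  · exact (he (ZFSet.mem_powerset.2 hκD) (hsub κ hκD κ E.crit.2.1)).2 E.crit.2.1
  · intro X hX a ha
    exact (he (ZFSet.mem_powerset.2 hX) (hsub X hX a ha)).2 ha

theorem ClassEmb.mono {M : Set ZFSet.{u}} (hM : TransClass M) (e : ClassEmb V M)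
    {x y : ZFSet.{u}} (h : x ⊆ y) : e.j x ⊆ e.j y :=
  ((Del.subset (Γ := ZFSet.{u} × ZFSet.{u}) (.fst .self) (.snd .self)).transfer hM e (x, y)).1 h

open ZFSet in
/-- An embedding moves the levels of the von Neumann hierarchy contained in its target up. -/
theorem ClassEmb.vonNeumann_subset {M : Set ZFSet.{u}} (hM : TransClass M) (e : ClassEmb V M)
    {o : Ordinal.{u}} (ho : ∀ x : ZFSet.{u}, x.rank < o → x ∈ M) : V_ o ⊆ e.j (V_ o) := by
  induction o using WellFoundedLT.induction with
  | _ o ih =>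
  intro x hx
  have hxM := ho x (mem_vonNeumann.1 hx)
  obtain ⟨b, hb, hxb⟩ := mem_vonNeumann'.1 hx
  have hQ : Del (fun p : ZFSet.{u} × ZFSet.{u} × ZFSet.{u} => p.1 ⊆ p.2.1 → p.1 ∈ p.2.2) :=
    .imp (.subset (.fst .self) (.fst (.snd .self))) (.mem (.fst .self) (.snd (.snd .self)))
  exact Del.transfer_forall (Q := fun x (p : ZFSet.{u} × ZFSet.{u}) => x ⊆ p.1 → x ∈ p.2) hQ hM e
    (V_ b, V_ o) (fun y hy => mem_vonNeumann'.2 ⟨b, hb, hy⟩) x hxM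
    (hxb.trans (ih b hb fun y hy => ho y (hy.trans hb)))

/-- The order-preserving map `f` bounds the ranks of the elements of `b` by elements of `α`. -/
def RankBound (f W b α : ZFSet.{u}) : Prop :=
  (∀ x ∈ W, ∀ y ∈ x, y ∈ W) ∧ (∀ x ∈ b, x ∈ W ∧ ∃ s ∈ α, ZFSet.pair x s ∈ f) ∧
  ∀ x ∈ W, ∀ y ∈ x, ∀ s ∈ α, ZFSet.pair x s ∈ f → ∃ t ∈ α, t ∈ s ∧ ZFSet.pair y t ∈ f

theorem RankBound.rank_lt {f W b α : ZFSet.{u}} (h : RankBound f W b α) {x : ZFSet.{u}}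
    (hx : x ∈ b) : x.rank < α.rank := by
  obtain ⟨h1, h2, h3⟩ := h
  have key : ∀ x : ZFSet.{u}, x ∈ W → ∀ s ∈ α, ZFSet.pair x s ∈ f → x.rank ≤ s.rank := by
    intro x
    induction x using ZFSet.inductionOn with
    | _ x ih =>
    intro hxW s hs hxs
    rw [ZFSet.rank_le_iff]
    intro y hy
    obtain ⟨t, ht, hts, hyt⟩ := h3 x hxW y hy s hs hxs
    exact (ih y hy (h1 x hxW y hy) t ht hyt).trans_lt (ZFSet.rank_lt_of_mem hts)
  obtain ⟨hxW, s, hs, hxs⟩ := h2 x hx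
  exact (key x hxW s hs hxs).trans_lt (ZFSet.rank_lt_of_mem hs)

open ZFSet in
theorem exists_rankBound (b : ZFSet.{u}) : ∃ f W, RankBound f W b b.rank.toZFSet := by
  refine ⟨ZFSet.range fun x : (V_ b.rank : ZFSet.{u}) => ZFSet.pair x.1 x.1.rank.toZFSet,
    V_ b.rank, fun x hx y hy => (isTransitive_vonNeumann _).mem_trans hy hx, ?_, ?_⟩
  · intro x hx
    have hx' := subset_vonNeumann_self b hx
    exact ⟨hx', _, Ordinal.mem_toZFSet_iff.2 ⟨_, ZFSet.rank_lt_of_mem hx, rfl⟩,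
      ZFSet.mem_range.2 ⟨⟨x, hx'⟩, rfl⟩⟩
  · intro x hx y hy s _ hxs
    obtain ⟨x', hx'⟩ := ZFSet.mem_range.1 hxs
    obtain ⟨rfl, rfl⟩ := ZFSet.pair_inj.1 hx'
    have hyb := (isTransitive_vonNeumann _).mem_trans hy x'.2
    exact ⟨_, Ordinal.mem_toZFSet_iff.2 ⟨_, mem_vonNeumann.1 hyb, rfl⟩,
      Ordinal.toZFSet_mem_toZFSet_iff.2 (ZFSet.rank_lt_of_mem hy),
      ZFSet.mem_range.2 ⟨⟨y, hyb⟩, rfl⟩⟩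

theorem del_rankBound : Del (fun p : ZFSet.{u} × ZFSet.{u} × ZFSet.{u} × ZFSet.{u} =>
    RankBound p.1 p.2.1 p.2.2.1 p.2.2.2) := by
  unfold RankBound
  repeat' with_reducible first
    | apply Proj.self | apply Proj.fst | apply Proj.snd
    | apply Del.ball | apply Del.bex | apply Del.and | apply Del.imp
    | apply Del.pair_mem | apply Del.mem

/-- An embedding fixes the sets of rank below its critical point. -/
theorem MeasEmb.fixed {κ : ZFSet.{u}} (E : MeasEmb κ) {b : ZFSet.{u}} (hb : b.rank < κ.rank) :
    E.e.j b = b := by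
  have key : ∀ (o : Ordinal.{u}) (b : ZFSet.{u}), b.rank = o → o < κ.rank → E.e.j b = b := by
    intro o
    induction o using WellFoundedLT.induction with
    | _ o ih =>
    rintro b rfl hb
    have hfix : ∀ y : ZFSet.{u}, y.rank < b.rank → E.e.j y = y := fun y hy =>
      ih _ hy y rfl (hy.trans hb)
    obtain ⟨f, W, hf⟩ := exists_rankBound b
    have hf' : RankBound (E.e.j f) (E.e.j W) (E.e.j b) (E.e.j b.rank.toZFSet) :=
      (del_rankBound.transfer E.trans E.e (f, W, b, b.rank.toZFSet)).1 hf
    have hα : b.rank.toZFSet ∈ κ := by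
      rwa [← (ZFSet.isOrdinal_toZFSet _).rank_lt_iff_mem E.crit.1, Ordinal.rank_toZFSet]
    rw [E.crit.2.2 _ (ZFSet.isOrdinal_toZFSet _) hα] at hf'
    have hiff : ∀ y : ZFSet.{u}, y.rank < b.rank → (y ∈ E.e.j b ↔ y ∈ b) := fun y hy => by
      have h := (Del.mem (Γ := ZFSet.{u} × ZFSet.{u}) (.fst .self) (.snd .self)).transfer
        E.trans E.e (y, b)
      change y ∈ b ↔ E.e.j y ∈ E.e.j b at h
      rw [h, hfix y hy]
    ext y
    constructor
    · intro hy
      have h1 := hf'.rank_lt hy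
      rw [Ordinal.rank_toZFSet] at h1
      exact (hiff y h1).1 hy
    · exact fun hy => (hiff y (ZFSet.rank_lt_of_mem hy)).2 hy
  exact key _ b rfl hb

/-- The elements of `h` are levels of the von Neumann hierarchy, as seen from `K`. -/
def Levels (K h : ZFSet.{u}) : Prop :=
  ∀ x ∈ h, x ∈ K ∧ ∀ y ∈ K, y ∈ x ↔ ∃ z ∈ h, z ∈ x ∧ y ⊆ z

open ZFSet in
theorem Levels.eq_vonNeumann {o : Ordinal.{u}} {h x : ZFSet.{u}} (hh : Levels (V_ o) h)
    (hx : x ∈ h) : x = V_ x.rank := by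
  induction x using ZFSet.inductionOn with
  | _ x ih =>
  obtain ⟨hxK, hx'⟩ := hh x hx
  refine ZFSet.ext fun y => ⟨fun hy => subset_vonNeumann_self x hy, fun hy => ?_⟩
  rw [mem_vonNeumann] at hy
  obtain ⟨z, hzx, hyz⟩ := ZFSet.lt_rank_iff.1 hy
  obtain ⟨w, hwh, hwx, hzw⟩ := (hx' z ((isTransitive_vonNeumann o).mem_trans hzx hxK)).1 hzx
  refine (hx' y (mem_vonNeumann.2 (hy.trans (mem_vonNeumann.1 hxK)))).2 ⟨w, hwh, hwx, ?_⟩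
  rw [ih w hwx hwh, subset_vonNeumann]
  exact hyz.trans (ZFSet.rank_mono hzw)

open ZFSet in
/-- The set of the levels of the von Neumann hierarchy below `o`. -/
noncomputable def levelsBelow (o : Ordinal.{u}) : ZFSet.{u} :=
  ZFSet.sep (fun x => x = V_ x.rank) (V_ o)

open ZFSet in
theorem levels_levelsBelow {o : Ordinal.{u}} {K : ZFSet.{u}} (hK : V_ o ⊆ K) :
    Levels K (levelsBelow o) := by
  intro x hx
  obtain ⟨hxo, hxr⟩ := ZFSet.mem_sep.1 hx
  refine ⟨hK hxo, fun y _ => ⟨fun hy => ?_, ?_⟩⟩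
  · rw [hxr, mem_vonNeumann'] at hy
    obtain ⟨a, ha, hya⟩ := hy
    refine ⟨V_ a, ZFSet.mem_sep.2 ⟨vonNeumann_mem_of_lt (ha.trans (mem_vonNeumann.1 hxo)), ?_⟩,
      ?_, hya⟩
    · rw [rank_vonNeumann]
    · rw [hxr]
      exact vonNeumann_mem_of_lt ha
  · rintro ⟨z, -, hzx, hyz⟩
    rw [hxr] at hzx ⊢
    exact mem_vonNeumann_of_subset hyz hzx

open ZFSet in
theorem vonNeumann_mem_levelsBelow {a b : Ordinal.{u}} (h : a < b) : V_ a ∈ levelsBelow b :=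
  ZFSet.mem_sep.2 ⟨vonNeumann_mem_of_lt h, by rw [rank_vonNeumann]⟩

theorem rank_pair_lt {o : Ordinal.{u}} (ho : Order.IsSuccLimit o) {x y : ZFSet.{u}}
    (hx : x.rank < o) (hy : y.rank < o) : (ZFSet.pair x y).rank < o := by
  rw [ZFSet.pair, ZFSet.rank_pair, ZFSet.rank_pair, ZFSet.rank_singleton]
  simp only [max_lt_iff]
  exact ⟨ho.succ_lt (ho.succ_lt hx), ho.succ_lt (max_lt (ho.succ_lt hx) (ho.succ_lt hy))⟩

/-! ### Reflecting measurability and anticipation -/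

/-- `K` correctly recognizes elements of `κ` carrying an extender in `K` as elements of `W`. -/
def MeasWitnessed (κ K W : ZFSet.{u}) : Prop :=
  ∀ δ ∈ κ, ∀ D ∈ K, ∀ PD ∈ K, ∀ B ∈ K, ∀ e ∈ K, ∀ RR ∈ K,
    (∀ X ∈ K, X ⊆ D → X ∈ PD) → SetExt δ D PD B e RR → δ ∈ W

/-- The extender `e` on `D` sends a subset `s` of `r` to a set containing the pair of `δ`
and `A`. -/
def Captures (K r δ D A PD B e RR s : ZFSet.{u}) : Prop :=
  (∀ X ∈ K, X ⊆ D → X ∈ PD) ∧ SetExt δ D PD B e RR ∧ D ⊆ B ∧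
    (∀ p ∈ s, p ∈ r ∧ ∃ γ ∈ δ, ∃ a ∈ K, p = ZFSet.pair γ a) ∧
    ZFSet.pair s (ZFSet.pair δ A) ∈ e

/-- For all `δ ∈ T`, the elements of the suitable levels `D` of the von Neumann hierarchy
in `K` are captured by extenders from `H`. -/
def AllCaptured (K T r H : ZFSet.{u}) : Prop :=
  ∀ δ ∈ T, ∀ h ∈ K, ∀ D ∈ h, ∀ A ∈ D, Levels K h → δ ∈ D →
    (∀ x ∈ D, ∀ y ∈ D, ∃ z ∈ D, z = ZFSet.pair x y) →
    (∀ p ∈ r, ∀ γ ∈ δ, ∀ a ∈ K, p = ZFSet.pair γ a → p ∈ D) →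
    ∃ PD ∈ H, ∃ B ∈ H, ∃ e ∈ H, ∃ RR ∈ H, ∃ s ∈ H, Captures K r δ D A PD B e RR s

theorem del_measWitnessed : Del (fun p : ZFSet.{u} × ZFSet.{u} × ZFSet.{u} =>
    MeasWitnessed p.1 p.2.1 p.2.2) := by
  unfold MeasWitnessed
  repeat' with_reducible first
    | apply Proj.self | apply Proj.fst | apply Proj.snd
    | apply Del.ball | apply Del.imp | apply Del.setExt | apply Del.subset | apply Del.mem

theorem del_allCaptured : Del (fun p : ZFSet.{u} × ZFSet.{u} × ZFSet.{u} × ZFSet.{u} =>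
    AllCaptured p.1 p.2.1 p.2.2.1 p.2.2.2) := by
  unfold AllCaptured Captures Levels
  repeat' with_reducible first
    | apply Proj.self | apply Proj.fst | apply Proj.snd
    | apply Del.setExt | apply Del.ball | apply Del.bex | apply Del.and | apply Del.iff
    | apply Del.imp | apply Del.pair_pair_mem | apply Del.eq_pair | apply Del.subset
    | apply Del.mem

open ZFSet in
theorem measWitnessed_vonNeumann {κ : ZFSet.{u}} (hκ : κ.IsOrdinal) (o : Ordinal.{u}) :
    MeasWitnessed κ (V_ o) (ZFSet.sep MeasurableCard κ) := by
  intro δ hδ D hD PD _ B _ e _ RR _ hP h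
  obtain ⟨E, -⟩ := h.exists_emb (fun X hX => hP X (mem_vonNeumann_of_subset hX hD) hX)
    (hκ.mem hδ)
  exact ZFSet.mem_sep.2 ⟨hδ, ⟨E⟩⟩

theorem exists_uniform (T : ZFSet.{u}) {P : ZFSet.{u} → ZFSet.{u} → Prop}
    (mono : ∀ x Y Z, Y ⊆ Z → P x Y → P x Z) (h : ∀ x ∈ T, ∃ Y, P x Y) :
    ∃ Y, ∀ x ∈ T, P x Y := by
  choose f hf using fun x : T => h x.1 x.2
  refine ⟨ZFSet.sUnion (ZFSet.range f), fun x hx => mono x _ _ ?_ (hf ⟨x, hx⟩)⟩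
  exact fun y hy => ZFSet.mem_sUnion.2 ⟨_, ZFSet.mem_range.2 ⟨_, rfl⟩, hy⟩

/-- The target model of a strongness embedding is forgotten. -/
def StrEmb.toMeasEmb {κ θ : ZFSet.{u}} (E : StrEmb κ θ) : MeasEmb κ :=
  ⟨E.M, E.trans, E.e, E.crit⟩

open ZFSet in
theorem LDstrongFun.exists_captures {o α : Ordinal.{u}} {δ s r A : ZFSet.{u}}
    (hs : LDstrongFun δ s) (hsr : s ⊆ r) (hα : α < o) (hδ : δ ∈ V_ α) (hA : A ∈ V_ α)
    (hpair : ∀ x ∈ V_ α, ∀ y ∈ V_ α, ZFSet.pair x y ∈ V_ α)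
    (hr : ∀ p ∈ r, ∀ γ ∈ δ, ∀ a ∈ V_ o, p = ZFSet.pair γ a → p ∈ V_ α) :
    ∃ PD B e RR, Captures (V_ o) r δ (V_ α) A PD B e RR s := by
  have hval : ∀ p ∈ s, ∃ γ ∈ δ, ∃ a ∈ V_ o, p = ZFSet.pair γ a := by
    intro p hp
    obtain ⟨γ, a, hγ, ha, rfl⟩ := hs.1.1 p hp
    exact ⟨γ, hγ, a, mem_vonNeumann.2 ((ha.trans (mem_vonNeumann.1 hδ)).trans hα), rfl⟩
  have hsα : s ⊆ V_ α := by
    intro p hp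
    obtain ⟨γ, hγ, a, ha, hpa⟩ := hval p hp
    exact hr p (hsr hp) γ hγ a ha hpa
  obtain ⟨E, hE⟩ := hs.2 α.toZFSet A (ZFSet.isOrdinal_toZFSet _) (by
    unfold MemV
    rw [Ordinal.rank_toZFSet]
    exact mem_vonNeumann.1 hA)
  obtain ⟨e, RR, h1, h2⟩ := E.toMeasEmb.exists_setExt (D := V_ α)
    (fun x hx y hy => (isTransitive_vonNeumann α).mem_trans hy hx) hpair hδ
  have hsub : V_ α ⊆ E.e.j (V_ α) := E.e.vonNeumann_subset E.trans fun x hx => E.vsub x (by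
    unfold MemV
    rwa [Ordinal.rank_toZFSet])
  exact ⟨_, _, e, RR, fun X _ hX => ZFSet.mem_powerset.2 hX, h1, hsub,
    fun p hp => ⟨hsr hp, hval p hp⟩, h2 s hsα _ hE⟩

open ZFSet in
theorem exists_allCaptured {T r : ZFSet.{u}} (o : Ordinal.{u})
    (hT : ∀ δ ∈ T, ∃ s, s ⊆ r ∧ LDstrongFun δ s) : ∃ H, AllCaptured (V_ o) T r H := by
  let P (δ D A H : ZFSet.{u}) : Prop := D = V_ D.rank → δ ∈ D →
    (∀ x ∈ D, ∀ y ∈ D, ∃ z ∈ D, z = ZFSet.pair x y) →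
    (∀ p ∈ r, ∀ γ ∈ δ, ∀ a ∈ V_ o, p = ZFSet.pair γ a → p ∈ D) →
    ∃ PD ∈ H, ∃ B ∈ H, ∃ e ∈ H, ∃ RR ∈ H, ∃ s ∈ H, Captures (V_ o) r δ D A PD B e RR s
  have mono : ∀ δ D A Y Z, Y ⊆ Z → P δ D A Y → P δ D A Z := by
    intro δ D A Y Z hYZ h h1 h2 h3 h4
    obtain ⟨PD, hP, B, hB, e, he, RR, hR, s, hs, hc⟩ := h h1 h2 h3 h4
    exact ⟨PD, hYZ hP, B, hYZ hB, e, hYZ he, RR, hYZ hR, s, hYZ hs, hc⟩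
  have hP : ∀ δ ∈ T, ∀ D ∈ V_ o, ∀ A ∈ D, ∃ H, P δ D A H := by
    intro δ hδ D hD A hA
    by_cases hc : ∃ PD B e RR s, Captures (V_ o) r δ D A PD B e RR s
    · obtain ⟨PD, B, e, RR, s, hc⟩ := hc
      refine ⟨{PD, B, e, RR, s}, fun _ _ _ _ => ⟨PD, ?_, B, ?_, e, ?_, RR, ?_, s, ?_, hc⟩⟩ <;>
        simp
    · refine ⟨∅, fun h1 h2 h3 h4 => (hc ?_).elim⟩
      obtain ⟨s, hsr, hs⟩ := hT δ hδ
      rw [mem_vonNeumann] at hD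
      generalize D.rank = α at h1 hD
      subst h1
      obtain ⟨PD, B, e, RR, hc⟩ := hs.exists_captures hsr hD h2 hA (fun x hx y hy => by
        obtain ⟨z, hz, rfl⟩ := h3 x hx y hy
        exact hz) h4
      exact ⟨PD, B, e, RR, s, hc⟩
  obtain ⟨H, hH⟩ := exists_uniform T (P := fun δ H => ∀ D ∈ V_ o, ∀ A ∈ D, P δ D A H)
    (fun δ Y Z hYZ h D hD A hA => mono δ D A Y Z hYZ (h D hD A hA)) fun δ hδ =>
      exists_uniform (V_ o) (P := fun D H => ∀ A ∈ D, P δ D A H)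
        (fun D Y Z hYZ h A hA => mono δ D A Y Z hYZ (h A hA)) fun D hD =>
          exists_uniform D (mono δ D) (hP δ hδ D hD)
  exact ⟨H, fun δ hδ h _ D hD A hA hL =>
    hH δ hδ D (hL D hD).1 A hA (hL.eq_vonNeumann hD)⟩

open ZFSet in
/-- Below its critical point, an embedding adds no pairs to a partial function. -/
theorem MeasEmb.mem_of_mem_map {κ : ZFSet.{u}} (E : MeasEmb κ) {r K p γ a : ZFSet.{u}}
    (hr : IsPFun κ r) (hp : p ∈ E.e.j r) (hγ : γ ∈ κ) (ha : a ∈ E.e.j K)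
    (hpa : p = ZFSet.pair γ a) : p ∈ r := by
  have hγj : E.e.j γ = γ := E.crit.2.2 γ (E.crit.1.mem hγ) hγ
  by_cases h : ∃ b, ZFSet.pair γ b ∈ r
  · obtain ⟨b, hb⟩ := h
    obtain ⟨γ', b', -, hbκ, hpair⟩ := hr.1 _ hb
    obtain ⟨rfl, rfl⟩ := ZFSet.pair_inj.1 hpair
    have hQ : Del (fun q : ZFSet.{u} × ZFSet.{u} × ZFSet.{u} × ZFSet.{u} =>
        ∀ p ∈ q.1, ∀ a ∈ q.2.1, p = ZFSet.pair q.2.2.1 a → a = q.2.2.2) := by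
      repeat' with_reducible first
        | apply Proj.self | apply Proj.fst | apply Proj.snd
        | apply Del.ball | apply Del.imp | apply Del.eq_pair | apply Del.eq
    have := (hQ.transfer E.trans E.e (r, K, γ, b)).1 (by
      rintro p hp a - rfl
      exact hr.2 _ _ _ hp hb) p hp a ha
    change p = ZFSet.pair (E.e.j γ) a → a = E.e.j b at this
    rw [hγj, E.fixed hbκ] at this
    rw [hpa, this hpa]
    exact hb
  · have hQ : Del (fun q : ZFSet.{u} × ZFSet.{u} × ZFSet.{u} =>
        ∀ p ∈ q.1, ∀ a ∈ q.2.1, ¬ p = ZFSet.pair q.2.2 a) := by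
      repeat' with_reducible first
        | apply Proj.self | apply Proj.fst | apply Proj.snd
        | apply Del.ball | apply Del.not | apply Del.eq_pair
    have := (hQ.transfer E.trans E.e (r, K, γ)).1 (by
      rintro p hp a - rfl
      exact h ⟨a, hp⟩) p hp a ha
    change ¬ p = ZFSet.pair (E.e.j γ) a at this
    rw [hγj] at this
    exact (this hpa).elim

open ZFSet in
/-- A Laver function for strongness can be restricted to the measurable cardinals which are not
strong, provided that this is known for all smaller strong cardinals. -/
theorem LDstrongFun.restrict {κ r t : ZFSet.{u}} (hκ : Strong κ) (hr : LDstrongFun κ r)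
    (ht : ∀ p, p ∈ t ↔ p ∈ r ∧ ∃ γ a, p = ZFSet.pair γ a ∧ MeasurableCard γ ∧ ¬ Strong γ)
    (ih : ∀ δ ∈ κ, Strong δ → ∃ s, s ⊆ t ∧ LDstrongFun δ s) : LDstrongFun κ t := by
  have htp : IsPFun κ t := ⟨fun p hp => hr.1.1 p ((ht p).1 hp).1,
    fun γ A B hA hB => hr.1.2 γ A B ((ht _).1 hA).1 ((ht _).1 hB).1⟩
  refine ⟨htp, fun θ A hθ hA => ?_⟩
  obtain ⟨E₀⟩ := hκ ∅ ZFSet.isOrdinal_empty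
  have hκo : κ.IsOrdinal := E₀.crit.1
  obtain ⟨l, hl, hθl, hκl⟩ : ∃ l : Ordinal.{u}, Order.IsSuccLimit l ∧ θ.rank < l ∧
      κ.rank < l := by
    refine ⟨max θ.rank κ.rank + Ordinal.omega0, Ordinal.isSuccLimit_add _
      Ordinal.isSuccLimit_omega0, ?_, ?_⟩
    · exact (le_max_left _ _).trans_lt (lt_add_of_pos_right _ Ordinal.omega0_pos)
    · exact (le_max_right _ _).trans_lt (lt_add_of_pos_right _ Ordinal.omega0_pos)
  have hAl : A ∈ V_ l := mem_vonNeumann.2 (hA.trans hθl)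
  have hκD : κ ∈ V_ l := mem_vonNeumann.2 hκl
  have hpair : ∀ x ∈ V_ l, ∀ y ∈ V_ l, ZFSet.pair x y ∈ V_ l := fun x hx y hy =>
    mem_vonNeumann.2 (rank_pair_lt hl (mem_vonNeumann.1 hx) (mem_vonNeumann.1 hy))
  obtain ⟨e₀, RR₀, hext, -⟩ := E₀.toMeasEmb.exists_setExt (D := V_ l)
    (fun x hx y hy => (isTransitive_vonNeumann l).mem_trans hy hx) hpair hκD
  generalize E₀.toMeasEmb.e.j (V_ l) = B₀ at hext
  let W : ZFSet.{u} := {V_ l, (V_ l).powerset, B₀, e₀, RR₀, levelsBelow (l + 1), V_ (l + 1)}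
  obtain ⟨o, hW⟩ : ∃ o, ∀ x ∈ W, x ∈ V_ o :=
    ⟨W.rank, fun x hx => mem_vonNeumann.2 (ZFSet.rank_lt_of_mem hx)⟩
  have hDo : V_ l ∈ V_ o := hW _ (by simp [W])
  have hPo : (V_ l).powerset ∈ V_ o := hW _ (by simp [W])
  have hBo : B₀ ∈ V_ o := hW _ (by simp [W])
  have heo : e₀ ∈ V_ o := hW _ (by simp [W])
  have hRo : RR₀ ∈ V_ o := hW _ (by simp [W])
  have hLo : levelsBelow (l + 1) ∈ V_ o := hW _ (by simp [W])
  have hlo : V_ (l + 1) ∈ V_ o := hW _ (by simp [W])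
  have hAo : A ∈ V_ o := (isTransitive_vonNeumann o).mem_trans hAl hDo
  have hlo' : l < o := by simpa using hDo
  obtain ⟨E, hE⟩ := hr.2 o.toZFSet A (ZFSet.isOrdinal_toZFSet o) (by
    unfold MemV
    rw [Ordinal.rank_toZFSet]
    exact mem_vonNeumann.1 hAo)
  have hEM : ∀ x : ZFSet.{u}, x.rank < o → x ∈ E.M := fun x hx => E.vsub x (by
    unfold MemV
    rwa [Ordinal.rank_toZFSet])
  have hK : V_ o ⊆ E.e.j (V_ o) := E.e.vonNeumann_subset E.trans hEM
  have hpow : ∀ X ∈ E.e.j (V_ o), X ⊆ V_ l → X ∈ (V_ l).powerset := fun X _ hX =>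
    ZFSet.mem_powerset.2 hX
  have hmeas : κ ∈ E.e.j (ZFSet.sep MeasurableCard κ) :=
    (del_measWitnessed.transfer E.trans E.e (κ, V_ o, ZFSet.sep MeasurableCard κ)).1
      (measWitnessed_vonNeumann hκo o) κ E.crit.2.1 _ (hK hDo) _ (hK hPo) _ (hK hBo) _ (hK heo)
      _ (hK hRo) hpow hext
  have hQ : Del (fun p : ZFSet.{u} × ZFSet.{u} × ZFSet.{u} =>
      ∀ δ ∈ p.1, δ ∈ p.2.1 ∨ δ ∈ p.2.2) := by
    repeat' with_reducible first
      | apply Proj.self | apply Proj.fst | apply Proj.snd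
      | apply Del.ball | apply Del.or | apply Del.mem
  have hcase : κ ∈ E.e.j (ZFSet.sep Strong κ) ∨
      κ ∈ E.e.j (ZFSet.sep (fun δ => MeasurableCard δ ∧ ¬ Strong δ) κ) :=
    (hQ.transfer E.trans E.e (ZFSet.sep MeasurableCard κ, ZFSet.sep Strong κ,
      ZFSet.sep (fun δ => MeasurableCard δ ∧ ¬ Strong δ) κ)).1 (by
        intro δ hδ
        simp only [ZFSet.mem_sep] at hδ ⊢
        tauto) κ hmeas
  rcases hcase with hT | hS
  · obtain ⟨H, hH⟩ := exists_allCaptured (T := ZFSet.sep Strong κ) (r := t) o fun δ hδ =>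
      ih δ (ZFSet.mem_sep.1 hδ).1 (ZFSet.mem_sep.1 hδ).2
    have hmem : ∀ p ∈ E.e.j t, ∀ γ ∈ κ, ∀ a ∈ E.e.j (V_ o), p = ZFSet.pair γ a → p ∈ t :=
      fun p hp γ hγ a ha hpa => E.toMeasEmb.mem_of_mem_map htp hp hγ ha hpa
    have htl : t ⊆ V_ l := by
      intro p hp
      obtain ⟨γ, a, hγ, ha, rfl⟩ := htp.1 p hp
      exact hpair _ ((isTransitive_vonNeumann l).mem_trans hγ hκD) _
        (mem_vonNeumann.2 (ha.trans hκl))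
    obtain ⟨PD, -, B, -, e, -, RR, -, s, -, hP, hSE, hDB, hs, hse⟩ :=
      (del_allCaptured.transfer E.trans E.e (V_ o, ZFSet.sep Strong κ, t, H)).1 hH κ hT
        (levelsBelow (l + 1)) (hK hLo) (V_ l)
        (vonNeumann_mem_levelsBelow (Order.lt_add_one_iff.2 le_rfl)) A hAl
        (levels_levelsBelow (fun x hx => hK ((isTransitive_vonNeumann o).mem_trans hx hlo)))
        hκD (fun x hx y hy => ⟨_, hpair x hx y hy, rfl⟩)
        (fun p hp γ hγ a ha hpa => htl (hmem p hp γ hγ a ha hpa))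
    have hst : s ⊆ t := by
      intro p hp
      obtain ⟨hpt, γ, hγ, a, ha, hpa⟩ := hs p hp
      exact hmem p hpt γ hγ a ha hpa
    obtain ⟨F, hFB, hF⟩ := hSE.exists_emb
      (fun X hX => hP X (hK (mem_vonNeumann_of_subset hX hDo)) hX) hκo
    refine ⟨⟨F.M, F.trans, F.e, F.crit, fun x hx => hFB x (hDB ?_)⟩, ?_⟩
    · exact mem_vonNeumann.2 (lt_trans hx hθl)
    · exact F.e.mono F.trans hst ((hF s (hst.trans htl) _).2 ⟨hDB (hpair _ hκD _ hAl), hse⟩)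
  · refine ⟨⟨E.M, E.trans, E.e, E.crit, fun x hx => hEM x ?_⟩, ?_⟩
    · exact (lt_trans hx hθl).trans hlo'
    · have hQ' : Del (fun p : ZFSet.{u} × ZFSet.{u} × ZFSet.{u} × ZFSet.{u} =>
          ∀ q ∈ p.1, ∀ γ ∈ p.2.1, ∀ a ∈ p.2.2.1, q = ZFSet.pair γ a → q ∈ p.2.2.2) := by
        repeat' with_reducible first
          | apply Proj.self | apply Proj.fst | apply Proj.snd
          | apply Del.ball | apply Del.imp | apply Del.eq_pair | apply Del.mem
      exact (hQ'.transfer E.trans E.e (r, ZFSet.sep (fun δ => MeasurableCard δ ∧ ¬ Strong δ) κ,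
        V_ o, t)).1 (fun q hq γ hγ a _ hqa =>
          (ht q).2 ⟨hq, γ, a, hqa,
            (ZFSet.mem_sep (p := fun δ => MeasurableCard δ ∧ ¬ Strong δ).1 hγ).2⟩)
        _ hE κ hS A (hK hAo) rfl

end LaverDiamond

/-- The restriction of any universal `LD^strong` Laver function to the class of
non-strong measurable cardinals still witnesses `LD^strong`. -/
theorem restrict_univLDstrong_to_nonStrong_measurable
    (ℓ : ZFSet.{u} → ZFSet.{u}) (h : UnivLDstrong ℓ) :
    ∀ κ : ZFSet, Strong κ →
      ∃ r : ZFSet,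
        RestrictEqOn ℓ {δ : ZFSet.{u} | MeasurableCard δ ∧ ¬ Strong δ} κ r ∧
        LDstrongFun κ r := by
  intro κ
  induction κ using ZFSet.inductionOn with
  | _ κ ih =>
  intro hκ
  obtain ⟨r, hr, hL⟩ := h κ hκ
  obtain ⟨E₀⟩ := hκ ∅ ZFSet.isOrdinal_empty
  have ht : RestrictEqOn ℓ {δ | MeasurableCard δ ∧ ¬ Strong δ} κ (ZFSet.sep (fun p =>
      ∃ γ a, p = ZFSet.pair γ a ∧ MeasurableCard γ ∧ ¬ Strong γ) r) := by
    intro p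
    rw [ZFSet.mem_sep, hr p]
    constructor
    · rintro ⟨⟨γ, hγ, rfl⟩, γ', a, hp, hm⟩
      obtain ⟨rfl, -⟩ := ZFSet.pair_inj.1 hp
      exact ⟨γ, hγ, hm, rfl⟩
    · rintro ⟨γ, hγ, hm, rfl⟩
      exact ⟨⟨γ, hγ, rfl⟩, γ, _, rfl, hm⟩
  refine ⟨_, ht, hL.restrict hκ (fun p => ZFSet.mem_sep) fun δ hδ hδs => ?_⟩
  obtain ⟨s, hs, hsL⟩ := ih δ hδ hδs
  refine ⟨s, fun p hp => ?_, hsL⟩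
  obtain ⟨γ, hγ, hm, rfl⟩ := (hs p).1 hp
  exact (ht _).2 ⟨γ, E₀.crit.1.mem_trans hγ hδ, hm, rfl⟩
end

section
/- For an inaccessible cardinal κ, the following are equivalent: (1) LD^wc_κ; (2) there is a partial function L : κ ⇀ V_κ with |L(γ)| ≤ γ for all γ ∈ dom(L), such that for every set A ∈ H(κ⁺) and every nice structure M of size κ containing L and A, there is an elementary embedding j : M → N with critical point κ such that A ∈ j(L)(κ); (3) there is a family 𝓛 of at most κ many functions from κ to V_κ such that for every set A ∈ H(κ⁺) and every nice structure M of size κ containing A and 𝓛, there is an elementary embedding j : M → N with critical point κ such that j(ℓ)(κ) = A for some ℓ ∈ 𝓛. -/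
open FirstOrder

universe u

open LaverDiamond

/-- Form (2) of the weak Laver diamond at `κ`: a partial function `L : κ ⇀ V_κ` guessing
with sets of size at most `γ` at each `γ`. -/
def WeakLD2 (κ : ZFSet.{u}) : Prop :=
  ∃ L : ZFSet, IsPFun κ L ∧
    (∀ γ x : ZFSet, ZFSet.pair γ x ∈ L → Cardinal.mk x.toSet ≤ Cardinal.mk γ.toSet) ∧
    ∀ A M : ZFSet, MemH κ A → Nice κ M → L ∈ M → A ∈ M →
      ∃ N : ZFSet, N.IsTransitive ∧ ∃ e : ClassEmb M.toSet N.toSet,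
        CritPt e.j κ ∧ ∃ Y : ZFSet, ZFSet.pair κ Y ∈ e.j L ∧ A ∈ Y

/-- Form (3) of the weak Laver diamond at `κ`: a family of at most `κ` many functions
from `κ` to `V_κ`, one of which anticipates any given set. -/
def WeakLD3 (κ : ZFSet.{u}) : Prop :=
  ∃ Fam : ZFSet, Cardinal.mk Fam.toSet ≤ Cardinal.mk κ.toSet ∧
    (∀ f ∈ Fam, IsPFun κ f ∧ ∀ γ ∈ κ, ∃ A : ZFSet, ZFSet.pair γ A ∈ f) ∧
    ∀ A M : ZFSet, MemH κ A → Nice κ M → Fam ∈ M → A ∈ M →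
      ∃ N : ZFSet, N.IsTransitive ∧ ∃ e : ClassEmb M.toSet N.toSet,
        CritPt e.j κ ∧ ∃ f : ZFSet, f ∈ Fam ∧ ZFSet.pair κ A ∈ e.j f

namespace LaverDiamond

open ZFSet Cardinal Ordinal

/-! ### First-order definability over transitive classes -/

/-- `P` is uniformly first-order definable over all transitive classes. -/
def FODef (n : ℕ) (P : Set ZFSet.{u} → (Fin n → ZFSet.{u}) → Prop) : Prop :=
  ∃ φ : SetLang.Formula (Fin n), ∀ M : Set ZFSet.{u}, TransClass M → ∀ v : Fin n → M,
    φ.Realize v ↔ P M (fun i => v i)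

namespace FODef

variable {n : ℕ} {P Q : Set ZFSet.{u} → (Fin n → ZFSet.{u}) → Prop}

theorem transfer (hP : FODef n P) {M N : Set ZFSet.{u}} (hM : TransClass M) (hN : TransClass N)
    (e : ClassEmb M N) (v : Fin n → ZFSet.{u}) (hv : ∀ i, v i ∈ M) (h : P M v) :
    P N (fun i => e.j (v i)) := by
  obtain ⟨φ, hφ⟩ := hP
  exact (hφ N hN _).1 ((e.elem φ v hv).1 ((hφ M hM (fun i => ⟨v i, hv i⟩)).2 h))

theorem congr (hP : FODef n P)
    (h : ∀ M, TransClass M → ∀ v : Fin n → ZFSet.{u}, (∀ i, v i ∈ M) → (P M v ↔ Q M v)) :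
    FODef n Q := by
  obtain ⟨φ, hφ⟩ := hP
  exact ⟨φ, fun M hM v => (hφ M hM v).trans (h M hM _ fun i => (v i).2)⟩

theorem mem (i j : Fin n) : FODef n fun _ v => v i ∈ v j :=
  ⟨(show SetLang.Relations 2 from memRel.mem).formula₂ (.var i) (.var j), fun M _ v => by
    rw [Language.Formula.realize_rel₂]; exact Iff.rfl⟩

theorem eq (i j : Fin n) : FODef n fun _ v => v i = v j :=
  ⟨Language.Term.equal (.var i) (.var j), fun M _ v => by
    rw [Language.Formula.realize_equal]; exact Subtype.ext_iff⟩

theorem imp (hP : FODef n P) (hQ : FODef n Q) : FODef n fun M v => P M v → Q M v := by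
  obtain ⟨φ, hφ⟩ := hP
  obtain ⟨ψ, hψ⟩ := hQ
  exact ⟨φ.imp ψ, fun M hM v => by rw [Language.Formula.realize_imp, hφ M hM, hψ M hM]⟩

theorem not (hP : FODef n P) : FODef n fun M v => ¬ P M v := by
  obtain ⟨φ, hφ⟩ := hP
  exact ⟨φ.not, fun M hM v => by rw [Language.Formula.realize_not, hφ M hM]⟩

theorem and (hP : FODef n P) (hQ : FODef n Q) : FODef n fun M v => P M v ∧ Q M v :=
  (hP.imp hQ.not).not.congr fun _ _ _ _ => by tauto

theorem or (hP : FODef n P) (hQ : FODef n Q) : FODef n fun M v => P M v ∨ Q M v :=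
  (hP.not.imp hQ).congr fun _ _ _ _ => by tauto

theorem all {P : Set ZFSet.{u} → (Fin n → ZFSet.{u}) → ZFSet.{u} → Prop}
    (hP : FODef (n + 1) fun M w => P M (fun i => w i.castSucc) (w (Fin.last n))) :
    FODef n fun M v => ∀ x ∈ M, P M v x := by
  obtain ⟨φ, hφ⟩ := hP
  refine ⟨(φ.relabel (Fin.lastCases (Sum.inr ()) Sum.inl : Fin (n + 1) → Fin n ⊕ Unit)).iAlls Unit,
    fun M hM v => ?_⟩
  rw [Language.Formula.realize_iAlls]
  simp only [Language.Formula.realize_relabel, hφ M hM]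
  constructor
  · intro h x hx
    simpa using h fun _ => ⟨x, hx⟩
  · intro h i
    simpa using h (i ()) (i ()).2

theorem ex {P : Set ZFSet.{u} → (Fin n → ZFSet.{u}) → ZFSet.{u} → Prop}
    (hP : FODef (n + 1) fun M w => P M (fun i => w i.castSucc) (w (Fin.last n))) :
    FODef n fun M v => ∃ x ∈ M, P M v x :=
  (FODef.all (P := fun M v x => ¬ P M v x) hP.not).not.congr fun _ _ _ _ => by push Not; rfl

theorem isUnorderedPair (i j k : Fin n) : FODef n fun _ v => v k = {v i, v j} := by
  have h : FODef n fun M v => v i ∈ v k ∧ v j ∈ v k ∧ ∀ x ∈ M, x ∈ v k → x = v i ∨ x = v j :=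
    (mem _ _).and ((mem _ _).and (all ((mem (Fin.last n) k.castSucc).imp
      ((eq (Fin.last n) i.castSucc).or (eq (Fin.last n) j.castSucc)))))
  refine h.congr fun M hM v hv => ⟨fun ⟨h₁, h₂, h₃⟩ => ?_, fun h => ?_⟩
  · ext z
    rw [mem_pair]
    exact ⟨fun hz => h₃ z (hM _ (hv k) _ hz) hz, by rintro (rfl | rfl) <;> assumption⟩
  · simp [h]

theorem isPair (i j k : Fin n) : FODef n fun _ v => v k = pair (v i) (v j) := by
  have h : FODef n fun M v => ∃ x ∈ M, ∃ y ∈ M, x = {v i, v i} ∧ y = {v i, v j} ∧ v k = {x, y} :=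
    ex (ex (P := fun M w y => w (Fin.last n) = {w i.castSucc, w i.castSucc} ∧
        y = {w i.castSucc, w j.castSucc} ∧ w k.castSucc = {w (Fin.last n), y})
      ((isUnorderedPair i.castSucc.castSucc i.castSucc.castSucc (Fin.last n).castSucc).and
        ((isUnorderedPair i.castSucc.castSucc j.castSucc.castSucc (Fin.last (n + 1))).and
          (isUnorderedPair (Fin.last n).castSucc (Fin.last (n + 1)) k.castSucc.castSucc))))
  refine h.congr fun M hM v hv => ⟨?_, fun h => ?_⟩
  · rintro ⟨x, -, y, -, rfl, rfl, h⟩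
    simp [h, pair]
  · refine ⟨_, hM _ (hv k) _ ?_, _, hM _ (hv k) _ ?_, rfl, rfl, ?_⟩ <;> simp [h, pair]

theorem pairMem (i j k : Fin n) : FODef n fun _ v => pair (v i) (v j) ∈ v k := by
  have h : FODef n fun M v => ∃ x ∈ M, x = pair (v i) (v j) ∧ x ∈ v k :=
    ex ((isPair i.castSucc j.castSucc (Fin.last n)).and (mem (Fin.last n) k.castSucc))
  refine h.congr fun M hM v hv => ⟨?_, fun h => ⟨_, hM _ (hv k) _ h, rfl, h⟩⟩
  rintro ⟨x, -, rfl, h⟩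
  exact h

end FODef

/-- The relativization of a formula to the set denoted by the variable `0`. -/
def relativize {n : ℕ} : ∀ {k : ℕ}, SetLang.BoundedFormula (Fin n) k →
    SetLang.BoundedFormula (Fin (n + 1)) k
  | _, .falsum => .falsum
  | _, .equal t₁ t₂ => .equal (t₁.relabel (Sum.map Fin.succ id)) (t₂.relabel (Sum.map Fin.succ id))
  | _, .rel R ts => .rel R fun i => (ts i).relabel (Sum.map Fin.succ id)
  | _, .imp φ ψ => (relativize φ).imp (relativize ψ)
  | k, .all φ => .all (.imp
      (.rel (show SetLang.Relations 2 from memRel.mem)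
        ![.var (.inr (Fin.last k)), .var (.inl 0)])
      (relativize φ))

theorem realize_relativize {M : Set ZFSet.{u}} (hM : TransClass M) {m : ZFSet.{u}} (hm : m ∈ M)
    {n k : ℕ} (φ : SetLang.BoundedFormula (Fin n) k) (v : Fin n → m.toSet) (xs : Fin k → m.toSet) :
    (relativize φ).Realize
      (Fin.cons (⟨m, hm⟩ : M) (fun i => (⟨v i, hM m hm _ (v i).2⟩ : M)) : Fin (n + 1) → M)
      (fun i => (⟨xs i, hM m hm _ (xs i).2⟩ : M)) ↔ φ.Realize v xs := by
  have ht : ∀ {k : ℕ} (xs : Fin k → m.toSet) (t : SetLang.Term (Fin n ⊕ Fin k)),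
      ((Language.Term.realize (M := M)
        (Sum.elim
          (Fin.cons (⟨m, hm⟩ : M) (fun i => (⟨v i, hM m hm _ (v i).2⟩ : M)) : Fin (n + 1) → M)
          (fun i => (⟨xs i, hM m hm _ (xs i).2⟩ : M)))
        (t.relabel (Sum.map Fin.succ id)) : M) : ZFSet) =
        (t.realize (Sum.elim v xs) : m.toSet) := by
    intro k xs t
    rcases t with (i | i) | ⟨f, _⟩
    · rfl
    · rfl
    · exact f.elim
  induction φ with
  | falsum => rfl
  | equal t₁ t₂ =>
    exact Subtype.ext_iff.trans (by rw [ht xs t₁, ht xs t₂]; exact Subtype.ext_iff.symm)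
  | rel R ts =>
    cases R
    change (_ : ZFSet) ∈ (_ : ZFSet) ↔ (_ : ZFSet) ∈ (_ : ZFSet)
    rw [ht, ht]
  | imp φ ψ ihφ ihψ => exact imp_congr (ihφ xs) (ihψ xs)
  | all φ ih =>
    have key : ∀ {k : ℕ} (xs : Fin k → m.toSet) (x : m.toSet),
        (fun i => (⟨(Fin.snoc xs x : Fin (k + 1) → m.toSet) i,
          hM m hm _ ((Fin.snoc xs x : Fin (k + 1) → m.toSet) i).2⟩ : M)) =
        (Fin.snoc (fun i => (⟨xs i, hM m hm _ (xs i).2⟩ : M)) (⟨x, hM m hm _ x.2⟩ : M) :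
          Fin (k + 1) → M) := by
      intro k xs x
      funext i
      refine Fin.lastCases ?_ (fun i => ?_) i <;> simp
    constructor
    · intro h x
      refine (ih (Fin.snoc xs x)).1 ?_
      rw [key]
      refine h ⟨x, hM m hm _ x.2⟩ ?_
      change (_ : ZFSet) ∈ (_ : ZFSet)
      simp
    · intro h x hx
      have hx' : (x : ZFSet) ∈ m := by
        change (_ : ZFSet) ∈ (_ : ZFSet) at hx
        simpa using hx
      have := (ih (Fin.snoc xs ⟨x, hx'⟩)).2 (h ⟨x, hx'⟩)
      rwa [key] at this

/-- An elementary embedding between transitive sets restricts to each transitive element of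
its domain. -/
theorem ClassEmb.exists_restrict {M M' N' : ZFSet.{u}} (hM : M.IsTransitive)
    (hM' : M'.IsTransitive) (hN' : N'.IsTransitive) (hMM' : M ∈ M')
    (e : ClassEmb M'.toSet N'.toSet) :
    ∃ N : ZFSet.{u}, N.IsTransitive ∧ ∃ e' : ClassEmb M.toSet N.toSet, e'.j = e.j := by
  have tM' : TransClass M'.toSet := fun x hx y hy => hM' x hx hy
  have tN' : TransClass N'.toSet := fun x hx y hy => hN' x hx hy
  have hsub : ∀ x, x ∈ M → x ∈ M' := fun x hx => hM' M hMM' hx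
  refine ⟨e.j M, ?_, ⟨e.j, ?_, ?_⟩, rfl⟩
  · have hD : FODef 1 fun K v => ∀ x ∈ K, ∀ y ∈ K, x ∈ v 0 → y ∈ x → y ∈ v 0 :=
      .all (.all (.imp (.mem 1 0) (.imp (.mem 2 1) (.mem 2 0))))
    have := hD.transfer tM' tN' e ![M] (fun i => by fin_cases i; exact hMM')
      fun x _ y _ hx hy => hM x hx hy
    intro x hx y hy
    have hxN := hN' _ (e.maps M hMM') hx
    exact this x hxN y (hN' x hxN hy) hx hy
  · intro x hx
    have hD : FODef 2 fun _ v => v 0 ∈ v 1 := .mem 0 1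
    exact hD.transfer tM' tN' e ![x, M] (by
      intro i; fin_cases i; exacts [hsub x hx, hMM']) hx
  · intro n φ v hv
    have hN : e.j M ∈ N'.toSet := e.maps M hMM'
    have h := e.elem (relativize φ) (Fin.cons M v) (Fin.cases hMM' fun i => hsub _ (hv i))
    refine (realize_relativize tM' hMM' φ (fun i => ⟨v i, hv i⟩) default).symm.trans
      (Iff.trans ?_ (realize_relativize tN' hN φ (fun i => ⟨e.j (v i), _⟩) default))
    exact (iff_of_eq (congrArg₂ (Language.BoundedFormula.Realize _)
      (funext (Fin.cases rfl fun _ => rfl)) (Subsingleton.elim _ _))).trans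
      (h.trans (iff_of_eq (congrArg₂ (Language.BoundedFormula.Realize _)
        (funext (Fin.cases rfl fun _ => rfl)) (Subsingleton.elim _ _))))

/-! ### Sets of hereditary size at most `κ` -/

theorem IsCard.ord_card {κ : ZFSet.{u}} (hκ : IsCard κ) : κ.card.ord = κ.rank := by
  have hcard : κ.card = κ.rank.card := by rw [← card_toZFSet, hκ.1.toZFSet_rank_eq]
  refine le_antisymm (by rw [hcard]; exact Cardinal.ord_card_le _) (not_lt.1 fun h => ?_)
  have hmem := toZFSet_mem_toZFSet_iff.2 h
  rw [hκ.1.toZFSet_rank_eq] at hmem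
  have := hκ.2 _ hmem
  change #(κ.card.ord.toZFSet : ZFSet) < #κ at this
  rw [cardinalMk_coe_sort, cardinalMk_coe_sort, card_toZFSet, Cardinal.card_ord] at this
  exact this.false

/-- For every set smaller than the cardinal `κ` there is an equinumerous element of `κ`. -/
theorem IsCard.exists_equiv_mem {κ x : ZFSet.{u}} (hκ : IsCard κ)
    (hx : #x.toSet < #κ.toSet) : ∃ γ ∈ κ, Nonempty (γ ≃ x) := by
  have hx' : x.card < κ.card := by
    change #x < #κ at hx
    rwa [cardinalMk_coe_sort, cardinalMk_coe_sort, Cardinal.lift_lt] at hx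
  refine ⟨x.card.ord.toZFSet, ?_, ?_⟩
  · have := toZFSet_mem_toZFSet_iff.2 (ord_strictMono hx')
    rwa [hκ.ord_card, hκ.1.toZFSet_rank_eq] at this
  · rw [← Cardinal.eq, cardinalMk_coe_sort, cardinalMk_coe_sort, card_toZFSet, Cardinal.card_ord]

section Inaccessible

variable {κ : ZFSet.{u}}

theorem mk_vonNeumann_rank (hκ : IsCard κ) (hin : (#κ.toSet).IsInaccessible) :
    #(vonNeumann κ.rank).toSet = #κ.toSet := by
  have h : #κ.toSet = lift.{u + 1} κ.card := cardinalMk_coe_sort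
  change #(vonNeumann κ.rank) = _
  rw [cardinalMk_coe_sort, card_vonNeumann, lift_preBeth, ← hκ.ord_card]
  conv_rhs => rw [← hin.preBeth_ord, h, ← lift_ord]

theorem isSuccLimit_rank (hκ : IsCard κ) (hin : (#κ.toSet).IsInaccessible) :
    Order.IsSuccLimit κ.rank := by
  rw [← hκ.ord_card]
  refine isSuccLimit_ord ?_
  have h : #κ.toSet = lift.{u + 1} κ.card := cardinalMk_coe_sort
  have := hin.aleph0_lt.le
  rwa [h, aleph0_le_lift] at this

theorem memH_of_forall_mem (hκ : ℵ₀ ≤ #κ.toSet) {x : ZFSet.{u}} (hx : #x.toSet ≤ #κ.toSet)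
    (h : ∀ y ∈ x, MemH κ y) : MemH κ x := by
  choose! t ht₁ ht₂ ht₃ using h
  let U : ZFSet := ⋃ y : x, t y
  refine ⟨insert x U, ?_, mem_insert _ _, ?_⟩
  · intro y hy z hz
    refine mem_insert_of_mem _ (mem_iUnion.2 ?_)
    rcases mem_insert_iff.1 hy with rfl | hy
    · exact ⟨⟨z, hz⟩, ht₂ z hz⟩
    · obtain ⟨⟨w, hw⟩, hyw⟩ := mem_iUnion.1 hy
      exact ⟨⟨w, hw⟩, ht₁ w hw y hyw hz⟩
  · have hU : #U.toSet ≤ #κ.toSet := by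
      have : U.toSet = ⋃ y : x, (t y).toSet := by
        ext z
        rw [Set.mem_iUnion]
        exact mem_iUnion
      rw [this]
      refine (mk_iUnion_le _).trans ?_
      refine (mul_le_mul' hx (ciSup_le' fun y : x => ht₃ y y.2)).trans ?_
      exact (mul_eq_self hκ).le
    have : (insert x U).toSet = insert x U.toSet := by
      ext z
      exact mem_insert_iff
    rw [this]
    exact mk_insert_le.trans (add_le_of_le hκ hU (one_le_aleph0.trans hκ))

theorem MemH.of_mem {x y : ZFSet.{u}} (h : MemH κ x) (hy : y ∈ x) : MemH κ y := by
  obtain ⟨t, ht, hx, hc⟩ := h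
  exact ⟨t, ht, ht x hx hy, hc⟩

theorem memH_empty (hκ : ℵ₀ ≤ #κ.toSet) : MemH κ ∅ :=
  memH_of_forall_mem hκ (by
    change #(∅ : ZFSet) ≤ _
    rw [cardinalMk_coe_sort]; simp) (by simp)

theorem MemH.insert (hκ : ℵ₀ ≤ #κ.toSet) {x y : ZFSet.{u}} (hx : MemH κ x) (hy : MemH κ y) :
    MemH κ (insert x y) := by
  refine memH_of_forall_mem hκ ?_ fun z hz => ?_
  · obtain ⟨t, ht, hyt, hc⟩ := hy
    have : (Insert.insert x y).toSet = Insert.insert x y.toSet := by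
      ext z
      exact mem_insert_iff
    rw [this]
    refine mk_insert_le.trans (add_le_of_le hκ ?_ (one_le_aleph0.trans hκ))
    exact (mk_le_mk_of_subset fun z hz => ht y hyt hz).trans hc
  · rcases mem_insert_iff.1 hz with rfl | hz
    exacts [hx, hy.of_mem hz]

theorem MemH.pair (hκ : ℵ₀ ≤ #κ.toSet) {x y : ZFSet.{u}} (hx : MemH κ x) (hy : MemH κ y) :
    MemH κ (pair x y) := by
  have h₀ := memH_empty hκ
  have hs : ∀ {z}, MemH κ z → MemH κ ({z} : ZFSet) := fun {z} hz => by
    simpa using hz.insert hκ h₀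
  exact (hs hx).insert hκ (hs (hx.insert hκ (hs hy)))

theorem memH_of_isTransitive (hκ : ℵ₀ ≤ #κ.toSet) {M : ZFSet.{u}} (hM : M.IsTransitive)
    (hc : #M.toSet ≤ #κ.toSet) : MemH κ M :=
  memH_of_forall_mem hκ hc fun _ hy => ⟨M, hM, hy, hc⟩

theorem MemV.memH (hκ : IsCard κ) (hin : (#κ.toSet).IsInaccessible) {x : ZFSet.{u}}
    (hx : MemV κ x) : MemH κ x :=
  ⟨_, isTransitive_vonNeumann κ.rank, mem_vonNeumann.2 hx, (mk_vonNeumann_rank hκ hin).le⟩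

theorem IsPFun.memH (hκ : IsCard κ) (hin : (#κ.toSet).IsInaccessible) {f : ZFSet.{u}}
    (hf : IsPFun κ f) : MemH κ f := by
  have hinf := hin.aleph0_lt.le
  refine memH_of_forall_mem hinf ?_ fun p hp => ?_
  · choose! γ A hγ hA h using hf.1
    refine mk_le_of_injective (f := fun p : f.toSet => (⟨γ p, hγ p p.2⟩ : κ.toSet)) ?_
    rintro ⟨p, hp⟩ ⟨q, hq⟩ hpq
    have hpq' : γ p = γ q := congrArg Subtype.val hpq
    have hp' := h p hp
    have hq' := h q hq
    have := hf.2 (γ p) (A p) (A q) (hp' ▸ hp) (by rw [hpq']; exact hq' ▸ hq)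
    exact Subtype.ext (hp'.trans ((congrArg₂ _ hpq' this).trans hq'.symm))
  · obtain ⟨γ, A, hγ, hA, rfl⟩ := hf.1 p hp
    exact .pair hinf ((memH_of_isTransitive hinf hκ.1.isTransitive le_rfl).of_mem hγ)
      (hA.memH hκ hin)

theorem mk_fun_le_of_isInaccessible {α β : Type u} (hα : (#α).IsInaccessible) (hβ : #β < #α) :
    #(β → α) ≤ #α := by
  have hinf := hα.aleph0_lt.le
  rcases isEmpty_or_nonempty β with hβ₀ | hβ₀
  · rw [mk_eq_one]
    exact one_le_aleph0.trans hinf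
  have hprod : #(β × α) = #α := by
    rw [mk_prod, Cardinal.lift_id, Cardinal.lift_id]
    exact mul_eq_right hinf hβ.le (mk_ne_zero β)
  have hlim : IsStrongPrelimit #(β × α) := by rw [hprod]; exact hα.isStrongPrelimit
  rw [← hprod, ← mk_subset_mk_lt_cof hlim, hprod, hα.isRegular.cof_ord]
  refine mk_le_of_injective (f := fun g : β → α => ⟨Set.range fun b => (b, g b), ?_⟩) ?_
  · exact mk_range_le.trans_lt hβ
  · intro g g' h
    funext b
    have hs : (Set.range fun b => (b, g b)) = Set.range fun b => (b, g' b) :=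
      congrArg Subtype.val h
    obtain ⟨b', hb'⟩ : (b, g b) ∈ Set.range fun b => (b, g' b) := hs ▸ ⟨b, rfl⟩
    simp only [Prod.mk.injEq] at hb'
    rw [← hb'.2, hb'.1]

/-- Arities for the closure of `t` under forming sets indexed by elements of `κ`. -/
def ClosureArity (t κ : ZFSet.{u}) : t ⊕ κ → Type (u + 1)
  | .inl _ => PEmpty
  | .inr γ => (γ : ZFSet.{u})

theorem mk_closureTerm_le (hκ : IsCard κ) (hin : (#κ.toSet).IsInaccessible) {t : ZFSet.{u}}
    (ht : #t.toSet ≤ #κ.toSet) : #(WType (ClosureArity t κ)) ≤ #κ.toSet := by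
  have hinf := hin.aleph0_lt.le
  refine WType.cardinalMk_le_of_le ?_
  have : ∀ a, #κ.toSet ^ #(ClosureArity t κ a) ≤ #κ.toSet := by
    rintro (x | γ)
    · change _ ^ #PEmpty ≤ _
      simpa using one_le_aleph0.trans hinf
    · rw [power_def]
      exact mk_fun_le_of_isInaccessible hin (hκ.2 γ γ.2)
  refine (sum_le_sum _ _ this).trans ?_
  rw [sum_const', mk_sum, Cardinal.lift_id, Cardinal.lift_id]
  exact (mul_le_mul_left (add_le_of_le hinf ht le_rfl) _).trans (mul_eq_self hinf).le

instance {t κ : ZFSet.{u}} (a : t ⊕ κ) : Small.{u} (ClosureArity t κ a) := by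
  rcases a with x | γ
  · exact inferInstanceAs (Small.{u} PEmpty)
  · exact small_coe (γ : ZFSet.{u})

/-- The set denoted by a closure term. -/
noncomputable def evalClosure {t κ : ZFSet.{u}} : WType (ClosureArity t κ) → ZFSet.{u}
  | ⟨.inl x, _⟩ => x
  | ⟨.inr _, g⟩ => ZFSet.range fun i => evalClosure (g i)

theorem MemH.exists_nice (hκ : IsCard κ) (hin : (#κ.toSet).IsInaccessible) {x : ZFSet.{u}}
    (hx : MemH κ x) : ∃ M : ZFSet.{u}, Nice κ M ∧ x ∈ M := by
  have hinf := hin.aleph0_lt.le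
  have hκH : MemH κ κ := memH_of_isTransitive hinf hκ.1.isTransitive le_rfl
  obtain ⟨t, ht, hpt, hc⟩ := hκH.pair hinf hx
  have hW := mk_closureTerm_le hκ hin hc
  have : Small.{u} (WType (ClosureArity t κ)) := by
    obtain ⟨f⟩ := hW
    have : Small.{u} κ.toSet := small_coe κ
    exact small_of_injective f.injective
  let M : ZFSet := ZFSet.range (evalClosure : WType (ClosureArity t κ) → ZFSet.{u})
  have htM : ∀ y ∈ t, y ∈ M := fun y hy => mem_range.2 ⟨⟨.inl ⟨y, hy⟩, PEmpty.elim⟩, rfl⟩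
  have hMtrans : M.IsTransitive := by
    intro y hy z hz
    obtain ⟨⟨a | γ, g⟩, rfl⟩ := mem_range.1 hy
    · rw [evalClosure] at hz
      exact htM z (ht _ a.2 hz)
    · rw [evalClosure] at hz
      obtain ⟨i, rfl⟩ := mem_range.1 hz
      exact mem_range_self _
  have hMsub : ∀ y : ZFSet, (∀ z ∈ y, z ∈ M) → #y.toSet < #κ.toSet → y ∈ M := by
    intro y hy hlt
    obtain ⟨γ, hγ, ⟨e⟩⟩ := hκ.exists_equiv_mem hlt
    choose w hw using fun z hz => mem_range.1 (hy z hz)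
    refine mem_range.2 ⟨⟨.inr ⟨γ, hγ⟩, fun i => w (e i) (e i).2⟩, ?_⟩
    rw [evalClosure]
    ext z
    rw [mem_range]
    constructor
    · rintro ⟨i, rfl⟩
      rw [hw _ (e i).2]
      exact (e i).2
    · intro hz
      refine ⟨e.symm ⟨z, hz⟩, ?_⟩
      simp [hw z hz]
  have hMpair : ∀ y z : ZFSet, y ∈ M → z ∈ M → ({y, z} : ZFSet) ∈ M := by
    intro y z hy hz
    refine hMsub _ (by simp [hy, hz]) (lt_of_lt_of_le ?_ hinf)
    have : ({y, z} : ZFSet).toSet = {y, z} := by ext; exact mem_pair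
    rw [this]
    exact (Set.toFinite _).lt_aleph0
  have hκt : κ ∈ t := ht _ (ht _ hpt (by simp [ZFSet.pair] : ({κ} : ZFSet) ∈ _)) (by simp)
  have hxt : x ∈ t := ht _ (ht _ hpt (by simp [ZFSet.pair] : ({κ, x} : ZFSet) ∈ _)) (by simp)
  have hκM := htM κ hκt
  refine ⟨M, ⟨hMtrans, le_antisymm ?_ ?_, ?_, hκM⟩, htM x hxt⟩
  · have : M.toSet = Set.range (evalClosure : WType (ClosureArity t κ) → ZFSet.{u}) := by
      ext; exact mem_range
    rw [this]
    exact mk_range_le.trans hW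
  · exact mk_le_mk_of_subset fun z hz => hMtrans κ hκM hz
  · intro α hα f hf
    refine hMsub f ?_ ?_
    · intro p hp
      obtain ⟨a, b, ha, hb, rfl⟩ := hf.1 p hp
      have haM := hMtrans κ hκM (hκ.1.mem_trans ha hα)
      have := hMpair _ _ (hMpair a a haM haM) (hMpair a b haM hb)
      simpa [ZFSet.pair] using this
    · refine lt_of_le_of_lt ?_ (hκ.2 α hα)
      choose! g hg₁ hg₂ using hf.2
      refine mk_le_of_surjective
        (f := fun a : α.toSet => (⟨ZFSet.pair a (g a), hg₁ a a.2⟩ : f.toSet)) ?_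
      rintro ⟨p, hp⟩
      obtain ⟨a, b, ha, hb, rfl⟩ := hf.1 p hp
      exact ⟨⟨a, ha⟩, Subtype.ext (by simp [hg₂ a ha b hp])⟩

end Inaccessible

/-! ### The implications between the forms of the Laver diamond -/

theorem transClass_toSet {M : ZFSet.{u}} (hM : M.IsTransitive) : TransClass M.toSet :=
  fun x hx _ hy => hM x hx hy

theorem mem_of_pair_mem_s16 {M a b : ZFSet.{u}} (hM : M.IsTransitive) (h : pair a b ∈ M) :
    a ∈ M ∧ b ∈ M :=
  have hab : ({a, b} : ZFSet) ∈ M := hM _ h (by simp [pair])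
  ⟨hM _ hab (by simp), hM _ hab (by simp)⟩

theorem memH_range {κ x : ZFSet.{u}} (hκ : ℵ₀ ≤ #κ.toSet) (hx : #x.toSet ≤ #κ.toSet)
    (f : x → ZFSet.{u}) (h : ∀ i, MemH κ (f i)) : MemH κ (ZFSet.range f) := by
  refine memH_of_forall_mem hκ (le_trans ?_ hx) fun y hy => ?_
  · have : (ZFSet.range f).toSet = Set.range f := by ext; exact mem_range
    rw [this]
    exact mk_range_le
  · obtain ⟨i, rfl⟩ := mem_range.1 hy
    exact h i

/-- The set of pairs in `κ × V_κ` that satisfy the relation `R`. -/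
noncomputable def graphOn (κ : ZFSet.{u}) (R : ZFSet.{u} → ZFSet.{u} → Prop) : ZFSet.{u} :=
  ZFSet.sep (fun p => ∃ γ B, p = pair γ B ∧ R γ B) (prod κ (vonNeumann κ.rank))

section Graph

variable {κ : ZFSet.{u}} {R : ZFSet.{u} → ZFSet.{u} → Prop}

theorem pair_mem_graphOn {γ B : ZFSet.{u}} :
    pair γ B ∈ graphOn κ R ↔ γ ∈ κ ∧ MemV κ B ∧ R γ B := by
  rw [graphOn, mem_sep, pair_mem_prod, mem_vonNeumann, and_assoc]
  refine and_congr_right fun _ => and_congr_right fun _ => ⟨?_, fun h => ⟨γ, B, rfl, h⟩⟩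
  rintro ⟨γ', B', h, hR⟩
  obtain ⟨rfl, rfl⟩ := pair_injective h
  exact hR

theorem isPFun_graphOn (hR : ∀ γ A B, R γ A → R γ B → A = B) : IsPFun κ (graphOn κ R) := by
  refine ⟨fun p hp => ?_, fun γ A B hA hB =>
    hR γ A B (pair_mem_graphOn.1 hA).2.2 (pair_mem_graphOn.1 hB).2.2⟩
  obtain ⟨γ, B, rfl, -⟩ := (mem_sep.1 hp).2
  obtain ⟨hγ, hB, -⟩ := pair_mem_graphOn.1 hp
  exact ⟨γ, B, hγ, hB, rfl⟩

end Graph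

theorem LDwc.weakLD2 {κ : ZFSet.{u}} (hκ : IsCard κ) (hin : (#κ.toSet).IsInaccessible)
    (h : LDwc κ) : WeakLD2 κ := by
  obtain ⟨l, hl, hguess⟩ := h
  have hinf := hin.aleph0_lt.le
  let L := graphOn κ fun γ Y => ∃ B, Y = {B} ∧ γ ≠ ∅ ∧ pair γ B ∈ l
  have hL : IsPFun κ L := isPFun_graphOn <| by
    rintro γ _ _ ⟨A, rfl, -, hA⟩ ⟨B, rfl, -, hB⟩
    rw [hl.2 γ A B hA hB]
  have hlL : ∀ γ B z, z ∈ γ → pair γ B ∈ l → pair γ {B} ∈ L := by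
    intro γ B z hz hB
    obtain ⟨γ', B', hγ, hB', hp⟩ := hl.1 _ hB
    obtain ⟨rfl, rfl⟩ := pair_injective hp
    refine pair_mem_graphOn.2 ⟨hγ, ?_, B, rfl, fun h => notMem_empty z (h ▸ hz), hB⟩
    change rank {B} < _
    rw [rank_singleton]
    exact (isSuccLimit_rank hκ hin).succ_lt hB'
  refine ⟨L, hL, fun γ x hx => ?_, fun A M hA hM hLM hAM => ?_⟩
  · obtain ⟨-, -, B, rfl, hγ, -⟩ := pair_mem_graphOn.1 hx
    obtain ⟨z, hz⟩ := (eq_empty_or_nonempty γ).resolve_left hγ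
    have : ({B} : ZFSet).toSet = {B} := by ext; exact mem_singleton
    rw [this, mk_singleton, Cardinal.one_le_iff_ne_zero, mk_ne_zero_iff]
    exact ⟨⟨z, hz⟩⟩
  · obtain ⟨M', hM', hmem⟩ := ((memH_of_isTransitive hinf hM.1 hM.2.1.le).pair hinf
      (hl.memH hκ hin)).exists_nice hκ hin
    obtain ⟨hMM', hlM'⟩ := mem_of_pair_mem_s16 hM'.1 hmem
    have hsub : ∀ x, x ∈ M → x ∈ M' := fun x hx => hM'.1 M hMM' hx
    obtain ⟨N', hN', e, hcrit, hj⟩ :=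
      hguess A M' hA hM'.1 hM'.2.1 hM'.2.2.2 (hsub A hAM) hlM'
    obtain ⟨N, hN, e', he'⟩ := e.exists_restrict hM.1 hM'.1 hN' hMM'
    refine ⟨N, hN, e', he' ▸ hcrit, ?_⟩
    have hD : FODef 2 fun K v => ∀ γ ∈ K, ∀ B ∈ K, ∀ z ∈ K, z ∈ γ → pair γ B ∈ v 0 →
        ∃ s ∈ K, pair γ s ∈ v 1 ∧ B ∈ s :=
      .all (.all (.all (.imp (.mem 4 2) (.imp (.pairMem 2 3 0)
        (.ex (.and (.pairMem 2 5 1) (.mem 3 5)))))))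
    have hT := hD.transfer (transClass_toSet hM'.1) (transClass_toSet hN') e ![l, L]
      (by intro i; fin_cases i; exacts [hlM', hsub L hLM]) (by
        intro γ hγ B hB z hz hzγ hγB
        have := hlL γ B z hzγ hγB
        exact ⟨{B}, (mem_of_pair_mem_s16 hM'.1 (hM'.1 _ (hsub L hLM) this)).2, this, by simp⟩)
    have hjl : e.j l ∈ N' := e.maps l hlM'
    obtain ⟨hκN, hAN⟩ := mem_of_pair_mem_s16 hN' (hN' _ hjl hj)
    obtain ⟨z, hz⟩ : ∃ z, z ∈ κ := by
      obtain ⟨z⟩ := mk_ne_zero_iff.1 hin.ne_zero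
      exact ⟨z, z.2⟩
    obtain ⟨Y, -, hY, hAY⟩ := hT κ hκN A hAN z (hN' κ hκN hz) hz hj
    exact ⟨Y, he' ▸ hY, hAY⟩

theorem WeakLD2.weakLD3 {κ : ZFSet.{u}} (hκ : IsCard κ) (hin : (#κ.toSet).IsInaccessible)
    (h : WeakLD2 κ) : WeakLD3 κ := by
  obtain ⟨L, hL, hcard, hguess⟩ := h
  have hinf := hin.aleph0_lt.le
  have h₀ : MemV κ ∅ := by
    change rank ∅ < _
    rw [rank_empty]
    exact (isSuccLimit_rank hκ hin).bot_lt
  have hg : ∀ γ : ZFSet, ∃ g : ZFSet → ZFSet, (∀ α, MemV κ (g α)) ∧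
      ∀ Y, pair γ Y ∈ L → ∀ A ∈ Y, ∃ α ∈ γ, g α = A := by
    intro γ
    by_cases hγ : ∃ Y, pair γ Y ∈ L
    · obtain ⟨Y, hY⟩ := hγ
      obtain ⟨f⟩ := hcard γ Y hY
      classical
      refine ⟨fun α => if h : ∃ y : Y, (f y : ZFSet) = α then h.choose else ∅, fun α => ?_,
        fun Y' hY' A hA => ?_⟩
      · dsimp only
        split_ifs with h
        · obtain ⟨γ', Y', -, hV, hp⟩ := hL.1 _ hY
          obtain ⟨rfl, rfl⟩ := pair_injective hp
          exact (rank_lt_of_mem h.choose.2).trans hV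
        · exact h₀
      · obtain rfl := hL.2 γ Y Y' hY hY'
        have h : ∃ y : Y, (f y : ZFSet) = f ⟨A, hA⟩ := ⟨⟨A, hA⟩, rfl⟩
        refine ⟨f ⟨A, hA⟩, (f ⟨A, hA⟩).2, ?_⟩
        refine (dif_pos h).trans ?_
        exact congrArg Subtype.val (f.injective (Subtype.ext h.choose_spec))
    · exact ⟨fun _ => ∅, fun _ => h₀, fun Y hY => (hγ ⟨Y, hY⟩).elim⟩
  choose g hgV hgL using hg
  let l : ZFSet → ZFSet := fun α => graphOn κ fun γ B => B = g γ α
  have hl : ∀ α, IsPFun κ (l α) := fun α => isPFun_graphOn fun γ A B hA hB => hA.trans hB.symm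
  let Fam : ZFSet := ZFSet.range fun α : κ => l α
  let F : ZFSet := ZFSet.range fun α : κ => pair α (l α)
  have hκH : MemH κ κ := memH_of_isTransitive hinf hκ.1.isTransitive le_rfl
  have hFH : MemH κ F := memH_range hinf le_rfl _ fun α =>
    (hκH.of_mem α.2).pair hinf ((hl α).memH hκ hin)
  refine ⟨Fam, ?_, ?_, fun A M hA hM hFM hAM => ?_⟩
  · have : Fam.toSet = Set.range fun α : κ => l α := by ext; exact mem_range
    rw [this]
    exact mk_range_le
  · intro f hf
    obtain ⟨α, rfl⟩ := mem_range.1 hf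
    exact ⟨hl α, fun γ hγ => ⟨g γ α, pair_mem_graphOn.2 ⟨hγ, hgV γ α, rfl⟩⟩⟩
  · obtain ⟨M', hM', hmem⟩ := ((memH_of_isTransitive hinf hM.1 hM.2.1.le).pair hinf
      (hFH.pair hinf (hL.memH hκ hin))).exists_nice hκ hin
    obtain ⟨hMM', hmem⟩ := mem_of_pair_mem_s16 hM'.1 hmem
    obtain ⟨hFM', hLM'⟩ := mem_of_pair_mem_s16 hM'.1 hmem
    have hsub : ∀ x, x ∈ M → x ∈ M' := fun x hx => hM'.1 M hMM' hx
    obtain ⟨N', hN', e, hcrit, Y, hY, hAY⟩ := hguess A M' hA hM' hLM' (hsub A hAM)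
    obtain ⟨N, hN, e', he'⟩ := e.exists_restrict hM.1 hM'.1 hN' hMM'
    refine ⟨N, hN, e', he' ▸ hcrit, ?_⟩
    have tM' := transClass_toSet hM'.1
    have tN' := transClass_toSet hN'
    have hD : FODef 2 fun K v => ∀ γ ∈ K, ∀ Y ∈ K, ∀ B ∈ K, pair γ Y ∈ v 0 → B ∈ Y →
        ∃ α ∈ K, ∃ f ∈ K, α ∈ γ ∧ pair α f ∈ v 1 ∧ pair γ B ∈ f :=
      .all (.all (.all (.imp (.pairMem 2 3 0) (.imp (.mem 4 3)
        (.ex (.ex (.and (.mem 5 2) (.and (.pairMem 5 6 1) (.pairMem 2 4 6)))))))))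
    have hT := hD.transfer tM' tN' e ![L, F]
      (by intro i; fin_cases i; exacts [hLM', hFM']) (by
        intro γ hγ Y hY B hB hγY hBY
        obtain ⟨α, hα, rfl⟩ := hgL γ Y hγY B hBY
        obtain ⟨γ', _, hγκ, -, hp⟩ := hL.1 _ hγY
        obtain ⟨rfl, -⟩ := pair_injective hp
        have hακ : α ∈ κ := hκ.1.isTransitive γ hγκ hα
        have hF : pair α (l α) ∈ F := mem_range_self (⟨α, hακ⟩ : κ)
        obtain ⟨hαM, hlM⟩ := mem_of_pair_mem_s16 hM'.1 (hM'.1 _ hFM' hF)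
        exact ⟨α, hαM, l α, hlM, hα, hF, pair_mem_graphOn.2 ⟨hγκ, hgV _ _, rfl⟩⟩)
    have hjL : e.j L ∈ N' := e.maps L hLM'
    have hjF : e.j F ∈ N' := e.maps F hFM'
    obtain ⟨hκN, hYN⟩ := mem_of_pair_mem_s16 hN' (hN' _ hjL hY)
    obtain ⟨α, hαN, f, hfN, hα, hαf, hAf⟩ := hT κ hκN Y hYN A (hN' Y hYN hAY) hY hAY
    have hF : pair α (l α) ∈ F := mem_range_self (⟨α, hα⟩ : κ)
    obtain ⟨hαM, hlM⟩ := mem_of_pair_mem_s16 hM'.1 (hM'.1 _ hFM' hF)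
    have hD₁ : FODef 3 fun _ v => pair (v 0) (v 1) ∈ v 2 := .pairMem 0 1 2
    have h₁ := hD₁.transfer tM' tN' e ![α, l α, F]
      (by intro i; fin_cases i; exacts [hαM, hlM, hFM']) hF
    change pair (e.j α) (e.j (l α)) ∈ e.j F at h₁
    rw [hcrit.2.2 α (hκ.1.mem hα) hα] at h₁
    have hD₂ : FODef 1 fun K v => ∀ α ∈ K, ∀ f ∈ K, ∀ f' ∈ K, pair α f ∈ v 0 →
        pair α f' ∈ v 0 → f = f' :=
      .all (.all (.all (.imp (.pairMem 1 2 0) (.imp (.pairMem 1 3 0) (.eq 2 3)))))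
    have h₂ := hD₂.transfer tM' tN' e ![F] (by intro i; fin_cases i; exact hFM') (by
      intro α _ f _ f' _ hf hf'
      obtain ⟨β, hβ⟩ := mem_range.1 hf
      obtain ⟨β', hβ'⟩ := mem_range.1 hf'
      obtain ⟨rfl, rfl⟩ := pair_injective hβ
      obtain ⟨h, rfl⟩ := pair_injective hβ'
      rw [h])
    have hff : f = e.j (l α) := h₂ α hαN f hfN _ (e.maps _ hlM) hαf h₁
    exact ⟨l α, mem_range_self (⟨α, hα⟩ : κ), by rw [he', ← hff]; exact hAf⟩

theorem WeakLD3.lDwc {κ : ZFSet.{u}} (hκ : IsCard κ) (hin : (#κ.toSet).IsInaccessible)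
    (h : WeakLD3 κ) : LDwc κ := by
  obtain ⟨Fam, ⟨i⟩, hFam, hguess⟩ := h
  have hinf := hin.aleph0_lt.le
  have hc : #Fam.toSet ≤ #κ.toSet := ⟨i⟩
  have hκH : MemH κ κ := memH_of_isTransitive hinf hκ.1.isTransitive le_rfl
  let r : Fam → ZFSet := fun f => graphOn κ fun γ B =>
    ∃ x, pair γ x ∈ (f : ZFSet) ∧ pair (i f) B ∈ x ∧ ∀ B', pair (i f : ZFSet) B' ∈ x → B' = B
  have hr : ∀ f, IsPFun κ (r f) := fun f => isPFun_graphOn <| by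
    rintro γ A B ⟨x, hx, hA, -⟩ ⟨y, hy, -, hB⟩
    obtain rfl := (hFam f f.2).1.2 γ x y hx hy
    exact hB A hA
  by_contra hno
  have hbad : ∀ f : Fam, ∃ A M : ZFSet, MemH κ A ∧ M.IsTransitive ∧ #M.toSet = #κ.toSet ∧
      κ ∈ M ∧ A ∈ M ∧ r f ∈ M ∧ ¬ ∃ N : ZFSet, N.IsTransitive ∧
        ∃ e : ClassEmb M.toSet N.toSet, CritPt e.j κ ∧ pair κ A ∈ e.j (r f) := by
    intro f
    by_contra hf
    refine hno ⟨r f, hr f, fun A M h₁ h₂ h₃ h₄ h₅ h₆ => ?_⟩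
    by_contra hN
    exact hf ⟨A, M, h₁, h₂, h₃, h₄, h₅, h₆, hN⟩
  choose A M hA hM hMc hκM hAM hrM hbad using hbad
  let B : ZFSet := ZFSet.range fun f : Fam => pair (i f) (A f)
  let Ms : ZFSet := ZFSet.range M
  have hB : MemH κ B := memH_range hinf hc _ fun f => (hκH.of_mem (i f).2).pair hinf (hA f)
  have hMs : MemH κ Ms := memH_range hinf hc _ fun f =>
    memH_of_isTransitive hinf (hM f) (hMc f).le
  have hFamH : MemH κ Fam := memH_of_forall_mem hinf hc fun f hf => (hFam f hf).1.memH hκ hin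
  obtain ⟨M', hM', hmem⟩ := (hB.pair hinf (hMs.pair hinf hFamH)).exists_nice hκ hin
  obtain ⟨hBM', hmem⟩ := mem_of_pair_mem_s16 hM'.1 hmem
  obtain ⟨hMsM', hFamM'⟩ := mem_of_pair_mem_s16 hM'.1 hmem
  obtain ⟨N', hN', e, hcrit, f, hf, hj⟩ := hguess B M' hB hM' hFamM' hBM'
  have hMM' : M ⟨f, hf⟩ ∈ M' := hM'.1 _ hMsM' (mem_range_self _)
  have hsub : ∀ x, x ∈ M ⟨f, hf⟩ → x ∈ M' := fun x hx => hM'.1 _ hMM' hx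
  have hfM' : f ∈ M' := hM'.1 _ hFamM' hf
  have hrM' := hsub _ (hrM ⟨f, hf⟩)
  obtain ⟨N, hN, e', he'⟩ := e.exists_restrict (hM _) hM'.1 hN' hMM'
  refine hbad ⟨f, hf⟩ ⟨N, hN, e', he' ▸ hcrit, ?_⟩
  rw [he']
  have hα : (i ⟨f, hf⟩ : ZFSet) ∈ κ := (i ⟨f, hf⟩).2
  have hαM' : (i ⟨f, hf⟩ : ZFSet) ∈ M' := hM'.1 κ hM'.2.2.2 hα
  have hD : FODef 3 fun K v => ∀ γ ∈ K, ∀ x ∈ K, ∀ B ∈ K, pair γ x ∈ v 0 → pair (v 1) B ∈ x →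
      (∀ B' ∈ K, pair (v 1) B' ∈ x → B' = B) → pair γ B ∈ v 2 :=
    .all (.all (.all (.imp (.pairMem 3 4 0) (.imp (.pairMem 1 5 4)
      (.imp (.all (.imp (.pairMem 1 6 4) (.eq 6 5))) (.pairMem 3 5 2))))))
  have hT := hD.transfer (transClass_toSet hM'.1) (transClass_toSet hN') e
    ![f, i ⟨f, hf⟩, r ⟨f, hf⟩]
    (by intro k; fin_cases k; exacts [hfM', hαM', hrM']) (by
      intro γ _ x hx C _ hγx hC huniq
      obtain ⟨γ', x', hγ, hxV, hp⟩ := (hFam f hf).1.1 _ hγx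
      obtain ⟨rfl, rfl⟩ := pair_injective hp
      refine pair_mem_graphOn.2 ⟨hγ, ?_, x, hγx, hC, fun C' hC' =>
        huniq C' (mem_of_pair_mem_s16 hM'.1 (hM'.1 x hx hC')).2 hC'⟩
      have h₁ : C ∈ ({(i ⟨f, hf⟩ : ZFSet), C} : ZFSet) := by simp
      have h₂ : ({(i ⟨f, hf⟩ : ZFSet), C} : ZFSet) ∈ pair (i ⟨f, hf⟩ : ZFSet) C := by simp [pair]
      exact (rank_lt_of_mem h₁).trans ((rank_lt_of_mem h₂).trans ((rank_lt_of_mem hC).trans hxV)))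
  have hjf : e.j f ∈ N' := e.maps f hfM'
  obtain ⟨hκN, hBN⟩ := mem_of_pair_mem_s16 hN' (hN' _ hjf hj)
  have hAB : pair (i ⟨f, hf⟩) (A ⟨f, hf⟩) ∈ B := mem_range_self (⟨f, hf⟩ : Fam)
  have hAN := (mem_of_pair_mem_s16 hN' (hN' B hBN hAB)).2
  refine hT κ hκN B hBN _ hAN hj ?_ ?_
  · change pair (e.j (i ⟨f, hf⟩)) _ ∈ B
    rw [hcrit.2.2 _ (hκ.1.mem hα) hα]
    exact hAB
  · intro C _ hC
    change pair (e.j (i ⟨f, hf⟩)) C ∈ B at hC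
    rw [hcrit.2.2 _ (hκ.1.mem hα) hα] at hC
    obtain ⟨f', hf'⟩ := mem_range.1 hC
    obtain ⟨h, rfl⟩ := pair_injective hf'
    rw [i.injective (Subtype.ext h)]

end LaverDiamond

/-- For an inaccessible cardinal `κ`, the Laver diamond `LD^wc_κ` is equivalent to each
of its weak forms. -/
theorem LDwc_iff_weak_forms (κ : ZFSet.{u}) (hκ : IsCard κ)
    (hin : (Cardinal.mk κ.toSet).IsInaccessible) :
    (LDwc κ ↔ WeakLD2 κ) ∧ (WeakLD2 κ ↔ WeakLD3 κ) := by
  have h₁₂ := LDwc.weakLD2 hκ hin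
  have h₂₃ := WeakLD2.weakLD3 hκ hin
  have h₃₁ := WeakLD3.lDwc hκ hin
  exact ⟨⟨h₁₂, fun h => h₃₁ (h₂₃ h)⟩, ⟨h₂₃, fun h => h₁₂ (h₃₁ h)⟩⟩
end
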